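/- arXiv:1610.00571 — 3 statements merged into one kernel-verified Lean document; each statement's English description precedes it below -/
import Mathlib

section
/- Let G=(V,E) be a finite graph with at least one vertex that admits a tree decomposition (𝒯,𝐓) of width at most w in which every simple path of 𝒯 has at most d edges. Then G admits a nice tree decomposition of width at most w whose tree has every simple path of length at most 2(w+1)(d+2) edges. -/
universe u v

/-- A leaf of a graph: a node with at most one neighbour. -/
def IsTreeLeaf {𝒱 : Type v} (T : SimpleGraph 𝒱) (x : 𝒱) : Prop :=
  (T.neighborSet x).Subsingleton

/-- `(T, B)` is a tree decomposition of the graph with vertex set `V` and edge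
relation `E`. -/
def IsTreeDecomp {V : Type u} {𝒱 : Type v} (E : V → V → Prop) (T : SimpleGraph 𝒱)
    (B : 𝒱 → Finset V) : Prop :=
  T.IsTree ∧ (∀ s t : V, E s t → ∃ x : 𝒱, s ∈ B x ∧ t ∈ B x) ∧
    ∀ s : V, (T.induce {x : 𝒱 | s ∈ B x}).Connected

/-- A nice (rooted) tree decomposition: every leaf has a singleton bag, every vertex
is the bag of some leaf, and along every tree edge one bag is obtained from the other
by adding exactly one vertex. -/
def IsNiceTD {V : Type u} {𝒱 : Type v} [DecidableEq V] (E : V → V → Prop)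
    (T : SimpleGraph 𝒱) (B : 𝒱 → Finset V) (root : 𝒱) : Prop :=
  IsTreeDecomp E T B ∧
  (∀ x : 𝒱, IsTreeLeaf T x → ∃ s : V, B x = {s}) ∧
  (∀ s : V, ∃ x : 𝒱, IsTreeLeaf T x ∧ B x = {s}) ∧
  ∀ x y : 𝒱, T.Adj x y →
    (∃ s : V, s ∉ B x ∧ B y = insert s (B x)) ∨ (∃ s : V, s ∉ B y ∧ B x = insert s (B y))

/-- A depth-first traversal `vs 1, …, vs ℓ` of the rooted tree `T`: it starts and ends
at the root, consecutive nodes are adjacent, and every oriented edge of `T` occurs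
exactly once among consecutive pairs. -/
structure IsDFT {𝒱 : Type v} (T : SimpleGraph 𝒱) (root : 𝒱) (ℓ : ℕ) (vs : ℕ → 𝒱) :
    Prop where
  one_le : 1 ≤ ℓ
  first : vs 1 = root
  last : vs ℓ = root
  adj : ∀ j : ℕ, 1 ≤ j → j < ℓ → T.Adj (vs j) (vs (j + 1))
  once : ∀ a b : 𝒱, T.Adj a b → ∃! j : ℕ, 1 ≤ j ∧ j < ℓ ∧ vs j = a ∧ vs (j + 1) = b

/-- `x` is an ancestor of `y` (w.r.t. `root`): `x` lies on the path from the root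
to `y`.  (In a tree the path between two nodes is unique.) -/
def Anc {𝒱 : Type v} (T : SimpleGraph 𝒱) (root x y : 𝒱) : Prop :=
  ∀ p : T.Walk root y, p.IsPath → x ∈ p.support

/-- `Θ_i`: the set of ancestors of `vs i`. -/
def Theta {𝒱 : Type v} (T : SimpleGraph 𝒱) (root : 𝒱) (vs : ℕ → 𝒱) (i : ℕ) : Set 𝒱 :=
  {x | Anc T root x (vs i)}

/-- `Θ_{≤ i} = ⋃_{1 ≤ j ≤ i} Θ_j`. -/
def ThetaLe {𝒱 : Type v} (T : SimpleGraph 𝒱) (root : 𝒱) (vs : ℕ → 𝒱) (i : ℕ) : Set 𝒱 :=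
  {x | ∃ j : ℕ, 1 ≤ j ∧ j ≤ i ∧ x ∈ Theta T root vs j}

/-- `Ψ_i = ⋃_{x ∈ Θ_i} B x`. -/
def Psi {V : Type u} {𝒱 : Type v} (T : SimpleGraph 𝒱) (root : 𝒱) (vs : ℕ → 𝒱)
    (B : 𝒱 → Finset V) (i : ℕ) : Set V :=
  {s | ∃ x ∈ Theta T root vs i, s ∈ B x}

/-- `Ψ_{≤ i} = ⋃_{1 ≤ j ≤ i} Ψ_j`. -/
def PsiLe {V : Type u} {𝒱 : Type v} (T : SimpleGraph 𝒱) (root : 𝒱) (vs : ℕ → 𝒱)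
    (B : 𝒱 → Finset V) (i : ℕ) : Set V :=
  {s | ∃ j : ℕ, 1 ≤ j ∧ j ≤ i ∧ s ∈ Psi T root vs B j}

/-- `x = n_i(w)`: `x` is the lowest ancestor of `w` belonging to `Θ_{≤ i}`. -/
def LowestAnc {𝒱 : Type v} (T : SimpleGraph 𝒱) (root : 𝒱) (vs : ℕ → 𝒱) (i : ℕ)
    (w x : 𝒱) : Prop :=
  Anc T root x w ∧ x ∈ ThetaLe T root vs i ∧
    ∀ y : 𝒱, Anc T root y w → y ∈ ThetaLe T root vs i → Anc T root y x

/-- `r = r(s)`: the node of `𝒯^s = {x | s ∈ B x}` closest to the root. -/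
def IsBagRoot {V : Type u} {𝒱 : Type v} (T : SimpleGraph 𝒱) (root : 𝒱)
    (B : 𝒱 → Finset V) (s : V) (r : 𝒱) : Prop :=
  s ∈ B r ∧ ∀ x : 𝒱, s ∈ B x → Anc T root r x

/-- `Ψ_{> i-1}(x) = {s ∈ Ψ_{> i-1} | n_i(s) = x}`, where `n_i(s) = n_i(r(s))`. -/
def PsiGtAt {V : Type u} {𝒱 : Type v} (T : SimpleGraph 𝒱) (root : 𝒱) (vs : ℕ → 𝒱)
    (B : 𝒱 → Finset V) (i : ℕ) (x : 𝒱) : Set V :=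
  {s | s ∉ PsiLe T root vs B (i - 1) ∧
    ∃ r : 𝒱, IsBagRoot T root B s r ∧ LowestAnc T root vs i r x}

open SimpleGraph

section Trees

/-- A nonempty graph whose paths have bounded length has a longest path. -/
lemma exists_longest_path {𝒱 : Type*} [Nonempty 𝒱] (T : SimpleGraph 𝒱) (d : ℕ)
    (hdiam : ∀ (a b : 𝒱) (p : T.Walk a b), p.IsPath → p.length ≤ d) :
    ∃ (a b : 𝒱) (p : T.Walk a b), p.IsPath ∧ p.length ≤ d ∧
      ∀ (a' b' : 𝒱) (q : T.Walk a' b'), q.IsPath → q.length ≤ p.length := by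
  induction d with
  | zero =>
    inhabit 𝒱
    exact ⟨default, default, .nil, .nil, le_rfl, fun a b q hq => hdiam a b q hq⟩
  | succ d ih =>
    by_cases h : ∃ (a b : 𝒱) (p : T.Walk a b), p.IsPath ∧ p.length = d + 1
    · obtain ⟨a, b, p, hp, hl⟩ := h
      exact ⟨a, b, p, hp, hl.le, fun a' b' q hq => hl ▸ hdiam a' b' q hq⟩
    · obtain ⟨a, b, p, hp, hl, hmax⟩ := ih fun a b p hp =>
        Nat.lt_succ_iff.mp ((hdiam a b p hp).lt_of_ne fun hl => h ⟨a, b, p, hp, hl⟩)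
      exact ⟨a, b, p, hp, hl.trans d.le_succ, hmax⟩

/-- A tree all of whose paths have at most `d` edges has a node at distance at most
`⌈d / 2⌉` from every node. -/
lemma exists_center {𝒱 : Type*} {T : SimpleGraph 𝒱} (hT : T.IsTree) (d : ℕ)
    (hdiam : ∀ (a b : 𝒱) (p : T.Walk a b), p.IsPath → p.length ≤ d) :
    ∃ c : 𝒱, ∀ (x : 𝒱) (q : T.Walk x c), q.IsPath → 2 * q.length ≤ d + 1 := by
  have := hT.connected.nonempty
  obtain ⟨a, b, p, hp, hpd, hmax⟩ := exists_longest_path T d hdiam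
  refine ⟨p.getVert (p.length / 2), fun x q hq => ?_⟩
  have hA := hT.isAcyclic
  have hsplit := congrArg Walk.edges (p.append_take_drop_eq (p.length / 2))
  have hlt : (p.take (p.length / 2)).length = p.length / 2 := by
    rw [Walk.take_length]; omega
  have hld : (p.drop (p.length / 2)).length = p.length - p.length / 2 := by
    rw [Walk.drop_length]
  have hpath : (q.append (p.drop (p.length / 2))).IsPath ∨
      (q.append (p.take (p.length / 2)).reverse).IsPath := by
    have hnd := hp.isTrail.edges_nodup
    rw [← hsplit, Walk.edges_append] at hnd
    have h₁ := (hA.isPath_iff_isChain _).mp hq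
    have h₂ := (hA.isPath_iff_isChain _).mp (hp.drop (p.length / 2))
    have h₃ := (hA.isPath_iff_isChain _).mp (hp.take (p.length / 2)).reverse
    rw [hA.isPath_iff_isChain, hA.isPath_iff_isChain, Walk.edges_append, Walk.edges_append,
      List.isChain_append, List.isChain_append]
    by_contra! hcon
    obtain ⟨e, he, f, hf, rfl⟩ := hcon.1 h₁ h₂
    obtain ⟨e', he', f', hf', rfl⟩ := hcon.2 h₁ h₃
    obtain rfl : e = e' := Option.some_injective _ (he.symm.trans he')
    have hmem := List.mem_of_mem_head? hf'
    rw [Walk.edges_reverse, List.mem_reverse] at hmem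
    exact List.disjoint_of_nodup_append hnd hmem (List.mem_of_mem_head? hf)
  rcases hpath with h | h
  · have := hmax _ _ _ h
    rw [Walk.length_append] at this
    omega
  · have := hmax _ _ _ h
    rw [Walk.length_append, Walk.length_reverse] at this
    omega

end Trees

section WordTrees

variable {α : Type*}

/-- The tree of all words over `α`: every nonempty word is joined to its tail. -/
def wordGraph (α : Type*) : SimpleGraph (List α) where
  Adj l m := (∃ a, l = a :: m) ∨ ∃ a, m = a :: l
  symm := ⟨fun _ _ h => h.symm⟩
  loopless := ⟨fun l h => by rcases h with ⟨a, h⟩ | ⟨a, h⟩ <;> simpa using congrArg List.length h⟩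

lemma wordGraph_isAcyclic : (wordGraph α).IsAcyclic := by
  have key : ∀ (a : α) (l : List α), (wordGraph α).IsBridge s(a :: l, l) := by
    intro a l
    rw [isBridge_iff]
    rintro ⟨p⟩
    have inv : ∀ {x y : List α}, ((wordGraph α).deleteEdges {s(a :: l, l)}).Walk x y →
        a :: l <:+ x → a :: l <:+ y := by
      intro x y p hx
      induction p with
      | nil => exact hx
      | @cons u v w h p ih =>
        apply ih
        rw [deleteEdges_adj] at h
        obtain ⟨⟨b, rfl⟩ | ⟨b, rfl⟩, hne⟩ := h
        · rcases List.suffix_cons_iff.mp hx with h | h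
          · simp_all
          · exact h
        · exact hx.trans (List.suffix_cons b u)
    have := (inv p List.suffix_rfl).length_le
    simp at this
  rw [isAcyclic_iff_forall_adj_isBridge]
  rintro l m (⟨a, rfl⟩ | ⟨a, rfl⟩)
  · exact key a m
  · exact Sym2.eq_swap ▸ key a l

/-- A word is joined to its suffix within any set of words containing everything between
them. -/
lemma wordGraph_exists_walk_append {X : Set (List α)} {l : List α} (hl : l ∈ X) (u : List α)
    (hX : ∀ v, v <:+ u → v ++ l ∈ X) (hu : u ++ l ∈ X) :
    ∃ p : ((wordGraph α).induce X).Walk ⟨u ++ l, hu⟩ ⟨l, hl⟩, p.length = u.length := by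
  induction u with
  | nil => exact ⟨.nil, rfl⟩
  | cons a u ih =>
    obtain ⟨p, hp⟩ := ih (fun v hv => hX v (hv.trans (List.suffix_cons a u)))
      (hX u (List.suffix_cons a u))
    exact ⟨.cons (Or.inl ⟨a, rfl⟩) p, congrArg (· + 1) hp⟩

lemma wordGraph_induce_exists_walk_nil {S : Set (List α)} (hnil : [] ∈ S)
    (hS : ∀ l m, m ∈ S → l <:+ m → l ∈ S) (l : S) :
    ∃ p : ((wordGraph α).induce S).Walk l ⟨[], hnil⟩, p.length = l.1.length := by
  obtain ⟨p, hp⟩ := wordGraph_exists_walk_append hnil l.1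
    (fun v hv => by simpa using hS v l.1 l.2 hv) (by simp)
  exact ⟨p.copy (by ext1; simp) rfl, by simpa using hp⟩

/-- A set of words containing the empty word and closed under suffixes spans a tree. -/
lemma wordGraph_induce_isTree {S : Set (List α)} (hnil : [] ∈ S)
    (hS : ∀ l m, m ∈ S → l <:+ m → l ∈ S) : ((wordGraph α).induce S).IsTree := by
  refine ⟨?_, wordGraph_isAcyclic.induce S⟩
  rw [connected_iff_exists_forall_reachable]
  exact ⟨⟨[], hnil⟩, fun l => (wordGraph_induce_exists_walk_nil hnil hS l).elim
    fun p _ => p.reachable.symm⟩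

lemma wordGraph_induce_path_length_le {S : Set (List α)} (hnil : [] ∈ S)
    (hS : ∀ l m, m ∈ S → l <:+ m → l ∈ S) {n : ℕ} (hn : ∀ l ∈ S, l.length ≤ n) {a b : S}
    {p : ((wordGraph α).induce S).Walk a b} (hp : p.IsPath) : p.length ≤ 2 * n := by
  classical
  obtain ⟨q, hq⟩ := wordGraph_induce_exists_walk_nil hnil hS a
  obtain ⟨r, hr⟩ := wordGraph_induce_exists_walk_nil hnil hS b
  have := (q.append r.reverse).length_bypass_le_length
  rw [((wordGraph_induce_isTree hnil hS).existsUnique_path a b).unique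
    (q.append r.reverse).bypass_isPath hp, Walk.length_append, Walk.length_reverse] at this
  have := hn _ a.2
  have := hn _ b.2
  omega

end WordTrees

section Saturation

/-- A vertex occurring in a bag may be added to the bag of any adjacent node. -/
lemma IsTreeDecomp.update_insert {V 𝒱 : Type*} [DecidableEq V] [DecidableEq 𝒱]
    {E : V → V → Prop} {T : SimpleGraph 𝒱} {B : 𝒱 → Finset V} (h : IsTreeDecomp E T B)
    {x y : 𝒱} (hxy : T.Adj x y) {s : V} (hs : s ∈ B y) :
    IsTreeDecomp E T (Function.update B x (insert s (B x))) := by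
  obtain ⟨hT, hE, hC⟩ := h
  have hsub : ∀ z, B z ⊆ Function.update B x (insert s (B x)) z := by
    intro z
    by_cases hz : z = x
    · subst hz; simp
    · simp [hz]
  refine ⟨hT, fun a b hab => ?_, fun t => ?_⟩
  · obtain ⟨z, ha, hb⟩ := hE a b hab
    exact ⟨z, hsub z ha, hsub z hb⟩
  · by_cases ht : t = s
    · subst ht
      have : {z | t ∈ Function.update B x (insert t (B x)) z} = {z | t ∈ B z} ∪ {x} := by
        ext z
        by_cases hz : z = x
        · subst hz; simp
        · simp [hz]
      rw [this]
      exact connected_induce_union (hC t).preconnected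
        (IsTree.of_subsingleton).connected.preconnected hs rfl hxy.symm
    · have : {z | t ∈ Function.update B x (insert s (B x)) z} = {z | t ∈ B z} := by
        ext z
        by_cases hz : z = x
        · subst hz; simp [ht]
        · simp [hz]
      rw [this]
      exact hC t

/-- A tree decomposition of width at most `w ≥ 1` of a graph with at least two vertices
can be enlarged so that every bag has at least two elements. -/
lemma IsTreeDecomp.exists_two_le_card {V 𝒱 : Type*} [Fintype V] [Nontrivial V] [Finite 𝒱]
    {E : V → V → Prop} {T : SimpleGraph 𝒱} {B : 𝒱 → Finset V} {w : ℕ}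
    (h : IsTreeDecomp E T B) (hwidth : ∀ x, (B x).card ≤ w + 1) (hw : 1 ≤ w) :
    ∃ B' : 𝒱 → Finset V, IsTreeDecomp E T B' ∧ (∀ x, (B' x).card ≤ w + 1) ∧
      ∀ x, 2 ≤ (B' x).card := by
  classical
  have := Fintype.ofFinite 𝒱
  obtain ⟨B', ⟨hB', hw'⟩, hmax⟩ := Set.exists_max_image
    {B' : 𝒱 → Finset V | IsTreeDecomp E T B' ∧ ∀ x, (B' x).card ≤ w + 1}
    (fun B' => ∑ x, (B' x).card) (Set.toFinite _) ⟨B, h, hwidth⟩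
  have hsat : ∀ x y, T.Adj x y → (B' x).card < w + 1 → B' y ⊆ B' x := by
    intro x y hxy hx s hs
    by_contra hsx
    have hle := hmax _ ⟨hB'.update_insert hxy hs, fun z => by
      by_cases hz : z = x
      · subst hz; simp [hsx]; omega
      · simpa [hz] using hw' z⟩
    refine absurd hle (not_le.mpr (Finset.sum_lt_sum (fun z _ => ?_) ⟨x, Finset.mem_univ x, ?_⟩))
    · by_cases hz : z = x
      · subst hz; simp [hsx]
      · simp [hz]
    · simp [hsx]
  refine ⟨B', hB', hw', fun x => ?_⟩
  by_contra! hx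
  have heq : ∀ y z, T.Walk y z → B' y = B' x → B' z = B' x := by
    intro y z p hy
    induction p with
    | nil => exact hy
    | cons hadj p ih =>
      refine ih ?_
      have h₁ := hsat _ _ hadj (by rw [hy]; omega)
      have h₂ := hsat _ _ hadj.symm ((Finset.card_le_card h₁).trans_lt (by rw [hy]; omega))
      exact (h₁.antisymm h₂).trans hy
  have huniv : B' x = Finset.univ := by
    refine Finset.eq_univ_iff_forall.mpr fun s => ?_
    obtain ⟨z, hz⟩ := (hB'.2.2 s).nonempty
    obtain ⟨p⟩ := hB'.1.connected x z
    exact heq x z p rfl ▸ hz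
  have := Fintype.one_lt_card (α := V)
  rw [huniv, Finset.card_univ] at hx
  omega

end Saturation

section Relabelling

variable {V W 𝒱 : Type*} {E : V → V → Prop} {T : SimpleGraph 𝒱} {B : 𝒱 → Finset V}

lemma IsTreeDecomp.map_equiv (e : V ≃ W) (h : IsTreeDecomp E T B) :
    IsTreeDecomp (fun s t => E (e.symm s) (e.symm t)) T fun x => (B x).map e.toEmbedding := by
  refine ⟨h.1, fun s t hst => ?_, fun s => ?_⟩
  · simpa only [Finset.mem_map_equiv] using h.2.1 _ _ hst
  · have : {x | s ∈ (B x).map e.toEmbedding} = {x | e.symm s ∈ B x} :=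
      Set.ext fun x => Finset.mem_map_equiv
    rw [this]
    exact h.2.2 (e.symm s)

lemma IsNiceTD.map_equiv [DecidableEq V] [DecidableEq W] {root : 𝒱} (e : V ≃ W)
    (h : IsNiceTD E T B root) :
    IsNiceTD (fun s t => E (e.symm s) (e.symm t)) T (fun x => (B x).map e.toEmbedding) root := by
  obtain ⟨hTD, hleaf, hvert, hadj⟩ := h
  refine ⟨hTD.map_equiv e, fun x hx => ?_, fun s => ?_, fun x y hxy => ?_⟩
  · obtain ⟨s, hs⟩ := hleaf x hx
    exact ⟨e s, by simp [hs]⟩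
  · obtain ⟨x, hx, hs⟩ := hvert (e.symm s)
    exact ⟨x, hx, by simp [hs]⟩
  · refine (hadj x y hxy).imp ?_ ?_ <;>
    · rintro ⟨s, hs, heq⟩
      exact ⟨e s, by simpa using hs, by simp [heq, Finset.map_insert]⟩

end Relabelling

section WordBags

variable {V : Type*} [DecidableEq V]

/-- The bag reached from `X` by toggling the vertices of a word, last letter first. -/
def wordBag (X : Finset V) : List (V × Bool) → Finset V
  | [] => X
  | a :: l => symmDiff (wordBag X l) {a.1}

lemma mem_wordBag_append (X : Finset V) {a : List (V × Bool)} (ha : (a.map Prod.fst).Nodup)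
    (l : List (V × Bool)) (s : V) :
    s ∈ wordBag X (a ++ l) ↔ ¬(s ∈ wordBag X l ↔ s ∈ a.map Prod.fst) := by
  induction a with
  | nil => simp
  | cons b a ih =>
    rw [List.map_cons, List.nodup_cons] at ha
    simp only [List.cons_append, wordBag, Finset.mem_symmDiff, ih ha.2, Finset.mem_singleton,
      List.map_cons, List.mem_cons]
    by_cases h : s = b.1
    · subst h; tauto
    · tauto

lemma wordBag_cons (X : Finset V) (a : V × Bool) (l : List (V × Bool)) :
    (∃ s, s ∉ wordBag X l ∧ wordBag X (a :: l) = insert s (wordBag X l)) ∨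
      ∃ s, s ∉ wordBag X (a :: l) ∧ wordBag X l = insert s (wordBag X (a :: l)) := by
  by_cases h : a.1 ∈ wordBag X l
  · refine Or.inr ⟨a.1, by simp [wordBag, Finset.mem_symmDiff, h], ?_⟩
    ext s
    by_cases hs : s = a.1
    · subst hs; simp [h]
    · simp [wordBag, Finset.mem_symmDiff, hs]
  · refine Or.inl ⟨a.1, h, ?_⟩
    ext s
    by_cases hs : s = a.1
    · subst hs; simp [wordBag, Finset.mem_symmDiff, h]
    · simp [wordBag, Finset.mem_symmDiff, hs]

/-- A suffix-closed set of words of bounded length gives a nice tree decomposition as soon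
as its bags cover the edges, its bags containing a given vertex are connected, and its
maximal words are exactly the right leaves. -/
lemma exists_niceTD_of_words {V : Type v} [Finite V] [DecidableEq V] (E : V → V → Prop)
    (X : Finset V) (S : Set (List (V × Bool))) (n k : ℕ) (hnil : [] ∈ S)
    (hS : ∀ l m, m ∈ S → l <:+ m → l ∈ S) (hn : ∀ l ∈ S, l.length ≤ n)
    (hcard : ∀ l ∈ S, (wordBag X l).card ≤ k)
    (hedge : ∀ s t, E s t → ∃ l ∈ S, s ∈ wordBag X l ∧ t ∈ wordBag X l)
    (hconn : ∀ s, ((wordGraph (V × Bool)).induce {l | l ∈ S ∧ s ∈ wordBag X l}).Connected)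
    (hleaf : ∀ l ∈ S, (∃ s, wordBag X l = {s}) ∨ (l ≠ [] ∧ ∃ a, a :: l ∈ S) ∨
      ∃ a b, a ≠ b ∧ a :: l ∈ S ∧ b :: l ∈ S)
    (hvert : ∀ s, ∃ l ∈ S, wordBag X l = {s} ∧ ∀ a, a :: l ∉ S) :
    ∃ (𝒱' : Type v) (_ : Fintype 𝒱') (T' : SimpleGraph 𝒱') (B' : 𝒱' → Finset V)
      (root : 𝒱'), IsNiceTD E T' B' root ∧ (∀ x, (B' x).card ≤ k) ∧
        ∀ (a b : 𝒱') (p : T'.Walk a b), p.IsPath → p.length ≤ 2 * n := by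
  have hfin : Finite S := (List.finite_length_le (V × Bool) n).subset hn
  refine ⟨S, Fintype.ofFinite S, (wordGraph (V × Bool)).induce S, fun l => wordBag X l.1,
    ⟨[], hnil⟩, ⟨⟨wordGraph_induce_isTree hnil hS, fun s t hst => ?_, fun s => ?_⟩,
      ?_, fun s => ?_, ?_⟩, fun l => hcard l.1 l.2,
    fun a b p hp => wordGraph_induce_path_length_le hnil hS hn hp⟩
  · obtain ⟨l, hl, h⟩ := hedge s t hst
    exact ⟨⟨l, hl⟩, h⟩
  · let e : (wordGraph (V × Bool)).induce {l | l ∈ S ∧ s ∈ wordBag X l} ≃g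
        ((wordGraph (V × Bool)).induce S).induce {l : S | s ∈ wordBag X l.1} :=
      { toFun := fun l => ⟨⟨l.1, l.2.1⟩, l.2.2⟩
        invFun := fun l => ⟨l.1.1, l.1.2, l.2⟩
        left_inv := fun _ => rfl
        right_inv := fun _ => rfl
        map_rel_iff' := Iff.rfl }
    exact e.connected_iff.mp (hconn s)
  · rintro ⟨l, hl⟩ hsub
    rcases hleaf l hl with h | ⟨hne, a, ha⟩ | ⟨a, b, hab, ha, hb⟩
    · exact h
    · obtain ⟨b, m, rfl⟩ := List.exists_cons_of_ne_nil hne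
      have := @hsub ⟨_, ha⟩ (Or.inr ⟨a, rfl⟩) ⟨m, hS _ _ hl (List.suffix_cons b m)⟩
        (Or.inl ⟨b, rfl⟩)
      have := congrArg (fun l : S => l.1.length) this
      simp at this
      omega
    · have := @hsub ⟨_, ha⟩ (Or.inr ⟨a, rfl⟩) ⟨_, hb⟩ (Or.inr ⟨b, rfl⟩)
      simp [hab] at this
  · obtain ⟨l, hl, hs, hmax⟩ := hvert s
    refine ⟨⟨l, hl⟩, ?_, hs⟩
    rintro ⟨m, hm⟩ (⟨a, h⟩ | ⟨a, h⟩) ⟨m', hm'⟩ (⟨b, h'⟩ | ⟨b, h'⟩)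
    · have := h.symm.trans h'
      simp at this
      simp [this.2]
    · exact absurd (h' ▸ hm') (hmax b)
    · exact absurd (h ▸ hm) (hmax a)
    · exact absurd (h ▸ hm) (hmax a)
  · rintro ⟨l, hl⟩ ⟨m, hm⟩ (⟨a, h⟩ | ⟨a, h⟩)
    · change l = a :: m at h
      subst h
      exact (wordBag_cons X a m).symm
    · change m = a :: l at h
      subst h
      exact wordBag_cons X a l

end WordBags

section Subdivision

variable {V 𝒱 : Type*}

/-- The word listing the elements of `L` with label `b`. -/
noncomputable def lettersWord (b : Bool) (L : Finset V) : List (V × Bool) :=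
  L.toList.map fun s => (s, b)

lemma map_fst_lettersWord (b : Bool) (L : Finset V) :
    (lettersWord b L).map Prod.fst = L.toList := by
  simp [lettersWord, Function.comp_def]

variable [DecidableEq V]

/-- The word that leads from the bag `X` to the bag `Y`: remove `X \ Y`, then add `Y \ X`. -/
noncomputable def chainWord (X Y : Finset V) : List (V × Bool) :=
  lettersWord false (Y \ X) ++ lettersWord false (X \ Y)

/-- The word that leads from the bag `X` to the bag `{s}`. -/
noncomputable def leafWord (X : Finset V) (s : V) : List (V × Bool) :=
  lettersWord true (X.erase s)

/-- The word that leads from the bag of the last node of a walk to the bag of its first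
node. -/
noncomputable def walkWord {T : SimpleGraph 𝒱} (B : 𝒱 → Finset V) :
    ∀ {x c : 𝒱}, T.Walk x c → List (V × Bool)
  | _, _, .nil => []
  | x, _, .cons (v := y) _ p => chainWord (B y) (B x) ++ walkWord B p

/-- The words occurring on the way from the bag of `c` to a singleton contained in some
bag. -/
def nodeWords (T : SimpleGraph 𝒱) (B : 𝒱 → Finset V) (c : 𝒱) : Set (List (V × Bool)) :=
  {l | ∃ (x : 𝒱) (p : T.Walk x c) (s : V), p.IsPath ∧ s ∈ B x ∧
    l <:+ leafWord (B x) s ++ walkWord B p}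

lemma mem_map_fst_chainWord {X Y : Finset V} {s : V} :
    s ∈ (chainWord X Y).map Prod.fst ↔ s ∈ Y \ X ∨ s ∈ X \ Y := by
  rw [chainWord, List.map_append, List.mem_append, map_fst_lettersWord, map_fst_lettersWord,
    Finset.mem_toList, Finset.mem_toList]

lemma nodup_map_fst_chainWord (X Y : Finset V) : ((chainWord X Y).map Prod.fst).Nodup := by
  rw [chainWord, List.map_append, map_fst_lettersWord, map_fst_lettersWord]
  refine (Finset.nodup_toList _).append (Finset.nodup_toList _) fun s h₁ h₂ => ?_
  simp only [Finset.mem_toList, Finset.mem_sdiff] at h₁ h₂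
  exact h₁.2 h₂.1

lemma mem_map_fst_leafWord {X : Finset V} {s t : V} :
    t ∈ (leafWord X s).map Prod.fst ↔ t ≠ s ∧ t ∈ X := by
  rw [leafWord, map_fst_lettersWord, Finset.mem_toList, Finset.mem_erase]

lemma nodup_map_fst_leafWord (X : Finset V) (s : V) : ((leafWord X s).map Prod.fst).Nodup := by
  rw [leafWord, map_fst_lettersWord]
  exact Finset.nodup_toList _

lemma length_leafWord {X : Finset V} {s : V} (hs : s ∈ X) :
    (leafWord X s).length = X.card - 1 := by
  simp [leafWord, lettersWord, hs]

lemma length_chainWord_le {X Y : Finset V} {k : ℕ} (hX : X.card ≤ k) (hY : Y.card ≤ k) :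
    (chainWord X Y).length ≤ 2 * k := by
  have h₁ := Finset.card_le_card (Finset.sdiff_subset (s := X) (t := Y))
  have h₂ := Finset.card_le_card (Finset.sdiff_subset (s := Y) (t := X))
  simp only [chainWord, lettersWord, List.length_append, List.length_map, Finset.length_toList]
  omega

lemma List.suffix_append_cases {α : Type*} {l a b : List α} (h : l <:+ a ++ b) :
    l <:+ b ∨ ∃ a', a' <:+ a ∧ l = a' ++ b := by
  rcases List.suffix_or_suffix_of_suffix h (List.suffix_append a b) with h' | ⟨t, rfl⟩
  · exact Or.inl h'
  · exact Or.inr ⟨t, List.suffix_append_self_iff.mp h, rfl⟩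

lemma mem_wordBag_leafWord (Z X : Finset V) (s t : V) {a l : List (V × Bool)}
    (hl : wordBag Z l = X) (ha : a <:+ leafWord X s) :
    t ∈ wordBag Z (a ++ l) ↔ t ∈ X ∧ t ∉ a.map Prod.fst := by
  have hsuf := ha.map Prod.fst
  rw [mem_wordBag_append Z ((nodup_map_fst_leafWord X s).sublist hsuf.sublist), hl]
  have : t ∈ a.map Prod.fst → t ∈ X := fun h => (mem_map_fst_leafWord.mp (hsuf.subset h)).2
  tauto

lemma wordBag_leafWord_append (Z X : Finset V) {s : V} (hs : s ∈ X) {l : List (V × Bool)}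
    (hl : wordBag Z l = X) : wordBag Z (leafWord X s ++ l) = {s} := by
  ext t
  rw [mem_wordBag_leafWord Z X s t hl List.suffix_rfl, mem_map_fst_leafWord,
    Finset.mem_singleton]
  by_cases h : t = s
  · subst h; simp [hs]
  · tauto

lemma mem_wordBag_chainWord (Z X Y : Finset V) {a l : List (V × Bool)}
    (hl : wordBag Z l = X) (ha : a <:+ chainWord X Y) (t : V) :
    t ∈ wordBag Z (a ++ l) ↔ ¬(t ∈ X ↔ t ∈ a.map Prod.fst) := by
  rw [mem_wordBag_append Z
    ((nodup_map_fst_chainWord X Y).sublist (ha.map Prod.fst).sublist), hl]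

lemma wordBag_chainWord_append (Z X Y : Finset V) {l : List (V × Bool)}
    (hl : wordBag Z l = X) : wordBag Z (chainWord X Y ++ l) = Y := by
  ext t
  rw [mem_wordBag_chainWord Z X Y hl List.suffix_rfl, mem_map_fst_chainWord]
  simp only [Finset.mem_sdiff]
  tauto

/-- The bags along the word leading from `X` to `Y` either shrink from `X` or
grow towards `Y`. -/
lemma chainWord_suffix_cases {X Y : Finset V} {a : List (V × Bool)} (ha : a <:+ chainWord X Y) :
    (∀ t ∈ a.map Prod.fst, t ∈ X \ Y) ∨ ∀ t ∈ X \ Y, t ∈ a.map Prod.fst := by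
  rcases List.suffix_append_cases ha with h | ⟨b, -, rfl⟩
  · left
    intro t ht
    simpa only [map_fst_lettersWord, Finset.mem_toList] using (h.map Prod.fst).subset ht
  · right
    intro t ht
    simp [List.map_append, map_fst_lettersWord, Finset.mem_sdiff.mp ht]

variable {T : SimpleGraph 𝒱} {B : 𝒱 → Finset V} {c : 𝒱}

lemma wordBag_walkWord {x : 𝒱} (p : T.Walk x c) : wordBag (B c) (walkWord B p) = B x := by
  induction p with
  | nil => rfl
  | cons h p ih => exact wordBag_chainWord_append _ _ _ ih

lemma length_walkWord_le {k : ℕ} (hk : ∀ x, (B x).card ≤ k) {x : 𝒱} (p : T.Walk x c) :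
    (walkWord B p).length ≤ 2 * k * p.length := by
  induction p with
  | nil => simp [walkWord]
  | @cons u v _ h p ih =>
    have := length_chainWord_le (hk v) (hk u)
    rw [walkWord, List.length_append, Walk.length_cons]
    linarith

lemma snd_of_mem_walkWord {x : 𝒱} (p : T.Walk x c) {a : V × Bool} (ha : a ∈ walkWord B p) :
    a.2 = false := by
  induction p with
  | nil => simp [walkWord] at ha
  | cons h p ih =>
    simp only [walkWord, chainWord, lettersWord, List.mem_append, List.mem_map] at ha
    rcases ha with (⟨s, -, rfl⟩ | ⟨s, -, rfl⟩) | ha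
    · rfl
    · rfl
    · exact ih ha

lemma snd_of_mem_leafWord {X : Finset V} {s : V} {a : V × Bool} (ha : a ∈ leafWord X s) :
    a.2 = true := by
  simp only [leafWord, lettersWord, List.mem_map] at ha
  obtain ⟨t, -, rfl⟩ := ha
  rfl

lemma leafWord_ne_nil {X : Finset V} {s : V} (hs : s ∈ X) (hX : 2 ≤ X.card) :
    leafWord X s ≠ [] := by
  have := length_leafWord hs
  intro h
  rw [h, List.length_nil] at this
  omega

lemma nodeWords_suffix_closed (l m : List (V × Bool)) (hm : m ∈ nodeWords T B c)
    (h : l <:+ m) : l ∈ nodeWords T B c := by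
  obtain ⟨x, p, s, hp, hs, hl⟩ := hm
  exact ⟨x, p, s, hp, hs, h.trans hl⟩

lemma walkWord_mem_nodeWords {x : 𝒱} {p : T.Walk x c} (hp : p.IsPath) {s : V} (hs : s ∈ B x) :
    walkWord B p ∈ nodeWords T B c :=
  ⟨x, p, s, hp, hs, List.suffix_append _ _⟩

lemma suffix_walkWord_cases {x : 𝒱} {p : T.Walk x c} (hp : p.IsPath) {l : List (V × Bool)}
    (hl : l <:+ walkWord B p) : l = [] ∨ ∃ (x y : 𝒱) (h : T.Adj x y) (q : T.Walk y c),
      (Walk.cons h q).IsPath ∧ ∃ a, a <:+ chainWord (B y) (B x) ∧ l = a ++ walkWord B q := by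
  induction p with
  | nil => exact Or.inl (List.suffix_nil.mp hl)
  | cons h p ih =>
    rcases List.suffix_append_cases hl with h' | ⟨a, ha, rfl⟩
    · exact ih hp.of_cons h'
    · exact Or.inr ⟨_, _, h, p, hp, a, ha, rfl⟩

/-- A node of the subdivided tree lies on the way from a node of `T` to a leaf, or on the
way from a node of `T` to one of its children. -/
lemma nodeWords_cases {l : List (V × Bool)} (hl : l ∈ nodeWords T B c) (hc : (B c).Nonempty) :
    (∃ (x : 𝒱) (p : T.Walk x c) (s : V), p.IsPath ∧ s ∈ B x ∧
      ∃ a, a <:+ leafWord (B x) s ∧ l = a ++ walkWord B p) ∨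
    ∃ (x y : 𝒱) (h : T.Adj x y) (q : T.Walk y c),
      (Walk.cons h q).IsPath ∧ ∃ a, a <:+ chainWord (B y) (B x) ∧ l = a ++ walkWord B q := by
  obtain ⟨x, p, s, hp, hs, hl⟩ := hl
  rcases List.suffix_append_cases hl with h | ⟨a, ha, rfl⟩
  · rcases suffix_walkWord_cases hp h with rfl | h
    · obtain ⟨t, ht⟩ := hc
      exact Or.inl ⟨c, .nil, t, .nil, ht, [], List.nil_suffix, rfl⟩
    · exact Or.inr h
  · exact Or.inl ⟨x, p, s, hp, hs, a, ha, rfl⟩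

lemma card_wordBag_le {k : ℕ} (hk : ∀ x, (B x).card ≤ k) (hc : (B c).Nonempty)
    {l : List (V × Bool)} (hl : l ∈ nodeWords T B c) : (wordBag (B c) l).card ≤ k := by
  rcases nodeWords_cases hl hc with ⟨x, p, s, -, -, a, ha, rfl⟩ | ⟨x, y, h, q, -, a, ha, rfl⟩
  · refine (Finset.card_le_card fun t ht => ?_).trans (hk x)
    exact ((mem_wordBag_leafWord _ _ s t (wordBag_walkWord p) ha).mp ht).1
  · have hmem := mem_wordBag_chainWord _ _ _ (wordBag_walkWord q) ha
    rcases chainWord_suffix_cases ha with hsub | hsub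
    · refine (Finset.card_le_card fun t ht => ?_).trans (hk y)
      have := hsub t
      have := (hmem t).mp ht
      simp only [Finset.mem_sdiff] at *
      tauto
    · refine (Finset.card_le_card fun t ht => ?_).trans (hk x)
      have h₁ := hsub t
      have h₂ := (hmem t).mp ht
      have h₃ : t ∈ a.map Prod.fst → _ := fun h =>
        mem_map_fst_chainWord.mp ((ha.map Prod.fst).subset h)
      simp only [Finset.mem_sdiff] at h₁ h₃
      tauto

lemma length_le_of_mem_nodeWords {k h : ℕ} (hk : ∀ x, (B x).card ≤ k + 1)
    (hh : ∀ (x : 𝒱) (q : T.Walk x c), q.IsPath → q.length ≤ h) {l : List (V × Bool)}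
    (hl : l ∈ nodeWords T B c) : l.length ≤ 2 * (k + 1) * h + k := by
  obtain ⟨x, p, s, hp, hs, hl⟩ := hl
  have h₁ := hl.length_le
  rw [List.length_append, length_leafWord hs] at h₁
  have h₂ := length_walkWord_le hk p
  have h₃ := Nat.mul_le_mul_left (2 * (k + 1)) (hh x p hp)
  have h₄ := hk x
  omega

/-- Every word leading to a singleton bag is maximal. -/
lemma cons_leafWord_notMem_nodeWords {x : 𝒱} (p : T.Walk x c) {s : V} (hs : s ∈ B x)
    (hx : 2 ≤ (B x).card) (b : V × Bool) :
    b :: (leafWord (B x) s ++ walkWord B p) ∉ nodeWords T B c := by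
  rintro ⟨y, q, t, -, ht, h⟩
  obtain ⟨u, hu⟩ := List.exists_mem_of_ne_nil _ (leafWord_ne_nil hs hx)
  have hnot : ∀ {m}, b :: (leafWord (B x) s ++ walkWord B p) = m → ¬ m <:+ walkWord B q := by
    rintro m rfl h'
    have := snd_of_mem_walkWord q (h'.subset (List.mem_cons_of_mem _ (List.mem_append_left _ hu)))
    simp [snd_of_mem_leafWord hu] at this
  rcases List.suffix_append_cases h with h' | ⟨a, ha, heq⟩
  · exact hnot rfl h'
  · obtain _ | ⟨b', a⟩ := a
    · exact hnot heq List.suffix_rfl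
    · rw [List.cons_append, List.cons.injEq] at heq
      have hfilter := congrArg (List.filter fun z => !z.2) heq.2
      have htrue : ∀ m : List (V × Bool), (∀ z ∈ m, z.2 = true) →
          m.filter (fun z => !z.2) = [] := by
        intro m hm
        simpa [List.filter_eq_nil_iff] using fun z w hz => hm (z, w) hz
      have hfalse : ∀ m : List (V × Bool), (∀ z ∈ m, z.2 = false) →
          m.filter (fun z => !z.2) = m := by
        intro m hm
        simpa [List.filter_eq_self] using fun z w hz => hm (z, w) hz
      rw [List.filter_append, List.filter_append, htrue _ fun z hz => snd_of_mem_leafWord hz,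
        htrue a fun z hz => snd_of_mem_leafWord (ha.subset (List.mem_cons_of_mem _ hz)),
        hfalse _ fun z hz => snd_of_mem_walkWord p hz,
        hfalse _ fun z hz => snd_of_mem_walkWord q hz, List.nil_append, List.nil_append] at hfilter
      have hB : B x = B y := by
        rw [← wordBag_walkWord (B := B) p, ← wordBag_walkWord (B := B) q, hfilter]
      have h₁ := congrArg List.length heq.2
      have h₂ := ha.length_le
      rw [List.length_append, List.length_append, hfilter, length_leafWord hs] at h₁
      rw [List.length_cons, length_leafWord ht, ← hB] at h₂
      omega

lemma nodeWords_leaf (h2 : ∀ x, 2 ≤ (B x).card) {l : List (V × Bool)}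
    (hl : l ∈ nodeWords T B c) : (∃ s, wordBag (B c) l = {s}) ∨
      (l ≠ [] ∧ ∃ a, a :: l ∈ nodeWords T B c) ∨
      ∃ a b, a ≠ b ∧ a :: l ∈ nodeWords T B c ∧ b :: l ∈ nodeWords T B c := by
  by_cases hnil : l = []
  · subst hnil
    have hfirst : ∀ s ∈ B c, ∃ u ∈ B c, u ≠ s ∧ [(u, true)] ∈ nodeWords T B c := by
      intro s hs
      obtain ⟨m, z, hm⟩ := (leafWord (B c) s).eq_nil_or_concat.resolve_left
        (leafWord_ne_nil hs (h2 c))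
      have hz : z ∈ leafWord (B c) s := by simp [hm]
      have h₁ := mem_map_fst_leafWord.mp (List.mem_map_of_mem (f := Prod.fst) hz)
      have h₂ := snd_of_mem_leafWord hz
      refine ⟨z.1, h₁.2, h₁.1, c, .nil, s, .nil, hs, ?_⟩
      rw [← h₂, walkWord, List.append_nil, hm]
      simp
    obtain ⟨s, hs⟩ := Finset.card_pos.mp (Nat.zero_lt_two.trans_le (h2 c))
    obtain ⟨u, hu, -, hu'⟩ := hfirst s hs
    obtain ⟨u', -, hne, hu''⟩ := hfirst u hu
    exact Or.inr (Or.inr ⟨(u, true), (u', true), by simpa using hne.symm, hu', hu''⟩)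
  · obtain ⟨x, p, s, hp, hs, t, ht⟩ := hl
    rcases t.eq_nil_or_concat with rfl | ⟨t, b, rfl⟩
    · rw [List.nil_append] at ht
      exact Or.inl ⟨s, ht ▸ wordBag_leafWord_append _ _ hs (wordBag_walkWord p)⟩
    · exact Or.inr (Or.inl ⟨hnil, b, x, p, s, hp, hs, t, by simpa using ht⟩)

/-- The words of `nodeWords T B c` whose bag contains `s`. -/
def nodeWordsAt (T : SimpleGraph 𝒱) (B : 𝒱 → Finset V) (c : 𝒱) (s : V) :
    Set (List (V × Bool)) :=
  {l | l ∈ nodeWords T B c ∧ s ∈ wordBag (B c) l}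

/-- Two words of `nodeWordsAt T B c s` are joined within this set. -/
def JoinedAt (T : SimpleGraph 𝒱) (B : 𝒱 → Finset V) (c : 𝒱) (s : V)
    (l m : List (V × Bool)) : Prop :=
  ∃ (hl : l ∈ nodeWordsAt T B c s) (hm : m ∈ nodeWordsAt T B c s),
    ((wordGraph (V × Bool)).induce (nodeWordsAt T B c s)).Reachable ⟨l, hl⟩ ⟨m, hm⟩

lemma JoinedAt.symm {s : V} {l m : List (V × Bool)} (h : JoinedAt T B c s l m) :
    JoinedAt T B c s m l :=
  ⟨h.2.1, h.1, h.2.2.symm⟩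

lemma JoinedAt.trans {s : V} {l m n : List (V × Bool)} (h : JoinedAt T B c s l m)
    (h' : JoinedAt T B c s m n) : JoinedAt T B c s l n :=
  ⟨h.1, h'.2.1, h.2.2.trans h'.2.2⟩

lemma joinedAt_append {s : V} {u l : List (V × Bool)} (hu : u ++ l ∈ nodeWords T B c)
    (hs : ∀ v, v <:+ u → s ∈ wordBag (B c) (v ++ l)) : JoinedAt T B c s (u ++ l) l := by
  have hmem : ∀ v, v <:+ u → v ++ l ∈ nodeWordsAt T B c s := fun v hv =>
    ⟨nodeWords_suffix_closed _ _ hu (List.suffix_append_self_iff.mpr hv), hs v hv⟩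
  have hl : l ∈ nodeWordsAt T B c s := hmem [] List.nil_suffix
  obtain ⟨p, -⟩ := wordGraph_exists_walk_append hl u hmem (hmem u List.suffix_rfl)
  exact ⟨_, hl, p.reachable⟩

/-- Every word whose bag contains `s` is joined to the word of a node of `T` whose bag
contains `s`. -/
lemma exists_joinedAt_walkWord (hc : (B c).Nonempty) {s : V} {l : List (V × Bool)}
    (hl : l ∈ nodeWordsAt T B c s) : ∃ (x : 𝒱) (p : T.Walk x c), p.IsPath ∧ s ∈ B x ∧
      JoinedAt T B c s l (walkWord B p) := by
  obtain ⟨hl, hs⟩ := hl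
  rcases nodeWords_cases hl hc with ⟨x, p, r, hp, -, a, ha, rfl⟩ | ⟨x, y, h, q, hq, a, ha, rfl⟩
  · have hmem := fun {a} => mem_wordBag_leafWord (a := a) _ _ r s (wordBag_walkWord (B := B) p)
    have hsa := (hmem ha).mp hs
    refine ⟨x, p, hp, hsa.1, joinedAt_append hl fun v hv => (hmem (hv.trans ha)).mpr
      ⟨hsa.1, fun h => hsa.2 ((hv.map Prod.fst).subset h)⟩⟩
  · have hmem := fun {a} ha =>
      mem_wordBag_chainWord (a := a) _ _ (B x) (wordBag_walkWord (B := B) q) ha s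
    have hsa := (hmem ha).mp hs
    rcases chainWord_suffix_cases ha with hsub | hsub
    · have hsub := hsub s
      simp only [Finset.mem_sdiff] at hsub
      refine ⟨y, q, hq.of_cons, by tauto, joinedAt_append hl fun v hv =>
        (hmem (hv.trans ha)).mpr ?_⟩
      have : s ∈ v.map Prod.fst → s ∈ a.map Prod.fst := fun h => (hv.map Prod.fst).subset h
      tauto
    · have hsub := hsub s
      have hchain : s ∈ a.map Prod.fst → _ := fun h =>
        mem_map_fst_chainWord.mp ((ha.map Prod.fst).subset h)
      simp only [Finset.mem_sdiff] at hsub hchain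
      have hsx : s ∈ B x := by tauto
      refine ⟨x, .cons h q, hq, hsx, JoinedAt.symm ?_⟩
      obtain ⟨t, ht⟩ := ha
      have hw : walkWord B (.cons h q) = t ++ (a ++ walkWord B q) := by
        rw [walkWord, ← ht, List.append_assoc]
      rw [hw]
      refine joinedAt_append (hw ▸ walkWord_mem_nodeWords hq hsx) fun v hv => ?_
      have hva : v ++ a <:+ chainWord (B y) (B x) :=
        ht ▸ List.suffix_append_self_iff.mpr hv
      rw [← List.append_assoc, hmem hva]
      have h₁ : s ∈ a.map Prod.fst → s ∈ (v ++ a).map Prod.fst := fun h => by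
        rw [List.map_append]
        exact List.mem_append_right _ h
      have h₂ : s ∈ (v ++ a).map Prod.fst → _ := fun h =>
        mem_map_fst_chainWord.mp ((hva.map Prod.fst).subset h)
      simp only [Finset.mem_sdiff] at h₂
      tauto

lemma joinedAt_walkWord_cons {x y : 𝒱} (h : T.Adj x y) {q : T.Walk y c}
    (hq : (Walk.cons h q).IsPath) {s : V} (hx : s ∈ B x) (hy : s ∈ B y) :
    JoinedAt T B c s (walkWord B (.cons h q)) (walkWord B q) := by
  refine joinedAt_append (walkWord_mem_nodeWords hq hx) fun v hv => ?_
  rw [mem_wordBag_chainWord _ _ _ (wordBag_walkWord q) hv s]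
  have h₂ : s ∈ v.map Prod.fst → _ := fun h =>
    mem_map_fst_chainWord.mp ((hv.map Prod.fst).subset h)
  simp only [Finset.mem_sdiff] at h₂
  tauto

lemma joinedAt_walkWord_of_adj (hT : T.IsTree) {x y : 𝒱} (h : T.Adj x y) {p : T.Walk x c}
    {q : T.Walk y c} (hp : p.IsPath) (hq : q.IsPath) {s : V} (hx : s ∈ B x) (hy : s ∈ B y) :
    JoinedAt T B c s (walkWord B p) (walkWord B q) := by
  by_cases hxq : x ∈ q.support
  · have hyp : y ∉ p.support := by
      simpa using hT.isAcyclic.ne_mem_support_of_support_of_adj_of_isPath hq.reverse hp.reverse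
        h.symm (by simpa using hxq)
    have hcons : (Walk.cons h.symm p).IsPath := hp.cons hyp
    rw [(hT.existsUnique_path y c).unique hq hcons]
    exact (joinedAt_walkWord_cons h.symm hcons hy hx).symm
  · have hcons : (Walk.cons h q).IsPath := hq.cons hxq
    rw [(hT.existsUnique_path x c).unique hp hcons]
    exact joinedAt_walkWord_cons h hcons hx hy

lemma joinedAt_walkWord_of_walk (hT : T.IsTree) {s : V} {x y : {x | s ∈ B x}}
    (r : (T.induce {x | s ∈ B x}).Walk x y) {p : T.Walk x c} {q : T.Walk y c} (hp : p.IsPath)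
    (hq : q.IsPath) : JoinedAt T B c s (walkWord B p) (walkWord B q) := by
  induction r with
  | @nil x =>
    rw [(hT.existsUnique_path x.1 c).unique hp hq]
    have : walkWord B q ∈ nodeWordsAt T B c s :=
      ⟨walkWord_mem_nodeWords hq x.2, by rw [wordBag_walkWord q]; exact x.2⟩
    exact ⟨this, this, .refl _⟩
  | @cons x z y h r ih =>
    obtain ⟨p', hp', -⟩ := hT.existsUnique_path z.1 c
    exact (joinedAt_walkWord_of_adj hT h hp hp' x.2 z.2).trans (ih hp' hq)

lemma nodeWordsAt_connected {E : V → V → Prop} (hTD : IsTreeDecomp E T B)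
    (hc : (B c).Nonempty) (s : V) :
    ((wordGraph (V × Bool)).induce (nodeWordsAt T B c s)).Connected := by
  obtain ⟨hT, -, hC⟩ := hTD
  obtain ⟨x⟩ := (hC s).nonempty
  obtain ⟨p, hp, -⟩ := hT.existsUnique_path x.1 c
  obtain ⟨hmem, -⟩ := joinedAt_walkWord_of_walk hT (.nil : (T.induce _).Walk x x) hp hp
  rw [connected_iff_exists_forall_reachable]
  refine ⟨⟨_, hmem⟩, fun ⟨l, hl⟩ => ?_⟩
  obtain ⟨y, q, hq, hy, hlq⟩ := exists_joinedAt_walkWord hc hl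
  obtain ⟨r⟩ := (hC s).preconnected ⟨y, hy⟩ x
  exact (hlq.trans (joinedAt_walkWord_of_walk hT r hq hp)).2.2.symm

end Subdivision

section Existence

variable {V : Type v} [Fintype V] [DecidableEq V] {E : V → V → Prop}

/-- A graph with a single vertex has a nice tree decomposition with a single node. -/
lemma exists_niceTD_of_subsingleton [Nonempty V] [Subsingleton V] (n w : ℕ) :
    ∃ (𝒱' : Type v) (_ : Fintype 𝒱') (T' : SimpleGraph 𝒱') (B' : 𝒱' → Finset V)
      (root : 𝒱'), IsNiceTD E T' B' root ∧ (∀ x, (B' x).card ≤ w + 1) ∧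
        ∀ (a b : 𝒱') (p : T'.Walk a b), p.IsPath → p.length ≤ 2 * n := by
  inhabit V
  have hbag : ∀ s : V, wordBag ({default} : Finset V) [] = {s} := fun s => by
    rw [Subsingleton.elim s default, wordBag]
  refine exists_niceTD_of_words E {default} {[]} n (w + 1) rfl (fun l m hm hl => ?_)
    (by simp) (by simp [wordBag]) (fun s t _ => ⟨[], rfl, ?_⟩) (fun s => ?_)
    (fun l hl => Or.inl ⟨default, ?_⟩) (fun s => ⟨[], rfl, hbag s, by simp⟩)
  · obtain rfl : m = [] := hm
    exact List.suffix_nil.mp hl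
  · simp [wordBag, Subsingleton.elim s t, Subsingleton.elim default t]
  · have : {l | l ∈ ({[]} : Set (List (V × Bool))) ∧ s ∈ wordBag {default} l} = {[]} := by
      ext l
      simp only [Set.mem_singleton_iff, Set.mem_ofPred_eq, and_iff_left_iff_imp]
      rintro rfl
      simp [hbag s]
    rw [this]
    exact IsTree.of_subsingleton.connected
  · obtain rfl : l = [] := hl
    rfl

/-- A graph without edges between distinct vertices has a nice tree decomposition whose
tree is a star with empty central bag. -/
lemma exists_niceTD_of_edgeless [Nontrivial V] (hE : ∀ s t, E s t → s = t) (n w : ℕ)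
    (hn : 1 ≤ n) :
    ∃ (𝒱' : Type v) (_ : Fintype 𝒱') (T' : SimpleGraph 𝒱') (B' : 𝒱' → Finset V)
      (root : 𝒱'), IsNiceTD E T' B' root ∧ (∀ x, (B' x).card ≤ w + 1) ∧
        ∀ (a b : 𝒱') (p : T'.Walk a b), p.IsPath → p.length ≤ 2 * n := by
  have hbag : ∀ s : V, wordBag (∅ : Finset V) [(s, true)] = {s} := fun s => by
    ext t
    simp [wordBag, Finset.mem_symmDiff]
  refine exists_niceTD_of_words E ∅ {l | l = [] ∨ ∃ s : V, l = [(s, true)]} n (w + 1)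
    (Or.inl rfl) (fun l m hm hl => ?_) (fun l hl => ?_) (fun l hl => ?_)
    (fun s t hst => ⟨[(s, true)], Or.inr ⟨s, rfl⟩, ?_⟩) (fun s => ?_) (fun l hl => ?_)
    (fun s => ⟨[(s, true)], Or.inr ⟨s, rfl⟩, hbag s, by simp⟩)
  · rcases hm with rfl | ⟨s, rfl⟩
    · exact Or.inl (List.suffix_nil.mp hl)
    · rcases List.suffix_cons_iff.mp hl with h | h
      · exact Or.inr ⟨s, h⟩
      · exact Or.inl (List.suffix_nil.mp h)
  · rcases hl with rfl | ⟨s, rfl⟩ <;> simp [hn]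
  · rcases hl with rfl | ⟨s, rfl⟩
    · simp [wordBag]
    · simp [hbag]
  · simp [hbag, hE s t hst]
  · have : {l | l ∈ {l : List (V × Bool) | l = [] ∨ ∃ s : V, l = [(s, true)]} ∧
        s ∈ wordBag ∅ l} = {[(s, true)]} := by
      ext l
      constructor
      · rintro ⟨rfl | ⟨t, rfl⟩, hs⟩
        · simp [wordBag] at hs
        · rw [hbag, Finset.mem_singleton] at hs
          simp [hs]
      · rintro rfl
        exact ⟨Or.inr ⟨s, rfl⟩, by simp [hbag]⟩
    rw [this]
    exact IsTree.of_subsingleton.connected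
  · rcases hl with rfl | ⟨s, rfl⟩
    · obtain ⟨a, b, hab⟩ := exists_pair_ne V
      exact Or.inr (Or.inr ⟨(a, true), (b, true), by simpa using hab, Or.inr ⟨a, rfl⟩,
        Or.inr ⟨b, rfl⟩⟩)
    · exact Or.inl ⟨s, hbag s⟩

/-- A tree decomposition with bags of at least two elements can be subdivided into a nice
one. -/
lemma exists_niceTD_of_two_le_card {𝒱 : Type*} {T : SimpleGraph 𝒱} {B : 𝒱 → Finset V}
    {w d : ℕ} (hTD : IsTreeDecomp E T B) (hwidth : ∀ x, (B x).card ≤ w + 1)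
    (h2 : ∀ x, 2 ≤ (B x).card)
    (hdiam : ∀ (a b : 𝒱) (p : T.Walk a b), p.IsPath → p.length ≤ d) :
    ∃ (𝒱' : Type v) (_ : Fintype 𝒱') (T' : SimpleGraph 𝒱') (B' : 𝒱' → Finset V)
      (root : 𝒱'), IsNiceTD E T' B' root ∧ (∀ x, (B' x).card ≤ w + 1) ∧
        ∀ (a b : 𝒱') (p : T'.Walk a b), p.IsPath → p.length ≤ 2 * ((w + 1) * (d + 2)) := by
  obtain ⟨c, hcenter⟩ := exists_center hTD.1 d hdiam
  have hne : ∀ x, (B x).Nonempty := fun x =>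
    Finset.card_pos.mp (Nat.zero_lt_two.trans_le (h2 x))
  obtain ⟨r, hr⟩ := hne c
  refine exists_niceTD_of_words E (B c) (nodeWords T B c) _ (w + 1)
    (walkWord_mem_nodeWords (p := .nil) .nil hr) nodeWords_suffix_closed (fun l hl => ?_)
    (fun l hl => card_wordBag_le hwidth (hne c) hl) (fun s t hst => ?_)
    (nodeWordsAt_connected hTD (hne c)) (fun l hl => nodeWords_leaf h2 hl) (fun s => ?_)
  · have h₁ := length_le_of_mem_nodeWords (h := (d + 1) / 2) hwidth
      (fun x q hq => by have := hcenter x q hq; omega) hl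
    have h₂ : 2 * ((d + 1) / 2) ≤ d + 1 := Nat.mul_div_le _ _
    have h₃ := Nat.mul_le_mul_left (w + 1) h₂
    linarith
  · obtain ⟨x, hs, ht⟩ := hTD.2.1 s t hst
    obtain ⟨p, hp, -⟩ := hTD.1.existsUnique_path x c
    exact ⟨_, walkWord_mem_nodeWords hp hs, by rwa [wordBag_walkWord],
      by rwa [wordBag_walkWord]⟩
  · obtain ⟨x, hs⟩ := (hTD.2.2 s).nonempty
    obtain ⟨p, hp, -⟩ := hTD.1.existsUnique_path x c
    exact ⟨_, ⟨x, p, s, hp, hs, List.suffix_rfl⟩,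
      wordBag_leafWord_append _ _ hs (wordBag_walkWord p),
      cons_leafWord_notMem_nodeWords p hs (h2 x)⟩

lemma exists_niceTD [Nonempty V] {𝒱 : Type*} [Finite 𝒱] {T : SimpleGraph 𝒱}
    {B : 𝒱 → Finset V} {w d : ℕ} (hTD : IsTreeDecomp E T B)
    (hwidth : ∀ x, (B x).card ≤ w + 1)
    (hdiam : ∀ (a b : 𝒱) (p : T.Walk a b), p.IsPath → p.length ≤ d) :
    ∃ (𝒱' : Type v) (_ : Fintype 𝒱') (T' : SimpleGraph 𝒱') (B' : 𝒱' → Finset V)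
      (root : 𝒱'), IsNiceTD E T' B' root ∧ (∀ x, (B' x).card ≤ w + 1) ∧
        ∀ (a b : 𝒱') (p : T'.Walk a b), p.IsPath → p.length ≤ 2 * ((w + 1) * (d + 2)) := by
  rcases subsingleton_or_nontrivial V with hV | hV
  · exact exists_niceTD_of_subsingleton _ _
  rcases Nat.eq_zero_or_pos w with rfl | hw
  · refine exists_niceTD_of_edgeless (fun s t hst => ?_) _ _ (by omega)
    obtain ⟨x, hs, ht⟩ := hTD.2.1 s t hst
    exact Finset.card_le_one.mp (hwidth x) s hs t ht
  · obtain ⟨B', hTD', hwidth', h2⟩ := hTD.exists_two_le_card hwidth hw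
    exact exists_niceTD_of_two_le_card hTD' hwidth' h2 hdiam

end Existence

/-- A graph with at least one vertex admitting a tree decomposition
of width at most `w` whose tree has all simple paths of length at most `d` admits a
nice tree decomposition of width at most `w` whose tree has all simple paths of
length at most `2(w+1)(d+2)`. -/
theorem nice_tree_decomposition_exists {V : Type u} {𝒱 : Type v}
    [Fintype V] [DecidableEq V] [Nonempty V] [Fintype 𝒱]
    (E : V → V → Prop) (T : SimpleGraph 𝒱) (B : 𝒱 → Finset V) (w d : ℕ)
    (hTD : IsTreeDecomp E T B)
    (hwidth : ∀ x : 𝒱, (B x).card ≤ w + 1)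
    (hdiam : ∀ (a b : 𝒱) (p : T.Walk a b), p.IsPath → p.length ≤ d) :
    ∃ (𝒱' : Type v) (_ : Fintype 𝒱') (T' : SimpleGraph 𝒱') (B' : 𝒱' → Finset V)
      (root : 𝒱'),
      IsNiceTD E T' B' root ∧ (∀ x : 𝒱', (B' x).card ≤ w + 1) ∧
        ∀ (a b : 𝒱') (p : T'.Walk a b), p.IsPath → p.length ≤ 2 * (w + 1) * (d + 2) := by
  classical
  let e : V ≃ ULift.{v} (Fin (Fintype.card V)) := (Fintype.equivFin V).trans Equiv.ulift.symm
  have : Nonempty (ULift.{v} (Fin (Fintype.card V))) := e.nonempty_congr.mp inferInstance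
  obtain ⟨𝒱', hfin, T', B', root, hnice, hcard, hpath⟩ :=
    exists_niceTD (hTD.map_equiv e) (fun x => by simpa using hwidth x) hdiam
  refine ⟨𝒱', hfin, T', fun x => (B' x).map e.symm.toEmbedding, root, ?_,
    fun x => by simpa using hcard x, fun a b p hp => ?_⟩
  · simpa using hnice.map_equiv e.symm
  · rw [mul_assoc]
    exact hpath a b p hp
end

section
/- The vertex σ is winning for player P_0 if and only if there exists a V_0-selector g such that ω_1^g(v_1) is the singleton set consisting of the function σ ↦ ⊤ (on the bag 𝐓(v_1) = {σ}). -/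
universe u v

/-- Possible values of a selector view: `?`, `⊤`, `⊥`, or an exit pair `(t, m)`. -/
inductive View (V : Type u) : Type u where
  | unk : View V
  | top : View V
  | bot : View V
  | exit : V → ℕ → View V

/-- The trace of the (partial) selector `f` from `s`: `iter f s n` is the `n`-th
vertex of the trace, if the trace is still defined at step `n`. -/
def iter {V : Type u} (f : V → Option V) (s : V) : ℕ → Option V
  | 0 => some s
  | n + 1 => (iter f s n).bind f

/-- `t` occurs infinitely often on the trace of `f` from `s`. -/
def infOcc {V : Type u} (f : V → Option V) (s t : V) : Prop :=
  ∀ N : ℕ, ∃ n : ℕ, N ≤ n ∧ iter f s n = some t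

/-- A parity game together with a tree decomposition and a depth-first traversal:
edge relation `E`, number of colors `C`, coloring `c`, set `V0` of vertices of
player `P₀` (`V1 = V0ᶜ`), tree `T` with bags `B`, depth-first traversal
`vs 1, …, vs len` and distinguished initial vertex `sigma`. -/
structure Setting (V : Type u) (𝒱 : Type v) where
  E : V → V → Prop
  C : ℕ
  c : V → ℕ
  V0 : Set V
  T : SimpleGraph 𝒱
  vs : ℕ → 𝒱
  len : ℕ
  sigma : V
  B : 𝒱 → Finset V

namespace Setting

variable {V : Type u} {𝒱 : Type v} (S : Setting V 𝒱)

/-- The root of the tree is the first node of the depth-first traversal. -/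
def root : 𝒱 := S.vs 1

/-- Standing assumptions: colors lie in `{1, …, C}`, `(T, B)` is a nice tree
decomposition of `(V, E)` rooted at `v₁` with bag `{σ}`, and `vs` is a
depth-first traversal of `T` of length `len`. -/
def Standing [DecidableEq V] : Prop :=
  (∀ s : V, 1 ≤ S.c s ∧ S.c s ≤ S.C) ∧
  IsNiceTD S.E S.T S.B S.root ∧
  IsDFT S.T S.root S.len S.vs ∧
  S.B S.root = {S.sigma}

def theta (i : ℕ) : Set 𝒱 := Theta S.T S.root S.vs i

def psi (i : ℕ) : Set V := Psi S.T S.root S.vs S.B i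

def psiLe (i : ℕ) : Set V := PsiLe S.T S.root S.vs S.B i

def psiGtAt (i : ℕ) (x : 𝒱) : Set V := PsiGtAt S.T S.root S.vs S.B i x

/-- The index `i` is critical: `Ψ_{>i} ⊊ Ψ_{>i-1}`. -/
def Crit (i : ℕ) : Prop := (S.psiLe i)ᶜ ⊂ (S.psiLe (i - 1))ᶜ

/-- `f` is a `W`-selector: a partial map with domain contained in `W` that follows
edges of the game. -/
def Sel (W : Set V) (f : V → Option V) : Prop :=
  ∀ s t : V, f s = some t → s ∈ W ∧ S.E s t

/-- The (maximal) trace of the `V`-selector `f` from `s` is winning for player `P₀`: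
either it is finite and its last vertex belongs to `V1 = V0ᶜ`, or it is infinite and
the maximal color occurring infinitely often along it is even. -/
def TraceWin (f : V → Option V) (s : V) : Prop :=
  (∃ (n : ℕ) (t : V), iter f s n = some t ∧ f t = none ∧ t ∉ S.V0) ∨
  ((∀ n : ℕ, iter f s n ≠ none) ∧
    ∃ m : ℕ, Even m ∧ (∃ t : V, infOcc f s t ∧ S.c t = m) ∧
      ∀ t : V, infOcc f s t → S.c t ≤ m)

/-- The selector view `f_i(x, s)` of the `V`-selector `f`: `S.SelView f i x s w`
means `f_i(x, s) = w`. -/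
def SelView (f : V → Option V) (i : ℕ) (x : 𝒱) (s : V) : View V → Prop := fun w =>
  match w with
  | View.unk =>
      (f s = none ∧ s ∉ S.psiGtAt i x) ∨ (∃ t : V, f s = some t ∧ t ∉ S.psiGtAt i x)
  | View.top =>
      (f s ≠ none ∨ s ∈ S.psiGtAt i x) ∧
      (∀ (n : ℕ) (t : V), 1 ≤ n → iter f s n = some t → t ∈ S.psiGtAt i x) ∧
      S.TraceWin f s
  | View.bot =>
      (f s ≠ none ∨ s ∈ S.psiGtAt i x) ∧
      (∀ (n : ℕ) (t : V), 1 ≤ n → iter f s n = some t → t ∈ S.psiGtAt i x) ∧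
      ¬ S.TraceWin f s
  | View.exit t m =>
      ∃ j : ℕ, 2 ≤ j ∧ iter f s j = some t ∧ t ∉ S.psiGtAt i x ∧
        (∀ (n : ℕ) (u : V), 1 ≤ n → n < j → iter f s n = some u → u ∈ S.psiGtAt i x) ∧
        (∃ (n : ℕ) (u : V), n < j ∧ iter f s n = some u ∧ S.c u = m) ∧
        (∀ (n : ℕ) (u : V), n < j → iter f s n = some u → S.c u ≤ m)

/-- The selector views `f_i(x)` and `g_i(x)` coincide (as functions on the bag of `x`). -/
def ViewEq (f g : V → Option V) (i : ℕ) (x : 𝒱) : Prop :=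
  ∀ s ∈ S.B x, ∀ w : View V, S.SelView f i x s w ↔ S.SelView g i x s w

/-- `f` is a `V`-selector extending the `V₀`-selector `g` (i.e. `g` is the
restriction of `f` to `V0`). -/
def Ext (f g : V → Option V) : Prop :=
  S.Sel Set.univ f ∧ (∀ s ∈ S.V0, g s = f s) ∧ ∀ s ∉ S.V0, g s = none

/-- The selector view `f_i(x)` of a `V`-selector, as a relation on the bag of `x`. -/
def viewOn (f : V → Option V) (i : ℕ) (x : 𝒱) : V → View V → Prop :=
  fun s w => s ∈ S.B x ∧ S.SelView f i x s w

/-- `ω_i^g(x) = { f_i(x) | f is an extension of g }`. -/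
def omega (g : V → Option V) (i : ℕ) (x : 𝒱) : Set (V → View V → Prop) :=
  {R | ∃ f : V → Option V, S.Ext f g ∧ R = S.viewOn f i x}

/-- The accessibility set `α_i^g`: vertices of `Ψ_i` reachable from `σ` along the
trace of some extension of `g`. -/
def alpha (g : V → Option V) (i : ℕ) : Set V :=
  {s | s ∈ S.psi i ∧ ∃ f : V → Option V, S.Ext f g ∧ ∃ k : ℕ, iter f S.sigma k = some s}

/-- The set `B(g)_{x,y} ⊆ {⊥, ⊤}` (with `false` for `⊥` and `true` for `⊤`). -/
def Bsel (g : V → Option V) (x y : V) : Set Bool :=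
  {b | (b = false ∧ (¬ S.E x y ∨ (x ∈ S.V0 ∧ g x = none) ∨
          (∃ z : V, g x = some z ∧ z ≠ y) ∨ (S.E x y ∧ x ∉ S.V0))) ∨
       (b = true ∧ (g x = some y ∨ (S.E x y ∧ x ∉ S.V0)))}

end Setting

/-- `p` is a (nonempty) finite path of the graph with edge relation `E`. -/
def FinPath {V : Type u} (E : V → V → Prop) (p : List V) : Prop :=
  p ≠ [] ∧ p.Chain' E

/-- The finite path `p` is compatible with the strategy `st`. -/
def StratCompat {V : Type u} (st : List V → Option V) (p : List V) : Prop :=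
  ∀ j : ℕ, j + 1 < p.length → ∀ t : V, st (p.take (j + 1)) = some t → p[j+1]? = some t

namespace Setting

variable {V : Type u} {𝒱 : Type v} (S : Setting V 𝒱)

/-- `st` is a strategy for player `P₀`: it associates, with every finite path whose
last vertex `u` belongs to `V0`, a successor of `u`, if any exists. -/
def IsStrategy (st : List V → Option V) : Prop :=
  (∀ (p : List V) (t : V), st p = some t →
      ∃ u : V, p.getLast? = some u ∧ u ∈ S.V0 ∧ S.E u t) ∧
  (∀ (p : List V) (u : V), FinPath S.E p → p.getLast? = some u → u ∈ S.V0 →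
      (∃ t : V, S.E u t) → st p ≠ none)

/-- The infinite play `ρ` is winning for `P₀`: the maximal color occurring
infinitely often along it is even. -/
def InfWin (ρ : ℕ → V) : Prop :=
  ∃ m : ℕ, Even m ∧ (∀ N : ℕ, ∃ n : ℕ, N ≤ n ∧ S.c (ρ n) = m) ∧
    ∀ m' : ℕ, (∀ N : ℕ, ∃ n : ℕ, N ≤ n ∧ S.c (ρ n) = m') → m' ≤ m

/-- The vertex `s0` is winning for player `P₀`: `P₀` has a strategy all of whose
maximal outcomes from `s0` are winning for `P₀`. -/
def WinFrom (s0 : V) : Prop :=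
  ∃ st : List V → Option V, S.IsStrategy st ∧
    (∀ p : List V, FinPath S.E p → p.head? = some s0 → StratCompat st p →
      (¬ ∃ t : V, FinPath S.E (p ++ [t]) ∧ StratCompat st (p ++ [t])) →
      ∃ u : V, p.getLast? = some u ∧ u ∉ S.V0) ∧
    ∀ ρ : ℕ → V, ρ 0 = s0 → (∀ n : ℕ, S.E (ρ n) (ρ (n + 1))) →
      (∀ (n : ℕ) (t : V), st (List.ofFn (fun k : Fin (n + 1) => ρ k)) = some t →
        ρ (n + 1) = t) →
      S.InfWin ρ

end Setting

/-- The maximal color seen infinitely often along `ρ` exists, and it is even iff `b = true`. -/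
def ParityWin {V : Type u} (c : V → ℕ) (b : Bool) (ρ : ℕ → V) : Prop :=
  ∃ m : ℕ, (Even m ↔ b = true) ∧ (∀ N : ℕ, ∃ n : ℕ, N ≤ n ∧ c (ρ n) = m) ∧
    ∃ N : ℕ, ∀ n : ℕ, N ≤ n → c (ρ n) ≤ m

/-- The infinite play `ρ` stays in `D` and follows the positional strategy `g` of player `b`. -/
structure FollowsIn {V : Type u} (E : V → V → Prop) (own : V → Bool) (b : Bool)
    (D : Set V) (g : V → V) (ρ : ℕ → V) : Prop where
  mem : ∀ n, ρ n ∈ D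
  edge : ∀ n, E (ρ n) (ρ (n + 1))
  follow : ∀ n, own (ρ n) = b → ρ (n + 1) = g (ρ n)

/-- In the subgame on `A`, the positional strategy `g` of player `b` stays in `D` until `N` is
reached, and every play that stays forever in `D \ N` satisfies `Win`. -/
structure Dom {V : Type u} (E : V → V → Prop) (own : V → Bool) (b : Bool)
    (Win : (ℕ → V) → Prop) (A N D : Set V) (g : V → V) : Prop where
  sub : D ⊆ A
  own_step : ∀ s ∈ D \ N, own s = b → E s (g s) ∧ g s ∈ D
  opp_step : ∀ s ∈ D \ N, own s ≠ b → ∀ t ∈ A, E s t → t ∈ D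
  win : ∀ ρ, FollowsIn E own b (D \ N) g ρ → Win ρ

section Determinacy

variable {V : Type u} {E : V → V → Prop} {own : V → Bool} {b : Bool}

theorem FollowsIn.shift {D : Set V} {g : V → V} {ρ : ℕ → V} (h : FollowsIn E own b D g ρ)
    (k : ℕ) : FollowsIn E own b D g (fun n => ρ (n + k)) where
  mem n := h.mem _
  edge n := by simpa [Nat.add_right_comm] using h.edge (n + k)
  follow n := by simpa [Nat.add_right_comm] using h.follow (n + k)

theorem ParityWin.of_shift {c : V → ℕ} {ρ : ℕ → V} {k : ℕ}
    (h : ParityWin c b (fun n => ρ (n + k))) : ParityWin c b ρ := by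
  obtain ⟨m, hm, hf, N, hN⟩ := h
  refine ⟨m, hm, fun M => ?_, N + k, fun n hn => ?_⟩
  · obtain ⟨n, hn, hc⟩ := hf M
    exact ⟨n + k, by omega, hc⟩
  · have := hN (n - k) (by omega)
    simpa only [Nat.sub_add_cancel (show k ≤ n by omega)] using this

/-- A dominion `W` can be enlarged by a set `D` from which the opponent can only go
to `W ∪ D` and in which the player has a strategy that wins when the play stays in `D`. -/
theorem Dom.glue {Win : (ℕ → V) → Prop} (hWin : ∀ ρ k, Win (fun n => ρ (n + k)) → Win ρ)
    {A N W D : Set V} {g g' : V → V} (h : Dom E own b Win A N W g)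
    (hDA : D ⊆ A)
    (hown : ∀ s ∈ D, own s = b → E s (g' s) ∧ g' s ∈ W ∪ D)
    (hopp : ∀ s ∈ D, own s ≠ b → ∀ t ∈ A, E s t → t ∈ W ∪ D)
    (hwin : ∀ ρ, FollowsIn E own b D g' ρ → Win ρ) :
    ∃ k, Dom E own b Win A N (W ∪ D) k := by
  classical
  refine ⟨fun s => if s ∈ W then g s else g' s, Set.union_subset h.sub hDA, ?_, ?_, ?_⟩
  · rintro s ⟨hs, hsN⟩ ho
    by_cases hW : s ∈ W
    · have := h.own_step s ⟨hW, hsN⟩ ho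
      simp only [hW, if_true]
      exact ⟨this.1, Or.inl this.2⟩
    · simp only [hW, if_false]
      exact hown s (hs.resolve_left hW) ho
  · rintro s ⟨hs, hsN⟩ ho t ht hE
    by_cases hW : s ∈ W
    · exact Or.inl (h.opp_step s ⟨hW, hsN⟩ ho t ht hE)
    · exact hopp s (hs.resolve_left hW) ho t ht hE
  · intro ρ hρ
    by_cases hex : ∃ k, ρ k ∈ W
    · obtain ⟨k, hk⟩ := hex
      have hstay : ∀ n, ρ (n + k) ∈ W := by
        intro n
        induction n with
        | zero => simpa using hk
        | succ n ih =>
          rw [Nat.add_right_comm]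
          have hN := (hρ.mem (n + k)).2
          by_cases ho : own (ρ (n + k)) = b
          · have := hρ.follow _ ho
            simp only [ih, if_true] at this
            rw [this]
            exact (h.own_step _ ⟨ih, hN⟩ ho).2
          · refine h.opp_step _ ⟨ih, hN⟩ ho _ ?_ (hρ.edge _)
            exact Set.union_subset h.sub hDA (hρ.mem _).1
      refine hWin ρ k (h.win _ ⟨fun n => ⟨hstay n, (hρ.mem _).2⟩, (hρ.shift k).edge, ?_⟩)
      intro n ho
      have := (hρ.shift k).follow n ho
      simpa only [hstay n, if_true] using this
    · push Not at hex
      refine hwin ρ ⟨fun n => (hρ.mem n).1.resolve_left (hex n), hρ.edge, fun n ho => ?_⟩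
      have := hρ.follow n ho
      simpa only [hex n, if_false] using this

/-- A dominion can be enlarged by one attractor step. -/
theorem Dom.insert_of_attr {Win : (ℕ → V) → Prop}
    (hWin : ∀ ρ k, Win (fun n => ρ (n + k)) → Win ρ)
    {A N W : Set V} {g : V → V} (h : Dom E own b Win A N W g) {s : V} (hsA : s ∈ A)
    (hsW : s ∉ W) (hown : own s = b → ∃ t ∈ W, E s t)
    (hopp : own s ≠ b → ∀ t ∈ A, E s t → t ∈ W) :
    ∃ k, Dom E own b Win A N (W ∪ {s}) k := by
  by_cases ho : own s = b
  · obtain ⟨t, htW, hE⟩ := hown ho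
    refine h.glue hWin (g' := fun _ => t) (by simpa using hsA) ?_ ?_ ?_
    · rintro _ rfl -
      exact ⟨hE, Or.inl htW⟩
    · rintro _ rfl h'
      exact absurd ho h'
    · intro ρ hρ
      have h0 : ρ 0 = s := hρ.mem 0
      have h1 : ρ 1 = s := hρ.mem 1
      have := hρ.follow 0 (by rw [h0, ho])
      simp only [zero_add, h1] at this
      exact absurd (this ▸ htW) hsW
  · refine h.glue hWin (g' := id) (by simpa using hsA) ?_ ?_ ?_
    · rintro _ rfl h'
      exact absurd h' ho
    · rintro _ rfl - t ht hE
      exact Or.inl (hopp ho t ht hE)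
    · intro ρ hρ
      have h0 : ρ 0 = s := hρ.mem 0
      have h1 : ρ 1 = s := hρ.mem 1
      have := hρ.edge 0
      rw [zero_add, h0, h1] at this
      exact absurd (hopp ho s hsA this) hsW

/-- Above every dominion there is one that is maximal for inclusion. -/
theorem Dom.exists_maximal [Finite V] {Win : (ℕ → V) → Prop} {A N W : Set V} {g : V → V}
    (h : Dom E own b Win A N W g) :
    ∃ (Y : Set V) (k : V → V), W ⊆ Y ∧ Dom E own b Win A N Y k ∧
      ∀ Z k', Y ⊆ Z → Dom E own b Win A N Z k' → Z ⊆ Y := by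
  obtain ⟨Y, hWY, ⟨k, hk⟩, hmax⟩ :=
    (Set.toFinite {D | ∃ k, Dom E own b Win A N D k}).exists_le_maximal ⟨g, h⟩
  exact ⟨Y, k, hWY, hk, fun Z k' hYZ hZ => hmax ⟨k', hZ⟩ hYZ⟩

/-- A play that, inside `R`, follows an attractor strategy to the vertices of maximal color `m`
on `Y` and a winning strategy outside `Y` is won by the player with the parity of `m`. -/
theorem parityWin_of_attractor {c : V → ℕ} {m : ℕ} {R Y : Set V} {h g k : V → V}
    (hb : Even m ↔ b = true) (hm : ∀ s ∈ R, c s ≤ m)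
    (hY : Dom E own b (fun _ => False) R {s ∈ R | c s = m} Y h)
    (hg : ∀ ρ, FollowsIn E own b (R \ Y) g ρ → ParityWin c b ρ)
    (hkY : ∀ s ∈ Y, c s ≠ m → k s = h s) (hkR : ∀ s ∈ R \ Y, k s = g s)
    {ρ : ℕ → V} (hρ : FollowsIn E own b R k ρ) : ParityWin c b ρ := by
  by_cases hfreq : ∀ N : ℕ, ∃ n : ℕ, N ≤ n ∧ c (ρ n) = m
  · exact ⟨m, hb, hfreq, 0, fun n _ => hm _ (hρ.mem n)⟩
  · push Not at hfreq
    obtain ⟨N, hN⟩ := hfreq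
    by_cases hex : ∃ n, N ≤ n ∧ ρ n ∈ Y
    · obtain ⟨n, hn, hnY⟩ := hex
      exfalso
      have hstay : ∀ j, ρ (j + n) ∈ Y \ {s ∈ R | c s = m} := by
        intro j
        refine ⟨?_, fun h' => hN (j + n) (by omega) h'.2⟩
        induction j with
        | zero => simpa using hnY
        | succ j ih =>
          rw [Nat.add_right_comm]
          have hc := hN (j + n) (by omega)
          have hmem : ρ (j + n) ∈ Y \ {s ∈ R | c s = m} := ⟨ih, fun h' => hc h'.2⟩
          by_cases ho : own (ρ (j + n)) = b
          · rw [hρ.follow _ ho, hkY _ ih hc]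
            exact (hY.own_step _ hmem ho).2
          · exact hY.opp_step _ hmem ho _ (hρ.mem _) (hρ.edge _)
      refine hY.win _ ⟨hstay, (hρ.shift n).edge, fun j ho => ?_⟩
      rw [(hρ.shift n).follow j ho]
      exact hkY _ (hstay j).1 (hN _ (by omega))
    · push Not at hex
      have hmem : ∀ j, ρ (j + N) ∈ R \ Y := fun j => ⟨hρ.mem _, hex _ (by omega)⟩
      refine ParityWin.of_shift (k := N) (hg _ ⟨hmem, (hρ.shift N).edge, fun j ho => ?_⟩)
      rw [(hρ.shift N).follow j ho]
      exact hkR _ (hmem j)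

/-- Positional determinacy of finite parity games, for the subgame on `A`. -/
theorem exists_dom_cover [Finite V] (E : V → V → Prop) (own : V → Bool) (c : V → ℕ)
    (A : Set V) :
    ∃ (W : Bool → Set V) (g : Bool → V → V),
      (∀ b, Dom E own b (ParityWin c b) A ∅ (W b) (g b)) ∧ A ⊆ W true ∪ W false := by
  classical
  induction A using WellFoundedLT.induction with
  | ind A ih =>
  have hshift : ∀ (b : Bool) (ρ : ℕ → V) (k : ℕ),
      ParityWin c b (fun n => ρ (n + k)) → ParityWin c b ρ := fun _ _ _ => ParityWin.of_shift
  have hempty : ∀ b, Dom E own b (ParityWin c b) A ∅ ∅ id := fun b =>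
    ⟨by simp, by simp, by simp, fun ρ hρ => absurd (hρ.mem 0) (by simp)⟩
  choose W g _ hDom hmax using fun b => (hempty b).exists_maximal
  refine ⟨W, g, hDom, ?_⟩
  by_contra hcover
  set R : Set V := {s ∈ A | ∀ b, s ∉ W b} with hR
  have hRne : R.Nonempty := by
    obtain ⟨s, hsA, hs⟩ := Set.not_subset.mp hcover
    refine ⟨s, hsA, fun b hb => hs ?_⟩
    cases b
    · exact Or.inr hb
    · exact Or.inl hb
  have hclosed : ∀ b, ∀ s ∈ R, own s = b → ∀ t ∈ A, E s t → t ∉ W b := by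
    intro b s hs ho t _ hE htW
    obtain ⟨k, hk⟩ := (hDom b).insert_of_attr (hshift b) hs.1 (hs.2 b)
      (fun _ => ⟨t, htW, hE⟩) (fun h => absurd ho h)
    exact hs.2 b (hmax b _ k Set.subset_union_left hk (Or.inr rfl))
  have hsucc : ∀ s ∈ R, ∃ t ∈ R, E s t := by
    intro s hs
    by_contra hno
    push Not at hno
    obtain ⟨k, hk⟩ := (hDom (!own s)).insert_of_attr (hshift _) hs.1 (hs.2 _)
      (fun h => absurd h (by simp)) (fun _ t ht hE => by
        by_contra htW
        refine hno t ⟨ht, fun b hb => ?_⟩ hE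
        by_cases hbo : own s = b
        · exact hclosed b s hs hbo t ht hE hb
        · obtain rfl : b = !own s := Bool.eq_not_of_ne (Ne.symm hbo)
          exact htW hb)
    exact hs.2 _ (hmax _ _ k Set.subset_union_left hk (Or.inr rfl))
  -- no subset of `R` can be added to a maximal dominion
  have hnone : ∀ (b : Bool) (D : Set V) (k : V → V), D ⊆ R →
      (∀ s ∈ D, own s = b → E s (k s) ∧ k s ∈ D) →
      (∀ s ∈ D, own s ≠ b → ∀ t ∈ R, E s t → t ∈ D) →
      (∀ ρ, FollowsIn E own b D k ρ → ParityWin c b ρ) → D = ∅ := by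
    intro b D k hDR h1 h2 h3
    obtain ⟨k', hk'⟩ := (hDom b).glue (hshift b) (g' := k) (fun s hs => (hDR hs).1)
      (fun s hs ho => ⟨(h1 s hs ho).1, Or.inr (h1 s hs ho).2⟩)
      (fun s hs ho t ht hE => by
        by_cases htW : t ∈ W b
        · exact Or.inl htW
        · refine Or.inr (h2 s hs ho t ⟨ht, fun b' hb' => ?_⟩ hE)
          by_cases hbb : b' = b
          · exact htW (hbb ▸ hb')
          · obtain rfl : b' = own s := by
              rw [Bool.eq_not_of_ne hbb, Bool.eq_not_of_ne ho]
            exact hclosed _ s (hDR hs) rfl t ht hE hb')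
      h3
    refine Set.eq_empty_of_forall_notMem fun s hs => ?_
    exact (hDR hs).2 b (hmax b _ k' Set.subset_union_left hk' (Or.inr hs))
  obtain ⟨x, hxR, hx⟩ := Set.exists_max_image R c R.toFinite hRne
  set N : Set V := {s ∈ R | c s = c x} with hN
  obtain ⟨b, hb⟩ : ∃ b : Bool, Even (c x) ↔ b = true := ⟨decide (Even (c x)), by simp⟩
  have hNdom : Dom E own b (fun _ => False) R N N id :=
    ⟨fun s hs => hs.1, by simp, by simp, fun ρ hρ => (hρ.mem 0).2 (hρ.mem 0).1⟩
  obtain ⟨Y, h, hNY, hY, hYmax⟩ := hNdom.exists_maximal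
  have hxY : x ∈ Y := hNY ⟨hxR, rfl⟩
  have hlt : R \ Y < A := by
    refine ⟨fun s hs => hs.1.1, fun hle => ?_⟩
    exact (hle hxR.1).2 hxY
  obtain ⟨W', g', hDom', hcover'⟩ := ih (R \ Y) hlt
  have hnoY : ∀ s ∈ R \ Y, own s = b → ∀ t ∈ R, E s t → t ∈ R \ Y := by
    intro s hs ho t ht hE
    refine ⟨ht, fun htY => ?_⟩
    obtain ⟨k, hk⟩ := hY.insert_of_attr (fun _ _ h => h) hs.1 hs.2
      (fun _ => ⟨t, htY, hE⟩) (fun h => absurd ho h)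
    exact hs.2 (hYmax _ k Set.subset_union_left hk (Or.inr rfl))
  have hopp : W' (!b) = ∅ := by
    refine hnone (!b) _ (g' (!b)) (fun s hs => ((hDom' _).sub hs).1) ?_ ?_ ?_
    · exact fun s hs ho => (hDom' _).own_step s ⟨hs, by simp⟩ ho
    · intro s hs ho t ht hE
      refine (hDom' _).opp_step s ⟨hs, by simp⟩ ho t ?_ hE
      exact hnoY s ((hDom' _).sub hs) (by simpa using Bool.eq_not_of_ne ho) t ht hE
    · simpa using (hDom' (!b)).win
  have hW' : W' b = R \ Y := by
    refine (hDom' b).sub.antisymm fun s hs => ?_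
    rcases hcover' hs with h' | h' <;> cases b
    · simp [show W' true = ∅ from hopp] at h'
    · exact h'
    · exact h'
    · simp [show W' false = ∅ from hopp] at h'
  choose! nx hnxR hnxE using hsucc
  have hwhole := hnone b R
    (fun s => if s ∈ Y then (if c s = c x then nx s else h s) else g' b s) subset_rfl ?_
    (fun _ _ _ t ht _ => ht) ?_
  · exact hRne.ne_empty hwhole
  · intro s hs ho
    by_cases hsY : s ∈ Y
    · by_cases hsc : c s = c x
      · simp only [hsY, hsc, if_true]
        exact ⟨hnxE s hs, hnxR s hs⟩
      · simp only [hsY, hsc, if_true, if_false]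
        have := hY.own_step s ⟨hsY, fun h => hsc h.2⟩ ho
        exact ⟨this.1, hY.sub this.2⟩
    · simp only [hsY, if_false]
      have := (hDom' b).own_step s ⟨hW' ▸ ⟨hs, hsY⟩, by simp⟩ ho
      exact ⟨this.1, ((hDom' b).sub this.2).1⟩
  · intro ρ hρ
    refine parityWin_of_attractor (g := g' b) hb hx hY ?_ ?_ ?_ hρ
    · intro ρ' hρ'
      exact (hDom' b).win ρ' (by simpa [hW'] using hρ')
    · intro s hs hc
      simp [hs, hc]
    · intro s hs
      simp [hs.2]

end Determinacy

theorem exists_isBagRoot {V : Type u} {𝒱 : Type v} {T : SimpleGraph 𝒱} (hT : T.IsTree)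
    {B : 𝒱 → Finset V} {s : V} (hs : (T.induce {x : 𝒱 | s ∈ B x}).Connected) (root : 𝒱) :
    ∃ r, IsBagRoot T root B s r := by
  classical
  obtain ⟨x₀, hx₀⟩ := hs.nonempty
  obtain ⟨r, hr, hmin⟩ := WellFounded.has_min
    (InvImage.wf (T.dist root) Nat.lt_wfRel.wf) {x : 𝒱 | s ∈ B x} ⟨x₀, hx₀⟩
  refine ⟨r, hr, fun x hx => ?_⟩
  obtain ⟨w⟩ := hs.preconnected ⟨r, hr⟩ ⟨x, hx⟩
  have key : ∀ {a b : {x : 𝒱 | s ∈ B x}} (w : (T.induce {x : 𝒱 | s ∈ B x}).Walk a b),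
      Anc T root r a → Anc T root r b := by
    intro a b w
    induction w with
    | nil => exact id
    | @cons a b _ hab _ ih =>
      refine fun ha => ih fun p hp => ?_
      have hadj : T.Adj b a := (SimpleGraph.induce_adj.mp hab).symm
      by_contra hrp
      by_cases hap : (a : 𝒱) ∈ p.support
      · exact hrp (p.support_takeUntil_subset_support hap (ha _ (hp.takeUntil hap)))
      · have hq : (p.concat hadj).IsPath := hp.concat hap hadj
        have hmem := ha _ hq
        simp only [SimpleGraph.Walk.support_concat, List.mem_append,
          List.mem_singleton] at hmem
        obtain rfl : r = a := hmem.resolve_left hrp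
        obtain ⟨q, hqlen⟩ := hT.connected.exists_walk_length_eq_dist root a
        have hqp := q.isPath_of_length_eq_dist hqlen
        have heq := congrArg (fun z : T.Path root a => z.1.length)
          ((hT.isAcyclic.subsingleton_path root a).elim ⟨q, hqp⟩ ⟨_, hq⟩)
        simp only [SimpleGraph.Walk.length_concat] at heq
        refine hmin b b.2 ?_
        have := SimpleGraph.dist_le p
        change T.dist root b < T.dist root a
        omega
  exact key w fun p _ => p.end_mem_support

theorem exists_last_of_iter_eq_none {V : Type u} {f : V → Option V} {s : V} {n : ℕ}
    (h : iter f s n = none) : ∃ k t, iter f s k = some t ∧ f t = none := by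
  induction n with
  | zero => simp [iter] at h
  | succ n ih =>
    cases hn : iter f s n with
    | none => exact ih hn
    | some t => exact ⟨n, t, hn, by simpa [iter, hn] using h⟩

/-- The trace of a selector is undefined after its last vertex. -/
theorem iter_eq_none_of_last {V : Type u} {f : V → Option V} {s t : V} {k : ℕ}
    (hk : iter f s k = some t) (hf : f t = none) (n : ℕ) : iter f s (k + 1 + n) = none := by
  induction n with
  | zero => simp [iter, hk, hf]
  | succ n ih => rw [← add_assoc]; simp [iter, ih]

/-- The trace stays in a set that is closed under the selector. -/
theorem iter_mem {V : Type u} {f : V → Option V} {s : V} {D : Set V} (hs : s ∈ D)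
    (hD : ∀ t ∈ D, ∀ u, f t = some u → u ∈ D) : ∀ n t, iter f s n = some t → t ∈ D := by
  intro n
  induction n with
  | zero => rintro t h; simp only [iter, Option.some.injEq] at h; exact h ▸ hs
  | succ n ih =>
    intro t h
    obtain ⟨u, hu, hut⟩ := Option.bind_eq_some_iff.mp h
    exact hD u (ih u hu) t hut

theorem exists_infOcc_of_color {V : Type u} [Finite V] {c : V → ℕ} {f : V → Option V} {s : V}
    {ρ : ℕ → V} (hρ : ∀ n, iter f s n = some (ρ n)) {m : ℕ}
    (hm : ∀ N : ℕ, ∃ n : ℕ, N ≤ n ∧ c (ρ n) = m) : ∃ t, infOcc f s t ∧ c t = m := by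
  by_contra hno
  push Not at hno
  have hbound : ∀ t, ∃ N, c t = m → ∀ n, N ≤ n → ρ n ≠ t := by
    intro t
    by_cases ht : c t = m
    · have : ¬ infOcc f s t := fun h => hno t h ht
      unfold infOcc at this
      push Not at this
      obtain ⟨N, hN⟩ := this
      exact ⟨N, fun _ n hn h => hN n hn (by rw [hρ, h])⟩
    · exact ⟨0, fun h => absurd h ht⟩
  choose N hN using hbound
  obtain ⟨M, hM⟩ := Set.Finite.bddAbove (Set.finite_range N)
  obtain ⟨n, hn, hc⟩ := hm M
  exact hN (ρ n) hc n ((hM ⟨_, rfl⟩).trans hn) rfl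

namespace Setting

variable {V : Type u} {𝒱 : Type v} {S : Setting V 𝒱}

theorem traceWin_of_parityWin [Finite V] {f : V → Option V} {s : V} {ρ : ℕ → V}
    (hρ : ∀ n, iter f s n = some (ρ n)) (h : ParityWin S.c true ρ) : S.TraceWin f s := by
  obtain ⟨m, hm, hf, N, hN⟩ := h
  refine Or.inr ⟨fun n => by simp [hρ], m, by simpa using hm, exists_infOcc_of_color hρ hf, ?_⟩
  intro t ht
  obtain ⟨n, hn, hnt⟩ := ht N
  obtain rfl : ρ n = t := by simpa [hρ] using hnt
  exact hN n hn

theorem not_traceWin_of_parityWin [Finite V] {f : V → Option V} {s : V} {ρ : ℕ → V}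
    (hρ : ∀ n, iter f s n = some (ρ n)) (h : ParityWin S.c false ρ) : ¬ S.TraceWin f s := by
  obtain ⟨m, hm, hf, N, hN⟩ := h
  rintro (⟨n, t, hn, hft, -⟩ | ⟨-, m', hm', ⟨t, ht, rfl⟩, hmax⟩)
  · have := iter_eq_none_of_last hn hft 0
    simp [hρ] at this
  · obtain ⟨u, hu, rfl⟩ := exists_infOcc_of_color hρ hf
    obtain ⟨n, hn, hnt⟩ := ht N
    obtain rfl : ρ n = t := by simpa [hρ] using hnt
    have heq : S.c (ρ n) = S.c u := le_antisymm (hN n hn) (hmax u hu)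
    exact absurd (hm.mp (heq ▸ hm')) (by simp)

theorem infWin_of_parityWin {ρ : ℕ → V} (h : ParityWin S.c true ρ) : S.InfWin ρ := by
  obtain ⟨m, hm, hf, N, hN⟩ := h
  refine ⟨m, by simpa using hm, hf, fun m' hm' => ?_⟩
  obtain ⟨n, hn, rfl⟩ := hm' N
  exact hN n hn

theorem not_infWin_of_parityWin {ρ : ℕ → V} (h : ParityWin S.c false ρ) : ¬ S.InfWin ρ := by
  obtain ⟨m, hm, hf, N, hN⟩ := h
  rintro ⟨m', hm', hf', hmax⟩
  obtain ⟨n, hn, rfl⟩ := hf' N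
  have heq : S.c (ρ n) = m := le_antisymm (hN n hn) (hmax m hf)
  exact absurd (hm.mp (heq ▸ hm')) (by simp)

theorem psiGtAt_one_root [DecidableEq V] (hS : S.Standing) : S.psiGtAt 1 S.root = Set.univ := by
  obtain ⟨-, ⟨⟨hT, -, hconn⟩, -⟩, -⟩ := hS
  refine Set.eq_univ_of_forall fun s => ⟨?_, ?_⟩
  · rintro ⟨j, h1, h2, -⟩
    omega
  · obtain ⟨r, hr⟩ := exists_isBagRoot hT (hconn s) S.root
    refine ⟨r, hr, fun p _ => p.start_mem_support,
      ⟨1, le_rfl, le_rfl, fun p _ => p.start_mem_support⟩, ?_⟩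
    rintro y - ⟨j, h1, h2, hy⟩
    obtain rfl : j = 1 := by omega
    exact hy

theorem selView_one_root [DecidableEq V] (hS : S.Standing) (f : V → Option V) (s : V)
    (w : View V) : S.SelView f 1 S.root s w ↔
      (w = View.top ∧ S.TraceWin f s) ∨ (w = View.bot ∧ ¬ S.TraceWin f s) := by
  cases w <;> simp [SelView, psiGtAt_one_root hS]

/-- `ω₁^g(v₁)` is the singleton of `σ ↦ ⊤` iff all extensions of `g` have a winning trace
from `σ`. -/
theorem omega_one_root_eq_iff [DecidableEq V] (hS : S.Standing) {g : V → Option V}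
    (hg : S.Sel S.V0 g) :
    S.omega g 1 S.root = {fun (s : V) (w : View V) => s ∈ S.B S.root ∧ w = View.top} ↔
      ∀ f, S.Ext f g → S.TraceWin f S.sigma := by
  have hB : S.B S.root = {S.sigma} := hS.2.2.2
  have hview : ∀ f, S.viewOn f 1 S.root =
      (fun (s : V) (w : View V) => s ∈ S.B S.root ∧ w = View.top) ↔ S.TraceWin f S.sigma := by
    intro f
    constructor
    · intro h
      have := congrFun (congrFun h S.sigma) View.top
      simpa [viewOn, hB, selView_one_root hS] using this
    · intro h
      funext s w
      refine propext (and_congr_right fun hs => ?_)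
      obtain rfl : s = S.sigma := by simpa [hB] using hs
      simp [selView_one_root hS, h]
  constructor
  · intro h f hf
    have : S.viewOn f 1 S.root ∈ S.omega g 1 S.root := ⟨f, hf, rfl⟩
    rw [h] at this
    exact (hview f).mp this
  · intro h
    have hext : S.Ext g g := by
      refine ⟨fun s t hst => ⟨trivial, (hg s t hst).2⟩, fun _ _ => rfl, fun s hs => ?_⟩
      cases hgs : g s with
      | none => rfl
      | some t => exact absurd (hg s t hgs).1 hs
    refine Set.eq_singleton_iff_unique_mem.mpr ⟨⟨g, hext, ((hview g).mpr (h g hext)).symm⟩, ?_⟩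
    rintro _ ⟨f, hf, rfl⟩
    exact (hview f).mpr (h f hf)

open Classical in
/-- The player owning a vertex, with `true` for `P₀`. -/
noncomputable def owner (S : Setting V 𝒱) (s : V) : Bool := decide (s ∈ S.V0)

theorem owner_eq_true {s : V} : S.owner s = true ↔ s ∈ S.V0 := by simp [owner]

theorem owner_eq_false {s : V} : S.owner s = false ↔ s ∉ S.V0 := by simp [owner]

/-- The positional strategy `g` of player `b` wins from every vertex of `D` without leaving
`D`. -/
abbrev PosDom (S : Setting V 𝒱) (b : Bool) (D : Set V) (g : V → V) : Prop :=
  Dom S.E S.owner b (ParityWin S.c b) Set.univ ∅ D g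

theorem PosDom.exists_sel [Finite V] {D : Set V} {k : V → V} (h : S.PosDom true D k)
    {s : V} (hs : s ∈ D) :
    ∃ g, S.Sel S.V0 g ∧ ∀ f, S.Ext f g → S.TraceWin f s := by
  classical
  have hg : ∀ t u, (if t ∈ D ∧ t ∈ S.V0 then some (k t) else none) = some u →
      (t ∈ D ∧ t ∈ S.V0) ∧ k t = u := by
    intro t u htu
    split_ifs at htu with ht
    exact ⟨ht, by simpa using htu⟩
  refine ⟨fun t => if t ∈ D ∧ t ∈ S.V0 then some (k t) else none, ?_, ?_⟩
  · intro t u htu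
    obtain ⟨ht, rfl⟩ := hg t u htu
    exact ⟨ht.2, (h.own_step t (by simpa using ht.1) (owner_eq_true.mpr ht.2)).1⟩
  · rintro f ⟨hf, hfg, -⟩
    have hfk : ∀ t ∈ D, t ∈ S.V0 → f t = some (k t) := fun t ht ht0 => by
      rw [← hfg t ht0]
      exact if_pos ⟨ht, ht0⟩
    have hmem : ∀ n t, iter f s n = some t → t ∈ D := by
      refine iter_mem hs fun t ht u htu => ?_
      by_cases ht0 : t ∈ S.V0
      · rw [hfk t ht ht0, Option.some.injEq] at htu
        exact htu ▸ (h.own_step t (by simpa using ht) (owner_eq_true.mpr ht0)).2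
      · exact h.opp_step t (by simpa using ht) (by simpa [owner] using ht0) u trivial (hf t u htu).2
    by_cases hfin : ∃ n, iter f s n = none
    · obtain ⟨n, hn⟩ := hfin
      obtain ⟨j, t, hj, hft⟩ := exists_last_of_iter_eq_none hn
      refine Or.inl ⟨j, t, hj, hft, fun ht0 => ?_⟩
      simp [hfk t (hmem j t hj) ht0] at hft
    · push Not at hfin
      choose ρ hρ using fun n => Option.ne_none_iff_exists'.mp (hfin n)
      have hstep : ∀ n, f (ρ n) = some (ρ (n + 1)) := fun n => by
        simpa [iter, hρ n] using hρ (n + 1)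
      refine traceWin_of_parityWin hρ (h.win ρ ⟨fun n => ?_, fun n => ?_, fun n ho => ?_⟩)
      · simpa using hmem n _ (hρ n)
      · exact (hf _ _ (hstep n)).2
      · have := hfk _ (hmem n _ (hρ n)) (owner_eq_true.mp ho)
        simpa [hstep n] using this

theorem PosDom.exists_ext_not_traceWin [Finite V] {D : Set V} {k : V → V}
    (h : S.PosDom false D k) {s : V} (hs : s ∈ D) {g : V → Option V} (hg : S.Sel S.V0 g) :
    ∃ f, S.Ext f g ∧ ¬ S.TraceWin f s := by
  classical
  set f : V → Option V := fun t => if t ∈ S.V0 then g t else if t ∈ D then some (k t) else none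
    with hfdef
  have hf0 : ∀ t ∈ S.V0, f t = g t := fun t ht => by simp [hfdef, ht]
  have hf1 : ∀ t ∉ S.V0, t ∈ D → f t = some (k t) := fun t ht htD => by simp [hfdef, ht, htD]
  have hsel : ∀ t u, f t = some u → S.E t u := by
    intro t u htu
    by_cases ht0 : t ∈ S.V0
    · exact (hg t u (hf0 t ht0 ▸ htu)).2
    · by_cases htD : t ∈ D
      · rw [hf1 t ht0 htD, Option.some.injEq] at htu
        exact htu ▸ (h.own_step t (by simpa using htD) (owner_eq_false.mpr ht0)).1
      · simp [hfdef, ht0, htD] at htu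
  refine ⟨f, ⟨fun t u htu => ⟨trivial, hsel t u htu⟩, fun t ht => (hf0 t ht).symm, ?_⟩, ?_⟩
  · intro t ht
    cases hgt : g t with
    | none => rfl
    | some u => exact absurd (hg t u hgt).1 ht
  have hmem : ∀ n t, iter f s n = some t → t ∈ D := by
    refine iter_mem hs fun t ht u htu => ?_
    by_cases ht0 : t ∈ S.V0
    · exact h.opp_step t (by simpa using ht) (by simpa [owner] using ht0) u trivial (hsel t u htu)
    · rw [hf1 t ht0 ht, Option.some.injEq] at htu
      exact htu ▸ (h.own_step t (by simpa using ht) (owner_eq_false.mpr ht0)).2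
  by_cases hfin : ∃ n, iter f s n = none
  · obtain ⟨n, hn⟩ := hfin
    rintro (⟨j, t, hj, hft, ht0⟩ | ⟨hinf, -⟩)
    · simp [hf1 t ht0 (hmem j t hj)] at hft
    · exact hinf n hn
  · push Not at hfin
    choose ρ hρ using fun n => Option.ne_none_iff_exists'.mp (hfin n)
    have hstep : ∀ n, f (ρ n) = some (ρ (n + 1)) := fun n => by
      simpa [iter, hρ n] using hρ (n + 1)
    refine not_traceWin_of_parityWin hρ (h.win ρ ⟨fun n => ?_, fun n => ?_, fun n ho => ?_⟩)
    · simpa using hmem n _ (hρ n)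
    · exact hsel _ _ (hstep n)
    · have := hf1 _ (owner_eq_false.mp ho) (hmem n _ (hρ n))
      simpa [hstep n] using this

theorem finPath_concat {E : V → V → Prop} {p : List V} {u t : V} (hp : FinPath E p)
    (hu : p.getLast? = some u) : FinPath E (p ++ [t]) ↔ E u t := by
  have hchain : p.IsChain E := hp.2
  constructor
  · intro h
    exact (List.isChain_append.mp h.2).2.2 u hu t (by simp)
  · intro h
    refine ⟨by simp, List.isChain_append.mpr ⟨hchain, by simp, ?_⟩⟩
    intro x hx y hy
    simp only [hu, Option.mem_def, Option.some.injEq, List.head?_cons] at hx hy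
    exact hx ▸ hy ▸ h

theorem stratCompat_concat {st : List V → Option V} {p : List V} (hne : p ≠ []) {t : V}
    (hp : StratCompat st p) (h : ∀ u, st p = some u → t = u) : StratCompat st (p ++ [t]) := by
  intro j hj u hu
  have hlen : 0 < p.length := List.length_pos_iff.mpr hne
  simp only [List.length_append, List.length_singleton] at hj
  rw [List.take_append_of_le_length (by omega)] at hu
  rcases Nat.lt_or_ge (j + 1) p.length with hlt | hge
  · rw [List.getElem?_append_left hlt]
    exact hp j hlt u hu
  · have heq : j + 1 = p.length := by omega
    rw [heq, List.take_length] at hu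
    simp [heq, h u hu]

theorem PosDom.winFrom {D : Set V} {k : V → V} (h : S.PosDom true D k) {s : V} (hs : s ∈ D) :
    S.WinFrom s := by
  classical
  have hex : ∃ sel : V → Option V, (∀ u t, sel u = some t → u ∈ S.V0 ∧ S.E u t) ∧
      (∀ u ∈ S.V0, (∃ t, S.E u t) → sel u ≠ none) ∧
      ∀ u ∈ D, u ∈ S.V0 → sel u = some (k u) := by
    refine ⟨fun u => if u ∈ S.V0 then (if u ∈ D then some (k u) else
      if hu : ∃ t, S.E u t then some hu.choose else none) else none, ?_, ?_, ?_⟩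
    · intro u t hut
      by_cases hu0 : u ∈ S.V0
      · by_cases huD : u ∈ D
        · simp only [hu0, huD, if_true, Option.some.injEq] at hut
          exact ⟨hu0, hut ▸ (h.own_step u (by simpa using huD) (owner_eq_true.mpr hu0)).1⟩
        · by_cases hE : ∃ t, S.E u t
          · simp only [hu0, huD, hE, if_true, if_false, dif_pos, Option.some.injEq] at hut
            exact ⟨hu0, hut ▸ hE.choose_spec⟩
          · simp [hu0, huD, hE] at hut
      · simp [hu0] at hut
    · intro u hu0 hE
      by_cases huD : u ∈ D <;> simp [hu0, huD, hE]
    · intro u huD hu0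
      simp [hu0, huD]
  obtain ⟨sel, hsel, htot, hk⟩ := hex
  have hD : ∀ u ∈ D, ∀ t, S.E u t → (∀ t', sel u = some t' → t = t') → t ∈ D := by
    intro u huD t hE ht
    by_cases hu0 : u ∈ S.V0
    · rw [ht _ (hk u huD hu0)]
      exact (h.own_step u (by simpa using huD) (owner_eq_true.mpr hu0)).2
    · exact h.opp_step u (by simpa using huD) (by simpa [owner] using hu0) t trivial hE
  refine ⟨fun p => p.getLast?.bind sel, ⟨?_, ?_⟩, ?_, ?_⟩
  · intro p t hpt
    obtain ⟨u, hu, hut⟩ := Option.bind_eq_some_iff.mp hpt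
    exact ⟨u, hu, hsel u t hut⟩
  · intro p u _ hu hu0 hE
    simpa [hu] using htot u hu0 hE
  · intro p hp hhead hcompat hmaximal
    have hmem : ∀ (j : ℕ) (u : V), p[j]? = some u → u ∈ D := by
      intro j
      induction j with
      | zero =>
        intro u hu
        rw [← List.head?_eq_getElem?, hhead, Option.some.injEq] at hu
        exact hu ▸ hs
      | succ j ih =>
        intro t ht
        obtain ⟨hlt, rfl⟩ := List.getElem?_eq_some_iff.mp ht
        have hj : p[j]? = some p[j] := List.getElem?_eq_getElem (by omega)
        refine hD _ (ih _ hj) _ (List.isChain_iff_getElem.mp hp.2 j hlt) fun t' ht' => ?_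
        have := hcompat j hlt t' (by simpa [List.getLast?_take, hj] using ht')
        simpa [ht] using this
    obtain ⟨u, hu⟩ := Option.ne_none_iff_exists'.mp
      (fun h' => hp.1 (List.getLast?_eq_none_iff.mp h'))
    refine ⟨u, hu, fun hu0 => hmaximal ⟨k u, ?_, ?_⟩⟩
    · have huD : u ∈ D := hmem _ u (List.getLast?_eq_getElem? ▸ hu)
      exact (finPath_concat hp hu).mpr
        (h.own_step u (by simpa using huD) (owner_eq_true.mpr hu0)).1
    · have huD : u ∈ D := hmem _ u (List.getLast?_eq_getElem? ▸ hu)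
      refine stratCompat_concat hp.1 hcompat fun t ht => ?_
      simpa [hu, hk u huD hu0] using ht
  · intro ρ h0 hE hcons
    have hcons' : ∀ n t, sel (ρ n) = some t → ρ (n + 1) = t := by
      intro n t ht
      refine hcons n t ?_
      rw [List.ofFn_succ_last]
      simpa using ht
    have hmem : ∀ n, ρ n ∈ D := by
      intro n
      induction n with
      | zero => exact h0 ▸ hs
      | succ n ih => exact hD _ ih _ (hE n) (hcons' n)
    refine infWin_of_parityWin (h.win ρ ⟨fun n => by simpa using hmem n, hE, fun n ho => ?_⟩)
    exact hcons' n _ (hk _ (hmem n) (owner_eq_true.mp ho))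

theorem PosDom.not_winFrom {D : Set V} {k : V → V} (h : S.PosDom false D k) {s : V}
    (hs : s ∈ D) : ¬ S.WinFrom s := by
  rintro ⟨st, ⟨hst, htot⟩, hfin, hinf⟩
  let next : List V → V := fun p => (st p).getD (k (p.getLast?.getD s))
  let hist : ℕ → List V := fun n => Nat.rec [s] (fun _ p => p ++ [next p]) n
  have hist_succ : ∀ n, hist (n + 1) = hist n ++ [next (hist n)] := fun _ => rfl
  let ρ : ℕ → V := fun n => (hist n).getLast?.getD s
  have hlast : ∀ n, (hist n).getLast? = some (ρ n) := by
    intro n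
    cases n with
    | zero => rfl
    | succ n => simp [ρ, hist_succ]
  have hρ_succ : ∀ n, ρ (n + 1) = next (hist n) := fun n => by simp [ρ, hist_succ]
  have hofFn : ∀ n, List.ofFn (fun j : Fin (n + 1) => ρ j) = hist n := by
    intro n
    induction n with
    | zero => simp [ρ, hist]
    | succ n ih =>
      rw [List.ofFn_succ_last, hist_succ, ← hρ_succ, ← ih]
      rfl
  have hfollow : ∀ n, ρ n ∉ S.V0 → ρ (n + 1) = k (ρ n) := by
    intro n hn
    have hnone : st (hist n) = none := by
      cases hc : st (hist n) with
      | none => rfl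
      | some t =>
        obtain ⟨u, hu, hu0, -⟩ := hst _ _ hc
        rw [hlast, Option.some.injEq] at hu
        exact absurd (hu ▸ hu0) hn
    simp [hρ_succ, next, hnone, hlast]
  have hcons : ∀ n t, st (hist n) = some t → ρ (n + 1) = t := by
    intro n t ht
    simp [hρ_succ, next, ht]
  have hstep : ∀ n, FinPath S.E (hist n) → (hist n).head? = some s → StratCompat st (hist n) →
      ρ n ∈ D → S.E (ρ n) (ρ (n + 1)) ∧ ρ (n + 1) ∈ D := by
    intro n hp hhead hcompat hD
    by_cases h0 : ρ n ∈ S.V0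
    · cases hc : st (hist n) with
      | none =>
        exfalso
        obtain ⟨u, hu, hu0⟩ := hfin _ hp hhead hcompat fun ⟨t, ht, _⟩ =>
          htot _ _ hp (hlast n) h0 ⟨t, (finPath_concat hp (hlast n)).mp ht⟩ hc
        rw [hlast, Option.some.injEq] at hu
        exact hu0 (hu ▸ h0)
      | some t =>
        obtain ⟨u, hu, -, hE⟩ := hst _ _ hc
        rw [hlast, Option.some.injEq] at hu
        rw [hcons n t hc, hu]
        exact ⟨hE, h.opp_step u (by simpa [hu] using hD) (by simpa [owner, ← hu] using h0) t
          trivial hE⟩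
    · rw [hfollow n h0]
      exact h.own_step _ (by simpa using hD) (owner_eq_false.mpr h0)
  have hinv : ∀ n, FinPath S.E (hist n) ∧ (hist n).head? = some s ∧ StratCompat st (hist n) ∧
      ρ n ∈ D := by
    intro n
    induction n with
    | zero =>
      refine ⟨⟨by simp [hist], List.isChain_singleton s⟩, rfl, fun j hj => ?_, hs⟩
      simp [hist] at hj
    | succ n ih =>
      obtain ⟨hp, hhead, hcompat, hD⟩ := ih
      have hs' := hstep n hp hhead hcompat hD
      rw [hist_succ, ← hρ_succ]
      refine ⟨(finPath_concat hp (hlast n)).mpr hs'.1, ?_, ?_, hs'.2⟩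
      · simp [List.head?_append, hhead]
      · exact stratCompat_concat hp.1 hcompat (hcons n)
  have hE : ∀ n, S.E (ρ n) (ρ (n + 1)) := fun n =>
    (hstep n (hinv n).1 (hinv n).2.1 (hinv n).2.2.1 (hinv n).2.2.2).1
  refine not_infWin_of_parityWin (h.win ρ ⟨fun n => by simpa using (hinv n).2.2.2, hE,
    fun n ho => hfollow n (owner_eq_false.mp ho)⟩) (hinf ρ rfl hE fun n t ht => ?_)
  exact hcons n t (hofFn n ▸ ht)

end Setting

/-- The vertex `σ` is winning for player `P₀` iff there exists a
`V₀`-selector `g` such that `ω₁^g(v₁)` is the singleton set consisting of the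
function `σ ↦ ⊤` on the bag `B v₁ = {σ}`. -/
theorem winning_iff_omega_singleton_top {V : Type u} {𝒱 : Type v}
    [Fintype V] [DecidableEq V] [Fintype 𝒱]
    (S : Setting V 𝒱) (hS : S.Standing) (hV : 2 ≤ Fintype.card V) :
    S.WinFrom S.sigma ↔
      ∃ g : V → Option V, S.Sel S.V0 g ∧
        S.omega g 1 S.root =
          {fun (s : V) (w : View V) => s ∈ S.B S.root ∧ w = View.top} := by
  constructor
  · intro hwin
    obtain ⟨W, k, hdom, hcover⟩ := exists_dom_cover S.E S.owner S.c Set.univ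
    rcases hcover (Set.mem_univ S.sigma) with h | h
    · obtain ⟨g, hg, hall⟩ := Setting.PosDom.exists_sel (hdom true) h
      exact ⟨g, hg, (Setting.omega_one_root_eq_iff hS hg).mpr hall⟩
    · exact absurd hwin (Setting.PosDom.not_winFrom (hdom false) h)
  · rintro ⟨g, hg, homega⟩
    obtain ⟨W, k, hdom, hcover⟩ := exists_dom_cover S.E S.owner S.c Set.univ
    rcases hcover (Set.mem_univ S.sigma) with h | h
    · exact Setting.PosDom.winFrom (hdom true) h
    · obtain ⟨f, hf, hlose⟩ := Setting.PosDom.exists_ext_not_traceWin (hdom false) h hg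
      exact absurd ((Setting.omega_one_root_eq_iff hS hg).mp homega f hf) hlose
end

section
/- Let i ≤ ℓ−1 be a critical index and let θ_i be the unique vertex with Ψ_{>i−1} = Ψ_{>i} ⊎ {θ_i}. For a V_0-selector g and vertices x,y ∈ V, define B(g)_{x,y} ⊆ {⊥,⊤} by: B(g)_{x,y} = {⊥} if (x,y) ∉ E, or x ∈ V_0∖dom(g), or x ∈ dom(g) and g(x) ≠ y; B(g)_{x,y} = {⊤} if x ∈ dom(g) and g(x) = y; B(g)_{x,y} = {⊥,⊤} if (x,y) ∈ E and x ∉ V_0. Then for all V_0-selectors g and h: if ω_{i+1}^g(v) = ω_{i+1}^h(v) for every v ∈ Θ_{i+1}, and B(g)_{θ_i,s} = B(h)_{θ_i,s} and B(g)_{s,θ_i} = B(h)_{s,θ_i} for every s ∈ 𝐓(v_i), then ω_i^g(v) = ω_i^h(v) for every v ∈ Θ_i. -/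
universe u v

namespace Anc

variable {𝒱 : Type v} {T : SimpleGraph 𝒱} {root x y z : 𝒱}

lemma iff_mem_support (hT : T.IsTree) (p : T.Walk root y) (hp : p.IsPath) :
    Anc T root x y ↔ x ∈ p.support := by
  refine ⟨fun h => h p hp, fun h q hq => ?_⟩
  rwa [hT.existsUnique_path root y |>.unique hq hp]

lemma refl (T : SimpleGraph 𝒱) (root x : 𝒱) : Anc T root x x := fun p _ => p.end_mem_support

lemma root_anc (T : SimpleGraph 𝒱) (root x : 𝒱) : Anc T root root x :=
  fun p _ => p.start_mem_support

lemma eq_root (hx : Anc T root x root) : x = root := by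
  simpa using hx .nil .nil

lemma trans (hxy : Anc T root x y) (hyz : Anc T root y z) : Anc T root x z := by
  classical
  intro p hp
  have hy := hyz p hp
  exact p.support_takeUntil_subset_support hy (hxy _ (hp.takeUntil hy))

lemma antisymm (hT : T.IsTree) (hxy : Anc T root x y) (hyx : Anc T root y x) : x = y := by
  classical
  obtain ⟨p, hp, -⟩ := hT.existsUnique_path root y
  have hx := hxy p hp
  by_contra hne
  exact SimpleGraph.Walk.endpoint_notMem_support_takeUntil hp hx (Ne.symm hne)
    (hyx _ (hp.takeUntil hx))

end Anc

/-- `b` is a child of `a` in the tree `T` rooted at `root`. -/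
def IsChild {𝒱 : Type v} (T : SimpleGraph 𝒱) (root a b : 𝒱) : Prop :=
  ¬ Anc T root b a ∧ ∀ x, Anc T root x b ↔ Anc T root x a ∨ x = b

section Tree

variable {𝒱 : Type v} {T : SimpleGraph 𝒱} {root a b x y z : 𝒱}

lemma isChild_of_adj_of_not_anc (hT : T.IsTree) (hab : T.Adj a b) (h : ¬ Anc T root b a) :
    IsChild T root a b := by
  obtain ⟨p, hp, -⟩ := hT.existsUnique_path root a
  refine ⟨h, fun x => ?_⟩
  have hb : b ∉ p.support := fun hb => h ((Anc.iff_mem_support hT p hp).2 hb)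
  rw [Anc.iff_mem_support hT p hp, Anc.iff_mem_support hT (p.concat hab) (hp.concat hb hab)]
  simp [SimpleGraph.Walk.support_concat]

lemma isChild_or_isChild_of_adj (hT : T.IsTree) (root : 𝒱) (hab : T.Adj a b) :
    IsChild T root a b ∨ IsChild T root b a := by
  by_cases h : Anc T root b a
  · exact .inr (isChild_of_adj_of_not_anc hT hab.symm
      fun h' => hab.ne (Anc.antisymm hT h' h))
  · exact .inl (isChild_of_adj_of_not_anc hT hab h)

lemma IsChild.anc (h : IsChild T root a b) : Anc T root a b := (h.2 a).2 (.inl (Anc.refl T root a))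

lemma IsChild.parent_unique (hT : T.IsTree) (ha : IsChild T root a x) (hb : IsChild T root b x) :
    a = b := by
  refine Anc.antisymm (root := root) hT ?_ ?_
  · refine ((hb.2 a).1 ha.anc).resolve_right ?_
    rintro rfl
    exact ha.1 (Anc.refl T root a)
  · refine ((ha.2 b).1 hb.anc).resolve_right ?_
    rintro rfl
    exact hb.1 (Anc.refl T root b)

/-- A tree edge can leave the subtree below `x` only through `x` itself. -/
lemma eq_of_adj_of_anc_of_not_anc (hT : T.IsTree) (hab : T.Adj a b) (ha : Anc T root x a)
    (hb : ¬ Anc T root x b) : a = x := by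
  rcases isChild_or_isChild_of_adj hT root hab with h | h
  · exact absurd ((h.2 x).2 (.inl ha)) hb
  · exact (((h.2 x).1 ha).resolve_left hb).symm

lemma Anc.total (hT : T.IsTree) (hx : Anc T root x z) (hy : Anc T root y z) :
    Anc T root x y ∨ Anc T root y x := by
  obtain ⟨p⟩ := hT.connected.preconnected z root
  induction p with
  | nil => rw [hx.eq_root, hy.eq_root]; exact .inl (Anc.refl _ _ _)
  | cons hadj q ih =>
    rcases isChild_or_isChild_of_adj hT _ hadj with h | h
    · exact ih ((h.2 x).2 (.inl hx)) ((h.2 y).2 (.inl hy))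
    · rcases (h.2 x).1 hx with hx' | rfl
      · rcases (h.2 y).1 hy with hy' | rfl
        · exact ih hx' hy'
        · exact .inl hx
      · exact .inr hy

end Tree

section TreeDecomp

variable {V : Type u} {𝒱 : Type v} {E : V → V → Prop} {T : SimpleGraph 𝒱} {B : 𝒱 → Finset V}
  {root x y z r : 𝒱} {s : V}

/-- Vertices shared by a bag below `x` and a bag not below `x` belong to the bag of `x`. -/
lemma IsTreeDecomp.mem_of_anc_of_not_anc (hD : IsTreeDecomp E T B) (hy : s ∈ B y) (hz : s ∈ B z)
    (hxy : Anc T root x y) (hxz : ¬ Anc T root x z) : s ∈ B x := by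
  obtain ⟨p⟩ := (hD.2.2 s).preconnected ⟨y, hy⟩ ⟨z, hz⟩
  obtain ⟨a, b, hab, ha, hb⟩ : ∃ a b : {w : 𝒱 | s ∈ B w}, T.Adj a b ∧
      Anc T root x a ∧ ¬ Anc T root x b := by
    obtain ⟨d, -, h1, h2⟩ := p.exists_boundary_dart {w | Anc T root x w} hxy hxz
    exact ⟨d.fst, d.snd, by simpa using d.adj, h1, h2⟩
  rw [← eq_of_adj_of_anc_of_not_anc hD.1 hab ha hb]
  exact a.2

lemma IsTreeDecomp.exists_isBagRoot [Finite 𝒱] (hD : IsTreeDecomp E T B) (root : 𝒱) (s : V) :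
    ∃ r, IsBagRoot T root B s r := by
  obtain ⟨⟨x₀, hx₀⟩⟩ := (hD.2.2 s).nonempty
  obtain ⟨r, hr, hmin⟩ := Set.exists_min_image {x | s ∈ B x} (fun x => {y | Anc T root y x}.ncard)
    (Set.toFinite _) ⟨x₀, hx₀⟩
  refine ⟨r, hr, fun x hx => ?_⟩
  by_contra hrx
  obtain ⟨p⟩ := (hD.2.2 s).preconnected ⟨r, hr⟩ ⟨x, hx⟩
  obtain ⟨d, -, h1, h2⟩ := p.exists_boundary_dart {w | Anc T root r w} (Anc.refl T root r) hrx
  have hadj : T.Adj d.fst d.snd := by simpa using d.adj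
  have hfst : d.fst.1 = r := eq_of_adj_of_anc_of_not_anc hD.1 hadj h1 h2
  have hchild := isChild_of_adj_of_not_anc hD.1 hadj.symm (fun h => h2 (hfst ▸ h))
  rw [hfst] at hchild
  refine (hmin d.snd d.snd.2).not_gt (Set.ncard_lt_ncard ⟨fun y hy => (hchild.2 y).2 (.inl hy),
    fun h => hchild.1 (h (Anc.refl T root r))⟩ (Set.toFinite _))

lemma IsBagRoot.unique (hT : T.IsTree) (hx : IsBagRoot T root B s x)
    (hy : IsBagRoot T root B s y) : x = y :=
  Anc.antisymm hT (hx.2 y hy.1) (hy.2 x hx.1)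

end TreeDecomp

section Iter

variable {V : Type u} {f f' : V → Option V} {s t : V} {j k n : ℕ}

lemma iter_one (f : V → Option V) (s : V) : iter f s 1 = f s := rfl

lemma iter_add (h : iter f s j = some t) (n : ℕ) : iter f s (j + n) = iter f t n := by
  induction n with
  | zero => exact h
  | succ n ih => rw [← add_assoc, iter, ih, iter]

lemma iter_succ_of_eq_some (h : iter f s j = some t) : iter f s (j + 1) = f t :=
  iter_add h 1

lemma exists_iter_of_le (h : iter f s j = some t) (hn : n ≤ j) : ∃ u, iter f s n = some u := by
  induction j, hn using Nat.le_induction generalizing t with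
  | base => exact ⟨t, h⟩
  | succ j _ ih =>
    obtain ⟨u, hu, -⟩ := Option.bind_eq_some_iff.1 h
    exact ih hu

lemma iter_ne_none_iff (h : iter f s j = some t) :
    (∀ n, iter f s n ≠ none) ↔ ∀ n, iter f t n ≠ none := by
  refine ⟨fun H n => iter_add h n ▸ H _, fun H n => ?_⟩
  obtain ⟨u, hu⟩ := Option.ne_none_iff_exists'.1 (H n)
  obtain ⟨u', hu'⟩ := exists_iter_of_le ((iter_add h n).trans hu) (Nat.le_add_left n j)
  simp [hu']

lemma infOcc_iff_of_iter (h : iter f s j = some t) (u : V) : infOcc f s u ↔ infOcc f t u := by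
  refine ⟨fun H N => ?_, fun H N => ?_⟩
  · obtain ⟨n, hn, hu⟩ := H (j + N)
    obtain ⟨k, rfl⟩ := Nat.exists_eq_add_of_le (Nat.le_of_add_right_le hn)
    exact ⟨k, by omega, by rwa [iter_add h] at hu⟩
  · obtain ⟨n, hn, hu⟩ := H N
    exact ⟨j + n, by omega, by rwa [iter_add h]⟩

/-- If `f'` agrees with `f` at the first `n` vertices of the trace of `f`, then the traces agree
up to step `n`. -/
lemma iter_congr (h : ∀ k < n, ∀ u, iter f s k = some u → f' u = f u) :
    iter f' s n = iter f s n := by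
  induction n with
  | zero => rfl
  | succ n ih =>
    rw [iter, iter, ih fun k hk => h k (hk.trans n.lt_succ_self)]
    cases hu : iter f s n with
    | none => rfl
    | some u => exact h n n.lt_succ_self u hu

lemma iter_mod (h : iter f s k = some s) (n : ℕ) : iter f s n = iter f s (n % k) := by
  have key : ∀ q r, iter f s (k * q + r) = iter f s r := by
    intro q
    induction q with
    | zero => simp
    | succ q ih => intro r; rw [Nat.mul_succ, add_assoc, ih, iter_add h]
  conv_lhs => rw [← Nat.div_add_mod n k]
  exact key _ _

end Iter

namespace Setting

variable {V : Type u} {𝒱 : Type v} (S : Setting V 𝒱)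

/-- After `j` steps the trace of `f` from `s` reaches `t`, its intermediate vertices lie in `P`,
and `m` is the maximal color seen before reaching `t`. -/
structure Segment (f : V → Option V) (P : Set V) (s t : V) (j m : ℕ) : Prop where
  reach : iter f s j = some t
  mem : ∀ (n : ℕ) (u : V), 1 ≤ n → n < j → iter f s n = some u → u ∈ P
  color : ∃ (n : ℕ) (u : V), n < j ∧ iter f s n = some u ∧ S.c u = m
  color_le : ∀ (n : ℕ) (u : V), n < j → iter f s n = some u → S.c u ≤ m

/-- The selector view of `f` from `s` relative to an arbitrary set `P` of vertices. -/
def ViewIn (f : V → Option V) (P : Set V) (s : V) : View V → Prop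
  | .unk => (f s = none ∧ s ∉ P) ∨ ∃ t, f s = some t ∧ t ∉ P
  | .top => (f s ≠ none ∨ s ∈ P) ∧ (∀ n t, 1 ≤ n → iter f s n = some t → t ∈ P) ∧ S.TraceWin f s
  | .bot => (f s ≠ none ∨ s ∈ P) ∧ (∀ n t, 1 ≤ n → iter f s n = some t → t ∈ P) ∧ ¬ S.TraceWin f s
  | .exit t m => ∃ j, 2 ≤ j ∧ t ∉ P ∧ S.Segment f P s t j m

variable {S} {f f' : V → Option V} {P Q : Set V} {s t θ : V} {i j k m m' : ℕ} {x : 𝒱}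
  {w w' : View V}

lemma selView_iff_viewIn : S.SelView f i x s w ↔ S.ViewIn f (S.psiGtAt i x) s w := by
  cases w with
  | exit t m =>
    constructor
    · rintro ⟨j, h1, h2, h3, h4, h5, h6⟩
      exact ⟨j, h1, h3, h2, h4, h5, h6⟩
    · rintro ⟨j, h1, h3, h2, h4, h5, h6⟩
      exact ⟨j, h1, h2, h3, h4, h5, h6⟩
  | _ => exact Iff.rfl

lemma Segment.mono (hPQ : P ⊆ Q) (h : S.Segment f P s t j m) : S.Segment f Q s t j m :=
  ⟨h.reach, fun n u h1 h2 h3 => hPQ (h.mem n u h1 h2 h3), h.color, h.color_le⟩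

lemma Segment.single (h : f s = some t) : S.Segment f P s t 1 (S.c s) where
  reach := h
  mem n u h1 h2 := by omega
  color := ⟨0, s, one_pos, rfl, rfl⟩
  color_le n u hn hu := by
    obtain rfl : n = 0 := by omega
    cases hu
    exact le_rfl

lemma Segment.append {u : V} (h : S.Segment f P s t j m) (ht : t ∈ P)
    (h' : S.Segment f P t u k m') : S.Segment f P s u (j + k) (max m m') where
  reach := by rw [iter_add h.reach, h'.reach]
  mem n v h1 h2 hv := by
    rcases lt_trichotomy n j with hn | rfl | hn
    · exact h.mem n v h1 hn hv
    · rw [h.reach] at hv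
      cases hv
      exact ht
    · obtain ⟨l, rfl⟩ := Nat.exists_eq_add_of_lt hn
      rw [add_assoc, iter_add h.reach] at hv
      exact h'.mem _ v (by omega) (by omega) hv
  color := by
    rcases le_total m m' with hm | hm
    · obtain ⟨n, v, hn, hv, hc⟩ := h'.color
      exact ⟨j + n, v, by omega, by rwa [iter_add h.reach], by rw [hc, max_eq_right hm]⟩
    · obtain ⟨n, v, hn, hv, hc⟩ := h.color
      exact ⟨n, v, by omega, hv, by rw [hc, max_eq_left hm]⟩
  color_le n v hn hv := by
    rcases lt_or_ge n j with hnj | hnj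
    · exact (h.color_le n v hnj hv).trans (le_max_left _ _)
    · obtain ⟨l, rfl⟩ := Nat.exists_eq_add_of_le hnj
      rw [iter_add h.reach] at hv
      exact (h'.color_le l v (by omega) hv).trans (le_max_right _ _)

lemma Segment.exists_color (hj : 1 ≤ j) (h : iter f s j = some t)
    (hP : ∀ n u, 1 ≤ n → n < j → iter f s n = some u → u ∈ P) : ∃ m, S.Segment f P s t j m := by
  induction j, hj using Nat.le_induction generalizing t with
  | base => exact ⟨_, Segment.single h⟩
  | succ j hj ih =>
    obtain ⟨u, hu⟩ := exists_iter_of_le h j.le_succ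
    obtain ⟨m, hm⟩ := ih hu fun n v h1 h2 => hP n v h1 (h2.trans j.lt_succ_self)
    rw [iter_succ_of_eq_some hu] at h
    exact ⟨_, hm.append (hP j u hj j.lt_succ_self hu) (Segment.single h)⟩

lemma Segment.congr (hs : f' s = f s) (hP : ∀ u ∈ P, f' u = f u) (h : S.Segment f P s t j m) :
    S.Segment f' P s t j m := by
  have key : ∀ n ≤ j, iter f' s n = iter f s n := fun n hn => iter_congr fun k hk u hu => by
    rcases Nat.eq_zero_or_pos k with rfl | hk0
    · cases hu
      exact hs
    · exact hP u (h.mem k u hk0 (by omega) hu)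
  obtain ⟨n, u, hn, hu, hc⟩ := h.color
  exact ⟨by rw [key j le_rfl, h.reach], fun n u h1 h2 hu => h.mem n u h1 h2 (key n h2.le ▸ hu),
    ⟨n, u, hn, by rw [key n hn.le, hu], hc⟩, fun n u hn hu => h.color_le n u hn (key n hn.le ▸ hu)⟩

lemma traceWin_iff_of_iter (h : iter f s j = some t) : S.TraceWin f s ↔ S.TraceWin f t := by
  refine or_congr ⟨?_, ?_⟩ (by simp only [iter_ne_none_iff h, infOcc_iff_of_iter h])
  · rintro ⟨n, u, hu, hn, h0⟩
    rcases lt_or_ge n j with hnj | hnj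
    · obtain ⟨v, hv⟩ := exists_iter_of_le h (Nat.succ_le_of_lt hnj)
      rw [Nat.succ_eq_add_one, iter_succ_of_eq_some hu, hn] at hv
      cases hv
    · obtain ⟨l, rfl⟩ := Nat.exists_eq_add_of_le hnj
      exact ⟨l, u, by rwa [iter_add h] at hu, hn, h0⟩
  · rintro ⟨n, u, hu, hn, h0⟩
    exact ⟨j + n, u, by rwa [iter_add h], hn, h0⟩

lemma traceWin_congr (h : ∀ n u, iter f s n = some u → f' u = f u) :
    S.TraceWin f' s ↔ S.TraceWin f s := by
  have key : iter f' s = iter f s := funext fun n => iter_congr fun k _ => h k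
  unfold TraceWin infOcc
  rw [key]
  refine or_congr (exists_congr fun n => exists_congr fun t => and_congr_right fun ht => ?_) Iff.rfl
  rw [h n t ht]

lemma traceWin_of_none (h : f s = none) : S.TraceWin f s ↔ s ∉ S.V0 := by
  constructor
  · rintro (⟨n, t, ht, -, h0⟩ | ⟨H, -⟩)
    · cases n with
      | zero => cases ht; exact h0
      | succ n =>
        obtain ⟨u, hu⟩ := exists_iter_of_le (n := 1) ht (by omega)
        rw [iter_one, h] at hu
        cases hu
    · exact absurd h (H 1)
  · exact fun h0 => .inl ⟨0, s, rfl, h, h0⟩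

lemma Segment.traceWin_loop (hk : 1 ≤ k) (h : S.Segment f P s s k m) :
    S.TraceWin f s ↔ Even m := by
  have hne : ∀ n, iter f s n ≠ none := fun n => by
    rw [iter_mod h.reach]
    obtain ⟨u, hu⟩ := exists_iter_of_le h.reach (Nat.mod_lt n hk).le
    simp [hu]
  have hinf : ∀ u, infOcc f s u ↔ ∃ n < k, iter f s n = some u := by
    refine fun u => ⟨fun H => ?_, fun ⟨n, _, hu⟩ N => ⟨k * N + n, ?_, ?_⟩⟩
    · obtain ⟨n, -, hu⟩ := H 0
      exact ⟨n % k, Nat.mod_lt n hk, by rwa [← iter_mod h.reach]⟩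
    · nlinarith
    · rw [iter_mod h.reach, Nat.mul_add_mod, ← iter_mod h.reach, hu]
  constructor
  · rintro (⟨n, t, ht, hn, -⟩ | ⟨-, m', hm', ⟨t, ht, hc⟩, hle⟩)
    · exact absurd ((iter_succ_of_eq_some ht).trans hn) (hne _)
    · obtain ⟨n, hn, hu⟩ := (hinf t).1 ht
      obtain ⟨n', u', hn', hu', hc'⟩ := h.color
      have h1 := h.color_le n t hn hu
      have h2 := hle u' ((hinf u').2 ⟨n', hn', hu'⟩)
      rwa [show m = m' by omega]
  · intro hm
    obtain ⟨n, u, hn, hu, hc⟩ := h.color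
    refine .inr ⟨hne, m, hm, ⟨u, (hinf u).2 ⟨n, hn, hu⟩, hc⟩, fun t ht => ?_⟩
    obtain ⟨n', hn', hu'⟩ := (hinf t).1 ht
    exact h.color_le n' t hn' hu'

lemma ViewIn.total (f : V → Option V) (P : Set V) (s : V) : ∃ w, S.ViewIn f P s w := by
  classical
  by_cases hin : ∀ n t, 1 ≤ n → iter f s n = some t → t ∈ P
  · by_cases h0 : f s ≠ none ∨ s ∈ P
    · by_cases hw : S.TraceWin f s
      exacts [⟨.top, h0, hin, hw⟩, ⟨.bot, h0, hin, hw⟩]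
    · push Not at h0
      exact ⟨.unk, .inl h0⟩
  · push Not at hin
    let hex : ∃ n t, 1 ≤ n ∧ iter f s n = some t ∧ t ∉ P := hin
    obtain ⟨t, hn1, ht, htP⟩ := Nat.find_spec hex
    have hmin : ∀ n u, 1 ≤ n → n < Nat.find hex → iter f s n = some u → u ∈ P :=
      fun n u h1 h2 hu => by_contra fun hP => Nat.find_min hex h2 ⟨u, h1, hu, hP⟩
    rcases hn1.eq_or_lt with h1 | h1
    · rw [← h1] at ht
      exact ⟨.unk, .inr ⟨t, ht, htP⟩⟩
    · obtain ⟨m, hm⟩ := Segment.exists_color (S := S) hn1 ht hmin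
      exact ⟨.exit t m, _, h1, htP, hm⟩

lemma ViewIn.exit_first {m : ℕ} (h : S.ViewIn f P s (.exit t m)) : ∃ u ∈ P, f s = some u := by
  obtain ⟨j, hj, -, h⟩ := h
  obtain ⟨u, hu⟩ := exists_iter_of_le h.reach (n := 1) (by omega)
  exact ⟨u, h.mem 1 u le_rfl (by omega) hu, hu⟩

lemma not_viewIn_unk_of_stays (h0 : f s ≠ none ∨ s ∈ P)
    (hin : ∀ n t, 1 ≤ n → iter f s n = some t → t ∈ P) : ¬ S.ViewIn f P s .unk := by
  rintro (⟨h1, h2⟩ | ⟨t, ht, htP⟩)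
  · exact h0.elim (· h1) h2
  · exact htP (hin 1 t le_rfl ht)

lemma ViewIn.not_unk_of_exit (h : S.ViewIn f P s (.exit t m)) : ¬ S.ViewIn f P s .unk := by
  obtain ⟨u, hu, hs⟩ := h.exit_first
  rintro (⟨h1, -⟩ | ⟨v, hv, hvP⟩)
  · simp [h1] at hs
  · rw [hs] at hv
    cases hv
    exact hvP hu

lemma not_viewIn_exit_of_stays (hin : ∀ n t, 1 ≤ n → iter f s n = some t → t ∈ P) :
    ¬ S.ViewIn f P s (.exit t m) := by
  rintro ⟨j, hj, htP, h⟩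
  exact htP (hin j t (by omega) h.reach)

lemma ViewIn.exit_unique {t' : V} (h : S.ViewIn f P s (.exit t m))
    (h' : S.ViewIn f P s (.exit t' m')) : View.exit t m = View.exit t' m' := by
  obtain ⟨j, hj, htP, h⟩ := h
  obtain ⟨j', hj', htP', h'⟩ := h'
  rcases lt_trichotomy j j' with hlt | rfl | hlt
  · exact absurd (h'.mem j t (by omega) hlt h.reach) htP
  · obtain rfl : t = t' := Option.some_injective _ (h.reach.symm.trans h'.reach)
    obtain ⟨n, u, hn, hu, hc⟩ := h.color
    obtain ⟨n', u', hn', hu', hc'⟩ := h'.color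
    have h1 := h'.color_le n u hn hu
    have h2 := h.color_le n' u' hn' hu'
    rw [show m = m' by omega]
  · exact absurd (h.mem j' t' (by omega) hlt h'.reach) htP'

lemma ViewIn.unique (h : S.ViewIn f P s w) (h' : S.ViewIn f P s w') : w = w' := by
  cases w <;> cases w'
  case unk.unk | top.top | bot.bot => rfl
  case unk.top | unk.bot => exact absurd h (not_viewIn_unk_of_stays h'.1 h'.2.1)
  case top.unk | bot.unk => exact absurd h' (not_viewIn_unk_of_stays h.1 h.2.1)
  case unk.exit => exact absurd h h'.not_unk_of_exit
  case exit.unk => exact absurd h' h.not_unk_of_exit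
  case top.bot => exact absurd h.2.2 h'.2.2
  case bot.top => exact absurd h'.2.2 h.2.2
  case top.exit | bot.exit => exact absurd h' (not_viewIn_exit_of_stays h.2.1)
  case exit.top | exit.bot => exact absurd h (not_viewIn_exit_of_stays h'.2.1)
  case exit.exit => exact h.exit_unique h'

lemma ViewIn.iff_of_common (h : S.ViewIn f P s w) (h' : S.ViewIn f' P s w) (w' : View V) :
    S.ViewIn f P s w' ↔ S.ViewIn f' P s w' :=
  ⟨fun hw => h.unique hw ▸ h', fun hw => h'.unique hw ▸ h⟩

lemma ViewIn.congr (hs : f' s = f s) (hP : ∀ u ∈ P, f' u = f u) (h : S.ViewIn f P s w) :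
    S.ViewIn f' P s w := by
  have key : (∀ n t, 1 ≤ n → iter f s n = some t → t ∈ P) →
      ∀ n u, iter f s n = some u → f' u = f u := fun hin n u hu => by
    rcases Nat.eq_zero_or_pos n with rfl | hn
    · cases hu
      exact hs
    · exact hP u (hin n u hn hu)
  have hiter : (∀ n t, 1 ≤ n → iter f s n = some t → t ∈ P) → iter f' s = iter f s :=
    fun hin => funext fun n => iter_congr fun k _ => key hin k
  cases w with
  | unk => simpa only [ViewIn, hs] using h
  | top =>
    exact ⟨hs ▸ h.1, hiter h.2.1 ▸ h.2.1, (traceWin_congr (key h.2.1)).2 h.2.2⟩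
  | bot =>
    exact ⟨hs ▸ h.1, hiter h.2.1 ▸ h.2.1, fun hw => h.2.2 ((traceWin_congr (key h.2.1)).1 hw)⟩
  | exit t m =>
    obtain ⟨j, hj, htP, h⟩ := h
    exact ⟨j, hj, htP, h.congr hs hP⟩

lemma Segment.stays_of_tail (h : S.Segment f P s t j m) (ht : t ∈ P)
    (hin : ∀ n u, 1 ≤ n → iter f t n = some u → u ∈ P) :
    ∀ n u, 1 ≤ n → iter f s n = some u → u ∈ P := by
  intro n u hn hu
  rcases lt_trichotomy n j with hnj | rfl | hnj
  · exact h.mem n u hn hnj hu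
  · rw [h.reach] at hu
    cases hu
    exact ht
  · obtain ⟨l, rfl⟩ := Nat.exists_eq_add_of_lt hnj
    rw [add_assoc, iter_add h.reach] at hu
    exact hin _ u (by omega) hu

lemma Segment.first_ne_none (hj : 1 ≤ j) (h : S.Segment f P s t j m) : f s ≠ none := by
  obtain ⟨u, hu⟩ := exists_iter_of_le h.reach hj
  rw [iter_one] at hu
  simp [hu]

end Setting

namespace Setting

variable {V : Type u} {𝒱 : Type v}

/-- The bag `K` separates the disjoint regions `P₁` and `P₂` from each other and from the rest of
the game, the vertices of `K` with an edge into `P₂` lie in `K₂`, and all edges leaving `θ ∈ K` lead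
into `P₁`, `P₂` or `K`. -/
structure Separates (S : Setting V 𝒱) (P₁ P₂ K K₂ : Set V) (θ : V) : Prop where
  mem : θ ∈ K
  notMem_left : ∀ s ∈ K, s ∉ P₁
  notMem_right : ∀ s ∈ K, s ∉ P₂
  disjoint : ∀ s ∈ P₁, s ∉ P₂
  edge_left : ∀ s t, S.E s t → s ∈ P₁ → t ∈ P₁ ∨ t ∈ K
  edge_right : ∀ s t, S.E s t → s ∈ P₂ → t ∈ P₂ ∨ t ∈ K
  edge_into_right : ∀ s t, S.E s t → s ∈ K → t ∈ P₂ → s ∈ K₂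
  edge_vertex : ∀ t, S.E θ t → t ∈ P₁ ∨ t ∈ P₂ ∨ t ∈ K

/-- The trace of `f` from `s` stays in `P` until it reaches `t`, having seen maximal color `m`. -/
def Returns (S : Setting V 𝒱) (f : V → Option V) (P : Set V) (s t : V) (m : ℕ) : Prop :=
  ∃ j, 1 ≤ j ∧ S.Segment f P s t j m

variable {S : Setting V 𝒱} {f f' F g h : V → Option V} {P Q K : Set V} {s t θ : V} {m m' : ℕ}
  {w : View V}

lemma mem_Bsel_true (hs : s ∈ S.V0) : true ∈ S.Bsel g s t ↔ g s = some t := by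
  simp [Bsel, hs]

lemma Ext.eq_of_mem (hf : S.Ext f g) (hs : s ∈ S.V0) : f s = g s := (hf.2.1 s hs).symm

lemma Ext.edge (hf : S.Ext f g) (hst : f s = some t) : S.E s t := (hf.1 s t hst).2

lemma Returns.viewIn_of_tail (hr : S.Returns f P s θ m) (hθ : θ ∈ P)
    (hin : ∀ n u, 1 ≤ n → iter f θ n = some u → u ∈ P) :
    (S.TraceWin f θ → S.ViewIn f P s .top) ∧ (¬ S.TraceWin f θ → S.ViewIn f P s .bot) := by
  obtain ⟨j, hj, hr⟩ := hr
  have h0 := hr.first_ne_none hj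
  have hst := hr.stays_of_tail hθ hin
  rw [← traceWin_iff_of_iter hr.reach]
  exact ⟨fun hw => ⟨.inl h0, hst, hw⟩, fun hw => ⟨.inl h0, hst, hw⟩⟩

lemma Returns.exit_of_step (hr : S.Returns f P s θ m) (hθ : θ ∈ P) (ht : f θ = some t)
    (htP : t ∉ P) : S.ViewIn f P s (.exit t (max m (S.c θ))) := by
  obtain ⟨j, hj, hr⟩ := hr
  exact ⟨j + 1, by omega, htP, hr.append hθ (Segment.single ht)⟩

lemma Returns.exit_of_exit (hr : S.Returns f P s θ m) (hθ : θ ∈ P)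
    (h : S.ViewIn f P θ (.exit t m')) : S.ViewIn f P s (.exit t (max m m')) := by
  obtain ⟨j, hj, hr⟩ := hr
  obtain ⟨k, hk, htP, h⟩ := h
  exact ⟨j + k, by omega, htP, hr.append hθ h⟩

lemma Returns.stays_of_loop (hr : S.Returns f P θ θ m) (hθ : θ ∈ P) :
    ∀ n u, 1 ≤ n → iter f θ n = some u → u ∈ P := by
  obtain ⟨k, hk, hr⟩ := hr
  intro n u hn hu
  rw [iter_mod hr.reach] at hu
  rcases Nat.eq_zero_or_pos (n % k) with h0 | h0
  · rw [h0] at hu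
    cases hu
    exact hθ
  · exact hr.mem _ u h0 (Nat.mod_lt n hk) hu

lemma Returns.viewIn_of_loop (hr : S.Returns f P s θ m) (hθ : θ ∈ P)
    (h : S.Returns f P θ θ m') :
    S.ViewIn f P s (open Classical in if Even m' then .top else .bot) := by
  have key := hr.viewIn_of_tail hθ (h.stays_of_loop hθ)
  obtain ⟨k, hk, h⟩ := h
  rw [h.traceWin_loop hk] at key
  split_ifs with hm
  exacts [key.1 hm, key.2 hm]

/-- If `f` and `F` have, from every vertex of `K`, either a common view relative to `P` or a common
return to `θ`, then they have the same views from `K`. -/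
lemma exists_common_view (hθP : θ ∈ P) (hθK : θ ∈ K)
    (hstep : ∀ s ∈ K, (∃ w, S.ViewIn f P s w ∧ S.ViewIn F P s w) ∨
      ∃ m, S.Returns f P s θ m ∧ S.Returns F P s θ m)
    (hθ : ∀ t, f θ = some t → t ∉ P → F θ = some t) (hs : s ∈ K) :
    ∃ w, S.ViewIn f P s w ∧ S.ViewIn F P s w := by
  rcases hstep s hs with hw | ⟨m, hf, hF⟩
  · exact hw
  rcases hstep θ hθK with ⟨w, hfw, hFw⟩ | ⟨m', hf', hF'⟩
  · cases w with
    | unk =>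
      rcases hfw with ⟨-, hn⟩ | ⟨t, ht, htP⟩
      · exact absurd hθP hn
      · exact ⟨_, hf.exit_of_step hθP ht htP, hF.exit_of_step hθP (hθ t ht htP) htP⟩
    | top =>
      exact ⟨.top, (hf.viewIn_of_tail hθP hfw.2.1).1 hfw.2.2,
        (hF.viewIn_of_tail hθP hFw.2.1).1 hFw.2.2⟩
    | bot =>
      exact ⟨.bot, (hf.viewIn_of_tail hθP hfw.2.1).2 hfw.2.2,
        (hF.viewIn_of_tail hθP hFw.2.1).2 hFw.2.2⟩
    | exit t m' => exact ⟨_, hf.exit_of_exit hθP hfw, hF.exit_of_exit hθP hFw⟩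
  · exact ⟨_, hf.viewIn_of_loop hθP hf', hF.viewIn_of_loop hθP hF'⟩

lemma ViewIn.exit_mem (hf : S.Ext f g) (hQ : ∀ s t, S.E s t → s ∈ Q → t ∈ Q ∨ t ∈ K)
    (h : S.ViewIn f Q s (.exit t m)) : t ∈ K := by
  obtain ⟨j, hj, htQ, h⟩ := h
  obtain ⟨l, rfl⟩ := Nat.exists_eq_add_of_le' (show 1 ≤ j by omega)
  obtain ⟨u, hu⟩ := exists_iter_of_le h.reach l.le_succ
  have hut : f u = some t := by rw [← iter_succ_of_eq_some hu, h.reach]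
  exact (hQ u t (hf.edge hut) (h.mem l u (by omega) (by omega) hu)).resolve_left htQ

/-- Selectors with a common view relative to a region `Q ⊆ P` which they enter and which is left
only through `K` have a common view relative to `P`, unless both return to `θ`. -/
lemma common_view_or_returns (hf : S.Ext f g) (hQP : Q ⊆ P)
    (hQ : ∀ s t, S.E s t → s ∈ Q → t ∈ Q ∨ t ∈ K) (hKP : ∀ t ∈ K, t ∈ P → t = θ)
    (hfw : S.ViewIn f Q s w) (hFw : S.ViewIn F Q s w) (hw : w ≠ .unk) :
    (∃ w, S.ViewIn f P s w ∧ S.ViewIn F P s w) ∨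
      ∃ m, S.Returns f P s θ m ∧ S.Returns F P s θ m := by
  cases w with
  | unk => exact absurd rfl hw
  | top =>
    exact .inl ⟨.top, ⟨hfw.1.imp_right (hQP ·), fun n t h1 h2 => hQP (hfw.2.1 n t h1 h2), hfw.2.2⟩,
      ⟨hFw.1.imp_right (hQP ·), fun n t h1 h2 => hQP (hFw.2.1 n t h1 h2), hFw.2.2⟩⟩
  | bot =>
    exact .inl ⟨.bot, ⟨hfw.1.imp_right (hQP ·), fun n t h1 h2 => hQP (hfw.2.1 n t h1 h2), hfw.2.2⟩,
      ⟨hFw.1.imp_right (hQP ·), fun n t h1 h2 => hQP (hFw.2.1 n t h1 h2), hFw.2.2⟩⟩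
  | exit t m =>
    have htK := hfw.exit_mem hf hQ
    obtain ⟨j, hj, -, hf⟩ := hfw
    obtain ⟨j', hj', -, hF⟩ := hFw
    by_cases htP : t ∈ P
    · obtain rfl := hKP t htK htP
      exact .inr ⟨m, ⟨j, by omega, hf.mono hQP⟩, ⟨j', by omega, hF.mono hQP⟩⟩
    · exact .inl ⟨.exit t m, ⟨j, hj, htP, hf.mono hQP⟩, ⟨j', hj', htP, hF.mono hQP⟩⟩

lemma ViewIn.unk_of_forall (hs : s ∉ P) (h : ∀ t, f s = some t → t ∉ P) :
    S.ViewIn f P s .unk := by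
  cases hfs : f s with
  | none => exact .inl ⟨hfs, hs⟩
  | some t => exact .inr ⟨t, hfs, h t hfs⟩

lemma ViewIn.notMem_of_unk (h : S.ViewIn f P s .unk) (ht : f s = some t) : t ∉ P := by
  rcases h with ⟨h, -⟩ | ⟨u, hu, huP⟩
  · simp [h] at ht
  · rw [ht] at hu
    cases hu
    exact huP

/-- Gluing: an extension of `h` realizing the views of `f` relative to `P₁` and one realizing the
views of `f` relative to `P₂` combine to an extension of `h` realizing the views of `f` relative to
`P₁ ∪ P₂ ∪ {θ}`. -/
theorem exists_ext_common_view {P₁ P₂ K K₂ : Set V} {f₁ f₂ : V → Option V}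
    (hsep : S.Separates P₁ P₂ K K₂ θ) (hf : S.Ext f g) (hf₁ : S.Ext f₁ h) (hf₂ : S.Ext f₂ h)
    (hv₁ : ∀ s ∈ K, ∀ w, S.ViewIn f P₁ s w → S.ViewIn f₁ P₁ s w)
    (hv₂ : ∀ s ∈ K, s ∈ K₂ → ∀ w, S.ViewIn f P₂ s w → S.ViewIn f₂ P₂ s w)
    (hB : ∀ s ∈ K, S.Bsel g θ s = S.Bsel h θ s ∧ S.Bsel g s θ = S.Bsel h s θ) :
    ∃ F, S.Ext F h ∧ ∀ s ∈ K, ∀ w, S.ViewIn f (insert θ (P₁ ∪ P₂)) s w ↔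
      S.ViewIn F (insert θ (P₁ ∪ P₂)) s w := by
  classical
  let F : V → Option V := fun u =>
    if u ∈ P₁ ∨ u ∈ K ∧ ∃ t ∈ P₁, f u = some t then f₁ u
    else if u ∈ P₂ ∨ u ∈ K ∧ ∃ t ∈ P₂, f u = some t then f₂ u
    else if u ∈ S.V0 then h u else f u
  have hF : S.Ext F h := by
    refine ⟨fun s t hst => ⟨trivial, ?_⟩, fun s hs => ?_, hf₁.2.2⟩
    · simp only [F] at hst
      split_ifs at hst with _ _ h0
      · exact hf₁.edge hst
      · exact hf₂.edge hst
      · exact hf₁.edge ((hf₁.eq_of_mem h0).trans hst)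
      · exact hf.edge hst
    · simp only [F, if_pos hs, hf₁.eq_of_mem hs, hf₂.eq_of_mem hs, ite_self]
  have hF₁ : ∀ u, u ∈ P₁ ∨ u ∈ K ∧ (∃ t ∈ P₁, f u = some t) → F u = f₁ u := fun u hu => if_pos hu
  have hF₂ : ∀ u, u ∈ P₂ ∨ u ∈ K ∧ (∃ t ∈ P₂, f u = some t) → F u = f₂ u := fun u hu => by
    refine (if_neg ?_).trans (if_pos hu)
    rcases hu with hu | ⟨hu, t, ht, hut⟩
    · rintro (h | ⟨h, -⟩)
      exacts [hsep.disjoint u h hu, hsep.notMem_right u h hu]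
    · rintro (h | ⟨-, t', ht', hut'⟩)
      · exact hsep.notMem_left u hu h
      · rw [hut] at hut'
        cases hut'
        exact hsep.disjoint t ht' ht
  have hF₃ : ∀ u ∈ K, (∀ t, f u = some t → t ∉ P₁ ∧ t ∉ P₂) →
      F u = if u ∈ S.V0 then h u else f u := fun u hu ht => by
    refine (if_neg ?_).trans (if_neg ?_)
    · rintro (h | ⟨-, t, htP, hut⟩)
      exacts [hsep.notMem_left u hu h, (ht t hut).1 htP]
    · rintro (h | ⟨-, t, htP, hut⟩)
      exacts [hsep.notMem_right u hu h, (ht t hut).2 htP]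
  have hg_eq : ∀ u ∈ S.V0, f u = g u := fun u hu => hf.eq_of_mem hu
  have hto : ∀ u ∈ K, u ∈ S.V0 → (h u = some θ ↔ f u = some θ) := fun u hu h0 => by
    rw [hg_eq u h0, ← mem_Bsel_true h0, ← mem_Bsel_true h0, (hB u hu).2]
  have hfrom : ∀ u ∈ K, θ ∈ S.V0 → (h θ = some u ↔ f θ = some u) := fun u hu h0 => by
    rw [hg_eq θ h0, ← mem_Bsel_true h0, ← mem_Bsel_true h0, (hB u hu).1]
  set P : Set V := insert θ (P₁ ∪ P₂) with hP
  have hθP : θ ∈ P := Set.mem_insert _ _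
  have hP₁ : P₁ ⊆ P := fun u hu => .inr (.inl hu)
  have hP₂ : P₂ ⊆ P := fun u hu => .inr (.inr hu)
  have hKP : ∀ t ∈ K, t ∈ P → t = θ := by
    rintro t htK (rfl | ht | ht)
    exacts [rfl, absurd ht (hsep.notMem_left t htK), absurd ht (hsep.notMem_right t htK)]
  have hout : ∀ s ∈ K, (∀ t, f s = some t → t ∉ P₁ ∧ t ∉ P₂) →
      ∀ t, F s = some t → t ∉ P₁ ∧ t ∉ P₂ := by
    intro s hs hnot t ht
    by_cases h0 : s ∈ S.V0
    · have hh : h s = some t := by rwa [hF₃ s hs hnot, if_pos h0] at ht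
      refine ⟨?_, fun htP => ?_⟩
      · exact (hv₁ s hs _ (.unk_of_forall (hsep.notMem_left s hs) fun t ht => (hnot t ht).1)
          ).notMem_of_unk ((hf₁.eq_of_mem h0).trans hh)
      · have hs₂ := hsep.edge_into_right s t (hF.edge ht) hs htP
        exact (hv₂ s hs hs₂ _ (.unk_of_forall (hsep.notMem_right s hs) fun t ht => (hnot t ht).2)
          ).notMem_of_unk ((hf₂.eq_of_mem h0).trans hh) htP
    · rw [hF₃ s hs hnot, if_neg h0] at ht
      exact hnot t ht
  have hθF : (∀ t, f θ = some t → t ∉ P₁ ∧ t ∉ P₂) → F θ = f θ := by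
    intro hnot
    by_cases h0 : θ ∈ S.V0
    · have hFθ : F θ = h θ := by rw [hF₃ θ hsep.mem hnot, if_pos h0]
      refine Option.ext fun t => ⟨fun ht => ?_, fun ht => ?_⟩
      · have hn := hout θ hsep.mem hnot t ht
        have htK := ((hsep.edge_vertex t (hF.edge ht)).resolve_left hn.1).resolve_left hn.2
        exact (hfrom t htK h0).1 (hFθ ▸ ht)
      · have hn := hnot t ht
        have htK := ((hsep.edge_vertex t (hf.edge ht)).resolve_left hn.1).resolve_left hn.2
        rw [hFθ]
        exact (hfrom t htK h0).2 ht
    · rw [hF₃ θ hsep.mem hnot, if_neg h0]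
  have hstep : ∀ s ∈ K, (∃ w, S.ViewIn f P s w ∧ S.ViewIn F P s w) ∨
      ∃ m, S.Returns f P s θ m ∧ S.Returns F P s θ m := by
    intro s hs
    by_cases h₁ : ∃ t ∈ P₁, f s = some t
    · obtain ⟨w, hw⟩ := ViewIn.total (S := S) f P₁ s
      obtain ⟨t, ht, hst⟩ := h₁
      refine common_view_or_returns hf hP₁ hsep.edge_left hKP hw ((hv₁ s hs w hw).congr
        (hF₁ s (.inr ⟨hs, t, ht, hst⟩)) fun u hu => hF₁ u (.inl hu)) ?_
      rintro rfl
      exact hw.notMem_of_unk hst ht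
    by_cases h₂ : ∃ t ∈ P₂, f s = some t
    · obtain ⟨w, hw⟩ := ViewIn.total (S := S) f P₂ s
      obtain ⟨t, ht, hst⟩ := h₂
      have hs₂ := hsep.edge_into_right s t (hf.edge hst) hs ht
      refine common_view_or_returns hf hP₂ hsep.edge_right hKP hw ((hv₂ s hs hs₂ w hw).congr
        (hF₂ s (.inr ⟨hs, t, ht, hst⟩)) fun u hu => hF₂ u (.inl hu)) ?_
      rintro rfl
      exact hw.notMem_of_unk hst ht
    have hnot : ∀ t, f s = some t → t ∉ P₁ ∧ t ∉ P₂ := fun t ht =>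
      ⟨fun htP => h₁ ⟨t, htP, ht⟩, fun htP => h₂ ⟨t, htP, ht⟩⟩
    have hFs := hF₃ s hs hnot
    have hθs : F s = some θ ↔ f s = some θ := by
      by_cases h0 : s ∈ S.V0
      · rw [hFs, if_pos h0, hto s hs h0]
      · rw [hFs, if_neg h0]
    by_cases hsθ : f s = some θ
    · exact .inr ⟨S.c s, ⟨1, le_rfl, .single hsθ⟩, ⟨1, le_rfl, .single (hθs.2 hsθ)⟩⟩
    have hnotP : ∀ t, f s = some t → t ∉ P := by
      rintro t ht (rfl | h | h)
      exacts [hsθ ht, (hnot t ht).1 h, (hnot t ht).2 h]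
    have hFnotP : ∀ t, F s = some t → t ∉ P := by
      rintro t ht (rfl | h | h)
      exacts [hsθ (hθs.1 ht), (hout s hs hnot t ht).1 h, (hout s hs hnot t ht).2 h]
    left
    by_cases hsP : s ∈ P
    · obtain rfl := hKP s hs hsP
      cases hfs : f s with
      | some t =>
        exact ⟨.unk, .inr ⟨t, hfs, hnotP t hfs⟩, .inr ⟨t, (hθF hnot).trans hfs, hnotP t hfs⟩⟩
      | none =>
        have hFs := (hθF hnot).trans hfs
        have hin : ∀ f : V → Option V, f s = none → ∀ n t, 1 ≤ n → iter f s n = some t → t ∈ P := by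
          intro f hfs n t hn ht
          obtain ⟨u, hu⟩ := exists_iter_of_le ht hn
          rw [iter_one, hfs] at hu
          cases hu
        by_cases h0 : s ∈ S.V0
        · exact ⟨.bot, ⟨.inr hsP, hin f hfs, fun hw => (traceWin_of_none hfs).1 hw h0⟩,
            ⟨.inr hsP, hin F hFs, fun hw => (traceWin_of_none hFs).1 hw h0⟩⟩
        · exact ⟨.top, ⟨.inr hsP, hin f hfs, (traceWin_of_none hfs).2 h0⟩,
            ⟨.inr hsP, hin F hFs, (traceWin_of_none hFs).2 h0⟩⟩
    · exact ⟨.unk, .unk_of_forall hsP hnotP, .unk_of_forall hsP hFnotP⟩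
  refine ⟨F, hF, fun s hs w => ?_⟩
  have hθstep : ∀ t, f θ = some t → t ∉ P → F θ = some t := by
    intro t ht htP
    refine (hθF fun u hu => ?_).trans ht
    rw [ht] at hu
    cases hu
    exact ⟨fun h => htP (hP₁ h), fun h => htP (hP₂ h)⟩
  obtain ⟨w₀, h1, h2⟩ := exists_common_view hθP hsep.mem hstep hθstep hs
  exact h1.iff_of_common h2 w

end Setting

section Traversal

variable {V : Type u} {𝒱 : Type v} {E : V → V → Prop} {T : SimpleGraph 𝒱} {B : 𝒱 → Finset V}
  {root v v' x y r : 𝒱} {vs : ℕ → 𝒱} {ℓ i k : ℕ} {s t θ : V}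

lemma mem_thetaLe_succ :
    x ∈ ThetaLe T root vs (k + 1) ↔ x ∈ ThetaLe T root vs k ∨ x ∈ Theta T root vs (k + 1) := by
  constructor
  · rintro ⟨j, h1, h2, hx⟩
    rcases h2.lt_or_eq with h | rfl
    · exact .inl ⟨j, h1, by omega, hx⟩
    · exact .inr hx
  · rintro (⟨j, h1, h2, hx⟩ | hx)
    · exact ⟨j, h1, by omega, hx⟩
    · exact ⟨k + 1, by omega, le_rfl, hx⟩

lemma thetaLe_of_anc (hxy : Anc T root x y) (hy : y ∈ ThetaLe T root vs k) :
    x ∈ ThetaLe T root vs k := by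
  obtain ⟨j, h1, h2, hy⟩ := hy
  exact ⟨j, h1, h2, hxy.trans hy⟩

lemma mem_psiLe : s ∈ PsiLe T root vs B k ↔ ∃ x ∈ ThetaLe T root vs k, s ∈ B x := by
  constructor
  · rintro ⟨j, h1, h2, x, hx, hs⟩
    exact ⟨x, ⟨j, h1, h2, hx⟩, hs⟩
  · rintro ⟨x, ⟨j, h1, h2, hx⟩, hs⟩
    exact ⟨j, h1, h2, x, hx, hs⟩

lemma IsBagRoot.mem_psiLe_iff (hr : IsBagRoot T root B s r) :
    s ∈ PsiLe T root vs B k ↔ r ∈ ThetaLe T root vs k := by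
  rw [mem_psiLe]
  exact ⟨fun ⟨x, hx, hs⟩ => thetaLe_of_anc (hr.2 x hs) hx, fun h => ⟨r, h, hr.1⟩⟩

/-- If step `k + 1` of the traversal uncovers a new vertex, it enters a new node whose bag contains
that vertex. -/
lemma IsDFT.fresh_node (hT : T.IsTree) (hvs : IsDFT T root ℓ vs) (hk : k + 1 ≤ ℓ)
    (h1 : s ∈ PsiLe T root vs B (k + 1)) (h0 : s ∉ PsiLe T root vs B k) :
    vs (k + 1) ∉ ThetaLe T root vs k ∧
      (∀ x, x ∈ ThetaLe T root vs (k + 1) ↔ x ∈ ThetaLe T root vs k ∨ x = vs (k + 1)) ∧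
      s ∈ B (vs (k + 1)) := by
  rw [mem_psiLe] at h1 h0
  obtain ⟨x, hx, hs⟩ := h1
  have hxk : x ∉ ThetaLe T root vs k := fun h => h0 ⟨x, h, hs⟩
  have hxθ := (mem_thetaLe_succ.1 hx).resolve_left hxk
  have hsub : ∀ y ∈ Theta T root vs (k + 1), y ∈ ThetaLe T root vs k ∨ y = vs (k + 1) := by
    intro y hy
    rcases Nat.eq_zero_or_pos k with rfl | hk0
    · right
      rw [Theta, Set.mem_ofPred_eq, zero_add, hvs.first] at hy
      rw [hy.eq_root, zero_add, hvs.first]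
    · rcases isChild_or_isChild_of_adj hT root (hvs.adj k hk0 (by omega)) with h | h
      · exact ((h.2 y).1 hy).imp_left fun hy => ⟨k, hk0, le_rfl, hy⟩
      · exact .inl ⟨k, hk0, le_rfl, (h.2 y).2 (.inl hy)⟩
  obtain rfl := (hsub x hxθ).resolve_left hxk
  refine ⟨hxk, fun y => ?_, hs⟩
  rw [mem_thetaLe_succ]
  constructor
  · rintro (hy | hy)
    exacts [.inl hy, hsub y hy]
  · rintro (hy | rfl)
    exacts [.inl hy, .inr (Anc.refl _ _ _)]

lemma IsDFT.exists_index (hT : T.IsTree) (hvs : IsDFT T root ℓ vs) (x : 𝒱) :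
    ∃ j, 1 ≤ j ∧ j ≤ ℓ ∧ vs j = x := by
  by_cases hx : x = root
  · exact ⟨1, le_rfl, hvs.one_le, hvs.first.trans hx.symm⟩
  · obtain ⟨p⟩ := hT.connected.preconnected x root
    cases p with
    | nil => exact absurd rfl hx
    | cons hadj q =>
      obtain ⟨j, ⟨h1, h2, h3, -⟩, -⟩ := hvs.once _ _ hadj
      exact ⟨j, h1, h2.le, h3⟩

/-- If the traversal goes back up right after entering a new node, this node has no proper
descendants. -/
lemma IsDFT.eq_of_anc_of_isChild (hT : T.IsTree) (hvs : IsDFT T root ℓ vs) (hk : k + 1 < ℓ)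
    (hnew : vs (k + 1) ∉ ThetaLe T root vs k) (hup : IsChild T root (vs (k + 2)) (vs (k + 1)))
    (hx : Anc T root (vs (k + 1)) x) : x = vs (k + 1) := by
  set v := vs (k + 1) with hv
  have hparent : ∀ a, T.Adj a v → ¬ Anc T root v a → a = vs (k + 2) := fun a hadj ha =>
    (isChild_of_adj_of_not_anc hT hadj ha).parent_unique hT hup
  have hk0 : 1 ≤ k := by
    by_contra h
    obtain rfl : k = 0 := by omega
    refine hup.1 ?_
    rw [hv, zero_add, hvs.first]
    exact Anc.root_anc _ _ _
  have hkv : vs k = vs (k + 2) := hparent _ (hvs.adj k hk0 (by omega)) fun h =>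
    hnew ⟨k, hk0, le_rfl, h⟩
  by_contra hne
  obtain ⟨j, hj1, hjℓ, rfl⟩ := hvs.exists_index hT x
  have hjk : k + 2 ≤ j := by
    by_contra hlt
    rcases (show j ≤ k ∨ j = k + 1 by omega) with h | rfl
    · exact hnew ⟨j, hj1, h, hx⟩
    · exact hne rfl
  have hcross : ∀ l, k + 2 ≤ l → l ≤ ℓ → ¬ Anc T root v (vs l) := by
    intro l hl
    induction l, hl using Nat.le_induction with
    | base => exact fun _ => hup.1
    | succ l hl ih =>
      intro hlℓ h
      have hadj := hvs.adj l (by omega) (by omega)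
      have hlv : vs (l + 1) = v := eq_of_adj_of_anc_of_not_anc hT hadj.symm h (ih (by omega))
      have hlp : vs l = vs (k + 2) := hparent _ (hlv ▸ hadj) (ih (by omega))
      have := (hvs.once (vs k) v (hvs.adj k hk0 (by omega))).unique
        ⟨by omega, by omega, hlp.trans hkv.symm, hlv⟩ ⟨hk0, by omega, rfl, rfl⟩
      omega
  exact hcross j hjk hjℓ hx

/-- The vertices attached to a node that is new at step `k + 1` are those whose bags lie below
that node. -/
lemma psiGtAt_of_fresh (hT : T.IsTree) (hnew : v ∉ ThetaLe T root vs k)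
    (hle : ∀ x, x ∈ ThetaLe T root vs (k + 1) ↔ x ∈ ThetaLe T root vs k ∨ x = v) :
    s ∈ PsiGtAt T root vs B (k + 1) v ↔ ∃ r, IsBagRoot T root B s r ∧ Anc T root v r := by
  constructor
  · rintro ⟨-, r, hr, h, -⟩
    exact ⟨r, hr, h⟩
  · rintro ⟨r, hr, h⟩
    refine ⟨fun hs => hnew (thetaLe_of_anc h (hr.mem_psiLe_iff.1 hs)), r, hr, h,
      (hle v).2 (.inr rfl), fun y hyr hy => ?_⟩
    rcases (hle y).1 hy with hy | rfl
    · exact (Anc.total hT hyr h).resolve_right fun hvy => hnew (thetaLe_of_anc hvy hy)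
    · exact Anc.refl _ _ _

end Traversal

namespace Setting

variable {V : Type u} {𝒱 : Type v} {S : Setting V 𝒱} {f g h : V → Option V} {i j k : ℕ} {x : 𝒱}
  {θ : V}

lemma viewOn_eq_iff {f f' : V → Option V} :
    S.viewOn f i x = S.viewOn f' i x ↔
      ∀ s ∈ S.B x, ∀ w, S.ViewIn f (S.psiGtAt i x) s w ↔ S.ViewIn f' (S.psiGtAt i x) s w := by
  constructor
  · intro H s hs w
    have := congrFun (congrFun H s) w
    simpa only [viewOn, hs, true_and, eq_iff_iff, selView_iff_viewIn] using this
  · intro H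
    funext s w
    simp only [viewOn, eq_iff_iff, selView_iff_viewIn]
    exact and_congr_right fun hs => H s hs w

lemma omega_congr (hP : S.psiGtAt i x = S.psiGtAt j x) : S.omega g i x = S.omega g j x := by
  have : ∀ f, S.viewOn f i x = S.viewOn f j x := fun f => by
    funext s w
    simp only [viewOn, selView_iff_viewIn, hP]
  simp only [omega, this]

lemma exists_ext_viewIn (hω : S.omega g i x = S.omega h i x) (hf : S.Ext f g) :
    ∃ f', S.Ext f' h ∧ ∀ s ∈ S.B x, ∀ w,
      S.ViewIn f (S.psiGtAt i x) s w → S.ViewIn f' (S.psiGtAt i x) s w := by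
  obtain ⟨f', hf', heq⟩ : S.viewOn f i x ∈ S.omega h i x := hω ▸ ⟨f, hf, rfl⟩
  exact ⟨f', hf', fun s hs w => (viewOn_eq_iff.1 heq s hs w).1⟩

lemma omega_eq_of_forall_ext
    (h₁ : ∀ f, S.Ext f g → ∃ F, S.Ext F h ∧ ∀ s ∈ S.B x, ∀ w,
      S.ViewIn f (S.psiGtAt i x) s w ↔ S.ViewIn F (S.psiGtAt i x) s w)
    (h₂ : ∀ f, S.Ext f h → ∃ F, S.Ext F g ∧ ∀ s ∈ S.B x, ∀ w,
      S.ViewIn f (S.psiGtAt i x) s w ↔ S.ViewIn F (S.psiGtAt i x) s w) :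
    S.omega g i x = S.omega h i x := by
  refine Set.Subset.antisymm ?_ ?_
  · rintro _ ⟨f, hf, rfl⟩
    obtain ⟨F, hF, H⟩ := h₁ f hf
    exact ⟨F, hF, viewOn_eq_iff.2 H⟩
  · rintro _ ⟨f, hf, rfl⟩
    obtain ⟨F, hF, H⟩ := h₂ f hf
    exact ⟨F, hF, viewOn_eq_iff.2 H⟩

lemma Sel.ext_self (hg : S.Sel S.V0 g) : S.Ext g g := by
  refine ⟨fun s t hst => ⟨trivial, (hg s t hst).2⟩, fun _ _ => rfl, fun s hs => ?_⟩
  cases hgs : g s with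
  | none => rfl
  | some t => exact absurd (hg s t hgs).1 hs

lemma mem_thetaLe_of_isChild (hdown : IsChild S.T S.root (S.vs (k + 1)) (S.vs (k + 2))) (x : 𝒱) :
    x ∈ ThetaLe S.T S.root S.vs (k + 2) ↔
      x ∈ ThetaLe S.T S.root S.vs (k + 1) ∨ x = S.vs (k + 2) := by
  rw [mem_thetaLe_succ]
  constructor
  · rintro (h | h)
    · exact .inl h
    · exact ((hdown.2 x).1 h).imp_left fun h => ⟨k + 1, by omega, le_rfl, h⟩
  · rintro (h | rfl)
    exacts [.inl h, .inr (Anc.refl _ _ _)]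

/-- `θ` is the only vertex uncovered at step `k + 1`, which enters a new node. -/
structure FreshStep (S : Setting V 𝒱) (k : ℕ) (θ : V) : Prop where
  decomp : IsTreeDecomp S.E S.T S.B
  fresh : S.vs (k + 1) ∉ ThetaLe S.T S.root S.vs k
  mem_iff : ∀ x, x ∈ ThetaLe S.T S.root S.vs (k + 1) ↔
    x ∈ ThetaLe S.T S.root S.vs k ∨ x = S.vs (k + 1)
  bagRoot_iff : ∀ s, IsBagRoot S.T S.root S.B s (S.vs (k + 1)) ↔ s = θ

namespace FreshStep

lemma of_crit [Finite 𝒱] (hD : IsTreeDecomp S.E S.T S.B) (hvs : IsDFT S.T S.root S.len S.vs)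
    (hk : k + 1 ≤ S.len) (hθ1 : (S.psiLe k)ᶜ = insert θ ((S.psiLe (k + 1))ᶜ))
    (hθ2 : θ ∈ S.psiLe (k + 1)) : S.FreshStep k θ := by
  have hθ0 : θ ∉ S.psiLe k := by
    rw [← Set.mem_compl_iff, hθ1]
    exact Set.mem_insert _ _
  obtain ⟨h1, h2, h3⟩ := hvs.fresh_node hD.1 hk hθ2 hθ0
  refine ⟨hD, h1, h2, fun s => ⟨fun hs => ?_, ?_⟩⟩
  · have hs0 : s ∈ (S.psiLe k)ᶜ := fun h => h1 (hs.mem_psiLe_iff.1 h)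
    rw [hθ1] at hs0
    exact hs0.resolve_right fun h => h (hs.mem_psiLe_iff.2 ((h2 _).2 (.inr rfl)))
  · rintro rfl
    obtain ⟨r, hr⟩ := hD.exists_isBagRoot S.root s
    have hr1 := ((h2 r).1 (hr.mem_psiLe_iff.1 hθ2)).resolve_left
      fun h => hθ0 (hr.mem_psiLe_iff.2 h)
    rwa [← hr1]

lemma theta_mem (H : S.FreshStep k θ) : θ ∈ S.B (S.vs (k + 1)) := ((H.bagRoot_iff θ).2 rfl).1

lemma mem_psiGtAt_iff (H : S.FreshStep k θ) (s : V) : s ∈ S.psiGtAt (k + 1) (S.vs (k + 1)) ↔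
    ∃ r, IsBagRoot S.T S.root S.B s r ∧ Anc S.T S.root (S.vs (k + 1)) r :=
  psiGtAt_of_fresh H.decomp.1 H.fresh H.mem_iff

lemma eq_of_mem_bag (H : S.FreshStep k θ) {s : V} (hs : s ∈ S.B (S.vs (k + 1)))
    (hs' : s ∈ S.psiGtAt (k + 1) (S.vs (k + 1))) : s = θ := by
  obtain ⟨r, hr, hvr⟩ := (H.mem_psiGtAt_iff s).1 hs'
  obtain rfl := Anc.antisymm H.decomp.1 hvr (hr.2 _ hs)
  exact (H.bagRoot_iff s).1 hr

lemma edge (H : S.FreshStep k θ) [Finite 𝒱] {s t : V} (hst : S.E s t)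
    (hs : s ∈ S.psiGtAt (k + 1) (S.vs (k + 1))) :
    t ∈ S.psiGtAt (k + 1) (S.vs (k + 1)) ∨ t ∈ S.B (S.vs (k + 1)) := by
  obtain ⟨r, hr, hvr⟩ := (H.mem_psiGtAt_iff s).1 hs
  obtain ⟨w, hsw, htw⟩ := H.decomp.2.1 s t hst
  obtain ⟨r', hr'⟩ := H.decomp.exists_isBagRoot S.root t
  by_cases h : Anc S.T S.root (S.vs (k + 1)) r'
  · exact .inl ((H.mem_psiGtAt_iff t).2 ⟨r', hr', h⟩)
  · exact .inr (H.decomp.mem_of_anc_of_not_anc htw hr'.1 (hvr.trans (hr.2 w hsw)) h)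

/-- Away from the new node, the attached vertices do not change in the next step. -/
lemma psiGtAt_eq (H : S.FreshStep k θ)
    (hnext : ∀ y ∈ ThetaLe S.T S.root S.vs (k + 2), y ∈ ThetaLe S.T S.root S.vs (k + 1) ∨
      Anc S.T S.root (S.vs (k + 1)) y)
    (hx : x ∈ S.theta (k + 1)) (hxv : x ≠ S.vs (k + 1)) :
    S.psiGtAt (k + 1) x = S.psiGtAt (k + 2) x := by
  have hvx : ¬ Anc S.T S.root (S.vs (k + 1)) x := fun h => hxv (Anc.antisymm H.decomp.1 hx h)
  have hxle : x ∈ ThetaLe S.T S.root S.vs (k + 1) := ⟨k + 1, by omega, le_rfl, hx⟩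
  ext s
  constructor
  · rintro ⟨hs, r, hr, hxr, -, hlow⟩
    have hvr : ¬ Anc S.T S.root (S.vs (k + 1)) r := fun h =>
      hvx (hlow _ h ((H.mem_iff _).2 (.inr rfl)))
    refine ⟨fun hs' => ?_, r, hr, hxr, mem_thetaLe_succ.2 (.inl hxle), fun y hyr hy => ?_⟩
    · rcases (H.mem_iff r).1 (hr.mem_psiLe_iff.1 hs') with h | rfl
      · exact hs (hr.mem_psiLe_iff.2 h)
      · exact hvr (Anc.refl _ _ _)
    · exact hlow y hyr ((hnext y hy).resolve_right fun h => hvr (h.trans hyr))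
  · rintro ⟨hs, r, hr, hxr, -, hlow⟩
    exact ⟨fun hs' => hs (hr.mem_psiLe_iff.2 ((H.mem_iff r).2 (.inl (hr.mem_psiLe_iff.1 hs')))),
      r, hr, hxr, hxle, fun y hyr hy => hlow y hyr (mem_thetaLe_succ.2 (.inl hy))⟩

lemma fresh_of_down (H : S.FreshStep k θ)
    (hdown : IsChild S.T S.root (S.vs (k + 1)) (S.vs (k + 2))) :
    S.vs (k + 2) ∉ ThetaLe S.T S.root S.vs (k + 1) := by
  intro h
  rcases (H.mem_iff _).1 h with h | h
  · exact H.fresh (thetaLe_of_anc hdown.anc h)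
  · exact hdown.1 (h ▸ Anc.refl _ _ _)

lemma mem_psiGtAt_child_iff (H : S.FreshStep k θ)
    (hdown : IsChild S.T S.root (S.vs (k + 1)) (S.vs (k + 2))) (s : V) :
    s ∈ S.psiGtAt (k + 2) (S.vs (k + 2)) ↔
    ∃ r, IsBagRoot S.T S.root S.B s r ∧ Anc S.T S.root (S.vs (k + 2)) r :=
  psiGtAt_of_fresh H.decomp.1 (H.fresh_of_down hdown) (mem_thetaLe_of_isChild hdown)

lemma mem_psiGtAt_parent_iff (H : S.FreshStep k θ)
    (hdown : IsChild S.T S.root (S.vs (k + 1)) (S.vs (k + 2))) (s : V) :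
    s ∈ S.psiGtAt (k + 2) (S.vs (k + 1)) ↔
    ∃ r, IsBagRoot S.T S.root S.B s r ∧ Anc S.T S.root (S.vs (k + 1)) r ∧ r ≠ S.vs (k + 1) ∧
      ¬ Anc S.T S.root (S.vs (k + 2)) r := by
  constructor
  · rintro ⟨hs, r, hr, hvr, -, hlow⟩
    refine ⟨r, hr, hvr, ?_, fun h => hdown.1 (hlow _ h ((mem_thetaLe_of_isChild hdown _).2
      (.inr rfl)))⟩
    rintro rfl
    exact hs (hr.mem_psiLe_iff.2 ((H.mem_iff _).2 (.inr rfl)))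
  · rintro ⟨r, hr, hvr, hne, hnot⟩
    obtain ⟨-, r', hr', hlow'⟩ := (H.mem_psiGtAt_iff s).2 ⟨r, hr, hvr⟩
    obtain rfl := hr.unique H.decomp.1 hr'
    refine ⟨fun hs => ?_, r, hr, hvr, mem_thetaLe_succ.2 (.inl hlow'.2.1), fun y hyr hy => ?_⟩
    · rcases (H.mem_iff r).1 (hr.mem_psiLe_iff.1 hs) with h | h
      · exact H.fresh (thetaLe_of_anc hvr h)
      · exact hne h
    · rcases (mem_thetaLe_of_isChild hdown y).1 hy with hy | rfl
      · exact hlow'.2.2 y hyr hy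
      · exact absurd hyr hnot

lemma psiGtAt_eq_insert (H : S.FreshStep k θ)
    (hdown : IsChild S.T S.root (S.vs (k + 1)) (S.vs (k + 2))) :
    S.psiGtAt (k + 1) (S.vs (k + 1)) =
    insert θ (S.psiGtAt (k + 2) (S.vs (k + 1)) ∪ S.psiGtAt (k + 2) (S.vs (k + 2))) := by
  ext s
  rw [Set.mem_insert_iff, Set.mem_union, H.mem_psiGtAt_iff, H.mem_psiGtAt_parent_iff hdown,
    H.mem_psiGtAt_child_iff hdown]
  constructor
  · rintro ⟨r, hr, hvr⟩
    by_cases h1 : r = S.vs (k + 1)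
    · exact .inl ((H.bagRoot_iff s).1 (h1 ▸ hr))
    · by_cases h2 : Anc S.T S.root (S.vs (k + 2)) r
      exacts [.inr (.inr ⟨r, hr, h2⟩), .inr (.inl ⟨r, hr, hvr, h1, h2⟩)]
  · rintro (rfl | ⟨r, hr, hvr, -⟩ | ⟨r, hr, h⟩)
    exacts [⟨_, (H.bagRoot_iff s).2 rfl, Anc.refl _ _ _⟩, ⟨r, hr, hvr⟩, ⟨r, hr, hdown.anc.trans h⟩]

/-- The vertices attached to the new node and those attached to its child share no bag. -/
lemma notMem_child_of_mem_parent (H : S.FreshStep k θ)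
    (hdown : IsChild S.T S.root (S.vs (k + 1)) (S.vs (k + 2)))
    {s t : V} {w : 𝒱} (hsw : s ∈ S.B w) (htw : t ∈ S.B w)
    (hs : s ∈ S.psiGtAt (k + 2) (S.vs (k + 1))) : t ∉ S.psiGtAt (k + 2) (S.vs (k + 2)) := by
  intro ht
  obtain ⟨r, hr, hvr, hne, hnot⟩ := (H.mem_psiGtAt_parent_iff hdown s).1 hs
  obtain ⟨r', hr', hvr'⟩ := (H.mem_psiGtAt_child_iff hdown t).1 ht
  have hrv' := (Anc.total H.decomp.1 (hr.2 w hsw) (hvr'.trans (hr'.2 w htw))).resolve_right hnot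
  rcases (hdown.2 r).1 hrv' with h | rfl
  · exact hne (Anc.antisymm H.decomp.1 h hvr)
  · exact hnot (Anc.refl _ _ _)

lemma separates (H : S.FreshStep k θ)
    (hdown : IsChild S.T S.root (S.vs (k + 1)) (S.vs (k + 2))) [Finite 𝒱] :
    S.Separates (S.psiGtAt (k + 2) (S.vs (k + 1)))
    (S.psiGtAt (k + 2) (S.vs (k + 2))) (S.B (S.vs (k + 1))) (S.B (S.vs (k + 2))) θ := by
  have hP := H.psiGtAt_eq_insert hdown
  have hθ₁ : θ ∉ S.psiGtAt (k + 2) (S.vs (k + 1)) := fun h => by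
    obtain ⟨r, hr, -, hne, -⟩ := (H.mem_psiGtAt_parent_iff hdown θ).1 h
    exact hne (hr.unique H.decomp.1 ((H.bagRoot_iff θ).2 rfl))
  have hθ₂ : θ ∉ S.psiGtAt (k + 2) (S.vs (k + 2)) := fun h => by
    obtain ⟨r, hr, hvr⟩ := (H.mem_psiGtAt_child_iff hdown θ).1 h
    obtain rfl := hr.unique H.decomp.1 ((H.bagRoot_iff θ).2 rfl)
    exact hdown.1 hvr
  have hedge : ∀ s t, S.E s t → s ∈ S.psiGtAt (k + 1) (S.vs (k + 1)) →
      t ∈ S.psiGtAt (k + 2) (S.vs (k + 1)) ∨ t ∈ S.psiGtAt (k + 2) (S.vs (k + 2)) ∨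
        t ∈ S.B (S.vs (k + 1)) := by
    intro s t hst hs
    rcases H.edge hst hs with h | h
    · rw [hP] at h
      rcases h with rfl | h | h
      exacts [.inr (.inr H.theta_mem), .inl h, .inr (.inl h)]
    · exact .inr (.inr h)
  have hsub₁ : ∀ s ∈ S.psiGtAt (k + 2) (S.vs (k + 1)), s ∈ S.psiGtAt (k + 1) (S.vs (k + 1)) :=
    fun s hs => hP ▸ .inr (.inl hs)
  have hsub₂ : ∀ s ∈ S.psiGtAt (k + 2) (S.vs (k + 2)), s ∈ S.psiGtAt (k + 1) (S.vs (k + 1)) :=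
    fun s hs => hP ▸ .inr (.inr hs)
  refine ⟨H.theta_mem, fun s hs h => ?_, fun s hs h => ?_, fun s hs => ?_, fun s t hst hs => ?_,
    fun s t hst hs => ?_, fun s t hst hs ht => ?_, fun t hst => ?_⟩
  · exact hθ₁ (H.eq_of_mem_bag hs (hsub₁ s h) ▸ h)
  · exact hθ₂ (H.eq_of_mem_bag hs (hsub₂ s h) ▸ h)
  · obtain ⟨r, hr⟩ := H.decomp.exists_isBagRoot S.root s
    exact H.notMem_child_of_mem_parent hdown hr.1 hr.1 hs
  · obtain ⟨w, hsw, htw⟩ := H.decomp.2.1 s t hst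
    exact (hedge s t hst (hsub₁ s hs)).imp_right fun h =>
      h.resolve_left (H.notMem_child_of_mem_parent hdown hsw htw hs)
  · obtain ⟨w, hsw, htw⟩ := H.decomp.2.1 s t hst
    exact (hedge s t hst (hsub₂ s hs)).resolve_left fun h =>
      H.notMem_child_of_mem_parent hdown htw hsw h hs
  · obtain ⟨w, hsw, htw⟩ := H.decomp.2.1 s t hst
    obtain ⟨r, hr, hvr⟩ := (H.mem_psiGtAt_child_iff hdown t).1 ht
    exact H.decomp.mem_of_anc_of_not_anc hsw hs (hvr.trans (hr.2 w htw)) hdown.1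
  · exact hedge θ t hst (hP ▸ Set.mem_insert _ _)

lemma psiGtAt_eq_singleton (H : S.FreshStep k θ)
    (hleaf : ∀ x, Anc S.T S.root (S.vs (k + 1)) x → x = S.vs (k + 1)) :
    S.psiGtAt (k + 1) (S.vs (k + 1)) = {θ} := by
  ext s
  rw [H.mem_psiGtAt_iff, Set.mem_singleton_iff, ← H.bagRoot_iff]
  constructor
  · rintro ⟨r, hr, hvr⟩
    rwa [← hleaf r hvr]
  · exact fun hr => ⟨_, hr, Anc.refl _ _ _⟩

lemma separates_of_leaf (H : S.FreshStep k θ) [Finite 𝒱]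
    (hleaf : ∀ x, Anc S.T S.root (S.vs (k + 1)) x → x = S.vs (k + 1)) :
    S.Separates ∅ ∅ (S.B (S.vs (k + 1))) ∅ θ := by
  have hP := H.psiGtAt_eq_singleton hleaf
  refine ⟨H.theta_mem, fun _ _ => id, fun _ _ => id, fun _ => False.elim, fun _ _ _ => False.elim,
    fun _ _ _ => False.elim, fun _ _ _ _ => False.elim, fun t ht => .inr (.inr ?_)⟩
  rcases H.edge ht (hP ▸ rfl) with h | h
  · rw [hP] at h
    exact h ▸ H.theta_mem
  · exact h

end FreshStep

end Setting

/-- For a critical index `i ≤ ℓ - 1` with new vertex `θ`, the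
views `ω_i` are determined by the views `ω_{i+1}` together with the vectors
`B(·)_{θ,s}` and `B(·)_{s,θ}` for `s ∈ B (vs i)`. -/
theorem omega_critical_determination {V : Type u} {𝒱 : Type v}
    [Fintype V] [DecidableEq V] [Fintype 𝒱]
    (S : Setting V 𝒱) (hS : S.Standing) (hV : 2 ≤ Fintype.card V)
    (i : ℕ) (hi1 : 1 ≤ i) (hi2 : i ≤ S.len - 1) (hcrit : S.Crit i)
    (θ : V) (hθ1 : (S.psiLe (i - 1))ᶜ = insert θ ((S.psiLe i)ᶜ)) (hθ2 : θ ∈ S.psiLe i)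
    (g h : V → Option V) (hg : S.Sel S.V0 g) (hh : S.Sel S.V0 h)
    (h1 : ∀ x ∈ S.theta (i + 1), S.omega g (i + 1) x = S.omega h (i + 1) x)
    (h2 : ∀ s ∈ S.B (S.vs i), S.Bsel g θ s = S.Bsel h θ s ∧ S.Bsel g s θ = S.Bsel h s θ) :
    ∀ x ∈ S.theta i, S.omega g i x = S.omega h i x := by
  have hD := hS.2.1.1
  have hvs := hS.2.2.1
  obtain ⟨k, rfl⟩ := Nat.exists_eq_add_of_le' hi1
  have hk : k + 1 < S.len := by omega
  have H : S.FreshStep k θ := .of_crit hD hvs hk.le hθ1 hθ2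
  have h2' : ∀ s ∈ (S.B (S.vs (k + 1)) : Set V),
      S.Bsel h θ s = S.Bsel g θ s ∧ S.Bsel h s θ = S.Bsel g s θ :=
    fun s hs => ⟨(h2 s hs).1.symm, (h2 s hs).2.symm⟩
  intro x hx
  rcases isChild_or_isChild_of_adj hD.1 S.root (hvs.adj (k + 1) hi1 hk) with hdown | hup
  · have hx' : x ∈ S.theta (k + 2) := (hdown.2 x).2 (.inl hx)
    by_cases hxv : x = S.vs (k + 1)
    · subst hxv
      have hv' : S.vs (k + 2) ∈ S.theta (k + 2) := Anc.refl _ _ _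
      have hsep := H.separates hdown
      refine Setting.omega_eq_of_forall_ext (fun f hf => ?_) (fun f hf => ?_) <;>
        rw [H.psiGtAt_eq_insert hdown]
      · obtain ⟨f₁, hf₁, hv₁⟩ := Setting.exists_ext_viewIn (h1 _ hx') hf
        obtain ⟨f₂, hf₂, hv₂⟩ := Setting.exists_ext_viewIn (h1 _ hv') hf
        exact Setting.exists_ext_common_view hsep hf hf₁ hf₂ hv₁ (fun s _ => hv₂ s) h2
      · obtain ⟨f₁, hf₁, hv₁⟩ := Setting.exists_ext_viewIn (h1 _ hx').symm hf
        obtain ⟨f₂, hf₂, hv₂⟩ := Setting.exists_ext_viewIn (h1 _ hv').symm hf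
        exact Setting.exists_ext_common_view hsep hf hf₁ hf₂ hv₁ (fun s _ => hv₂ s) h2'
    · have hnext : ∀ y ∈ ThetaLe S.T S.root S.vs (k + 2),
          y ∈ ThetaLe S.T S.root S.vs (k + 1) ∨ Anc S.T S.root (S.vs (k + 1)) y := by
        intro y hy
        rcases (Setting.mem_thetaLe_of_isChild hdown y).1 hy with h | rfl
        exacts [.inl h, .inr hdown.anc]
      have heq := H.psiGtAt_eq hnext hx hxv
      rw [Setting.omega_congr heq, Setting.omega_congr heq, h1 x hx']
  · by_cases hxv : x = S.vs (k + 1)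
    · subst hxv
      have hleaf : ∀ x, Anc S.T S.root (S.vs (k + 1)) x → x = S.vs (k + 1) :=
        fun x => hvs.eq_of_anc_of_isChild hD.1 hk H.fresh hup
      have hsep := H.separates_of_leaf hleaf
      have hP : S.psiGtAt (k + 1) (S.vs (k + 1)) = insert θ (∅ ∪ ∅) := by
        rw [H.psiGtAt_eq_singleton hleaf, Set.empty_union, insert_empty_eq]
      have hunk : ∀ f f' : V → Option V, ∀ s w, S.ViewIn f ∅ s w → S.ViewIn f' ∅ s w :=
        fun f f' s w hw => by
          have hu : ∀ f : V → Option V, S.ViewIn f ∅ s .unk := fun f =>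
            .unk_of_forall id fun _ _ => id
          exact (hu f).unique hw ▸ hu f'
      refine Setting.omega_eq_of_forall_ext (fun f hf => ?_) (fun f hf => ?_) <;> rw [hP]
      · exact Setting.exists_ext_common_view hsep hf hh.ext_self hh.ext_self
          (fun s _ => hunk f h s) (fun s _ _ => hunk f h s) h2
      · exact Setting.exists_ext_common_view hsep hf hg.ext_self hg.ext_self
          (fun s _ => hunk f g s) (fun s _ _ => hunk f g s) h2'
    · have hx' : x ∈ S.theta (k + 2) := ((hup.2 x).1 hx).resolve_right hxv
      have heq := H.psiGtAt_eq (fun y hy => .inl ((mem_thetaLe_succ.1 hy).elim id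
        fun h => ⟨k + 1, hi1, le_rfl, (hup.2 y).2 (.inl h)⟩)) hx hxv
      rw [Setting.omega_congr heq, Setting.omega_congr heq, h1 x hx']
end
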